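/- Let P₁, P₂ : ℝ → ℝ be polynomials with 1 ≤ deg P₁ < deg P₂ and P₁(0) = P₂(0) = 0, and write d₂ = deg P₂. Then there exists a constant c > 0, depending only on P₁ and P₂, such that for every ε > 0 there exists δ > 0 with δ ≥ exp(−exp(c·ε^{−6})) and the following property: for every real N > 1 and every Lebesgue-measurable set S ⊆ [0, N] with Lebesgue measure |S| ≥ εN, there exist x ∈ ℝ and t > δ·N^{1/d₂} such that x ∈ S, x + P₁(t) ∈ S, and x + P₂(t) ∈ S. -/

import Mathlib

open MeasureTheory Polynomial

instance isAddHaarMeasure_volume_prod_prod :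
    (volume : Measure ((ℝ × ℝ) × ℝ)).IsAddHaarMeasure :=
  Measure.prod.instIsAddHaarMeasure _ _

theorem integrable_of_bounded_of_support {α : Type*} [MeasurableSpace α] {μ : Measure α}
    {F : α → ℝ} {s : Set α} {C : ℝ} (hF : Measurable F) (hC : ∀ x, |F x| ≤ C)
    (hs : ∀ x, F x ≠ 0 → x ∈ s) (hμ : μ s ≠ ⊤) : Integrable F μ := by
  refine (integrableOn_iff_integrable_of_support_subset (s := s) (fun x hx => hs x hx)).1 ?_
  exact Measure.integrableOn_of_bounded (f := F) hμ hF.aestronglyMeasurable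
    (M := C) (Filter.Eventually.of_forall fun x => by simpa [Real.norm_eq_abs] using hC x)

theorem abs_integral_le_of_support {α : Type*} [MeasurableSpace α] {μ : Measure α}
    {F : α → ℝ} {s : Set α} {C : ℝ} (hC : ∀ x, |F x| ≤ C)
    (hs : ∀ x, F x ≠ 0 → x ∈ s) (hμ : μ s < ⊤) : |∫ x, F x ∂μ| ≤ C * μ.real s := by
  rw [← setIntegral_eq_integral_of_forall_compl_eq_zero (s := s)
    (fun x hx => by by_contra h; exact hx (hs x h))]
  exact norm_setIntegral_le_of_norm_le_const (f := F) hμ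
    (fun x _ => by simpa [Real.norm_eq_abs] using hC x)

theorem sq_integral_mul_le {α : Type*} [MeasurableSpace α] {μ : Measure α} {f g : α → ℝ}
    (hf : Integrable (fun x => f x ^ 2) μ) (hg : Integrable (fun x => g x ^ 2) μ)
    (hfg : Integrable (fun x => f x * g x) μ) :
    (∫ x, f x * g x ∂μ) ^ 2 ≤ (∫ x, f x ^ 2 ∂μ) * ∫ x, g x ^ 2 ∂μ := by
  have key : ∀ c : ℝ, 0 ≤ (∫ x, g x ^ 2 ∂μ) * (c * c) + (2 * ∫ x, f x * g x ∂μ) * c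
      + ∫ x, f x ^ 2 ∂μ := by
    intro c
    have h : 0 ≤ ∫ x, (f x + c * g x) ^ 2 ∂μ := integral_nonneg fun x => sq_nonneg _
    have e : ∫ x, (f x + c * g x) ^ 2 ∂μ = ∫ x, (f x ^ 2 + (2 * c) * (f x * g x))
        + c ^ 2 * g x ^ 2 ∂μ := by
      congr 1; ext x; ring
    have hI : Integrable (fun x => f x ^ 2 + (2 * c) * (f x * g x)) μ := hf.add (hfg.const_mul _)
    rw [e, integral_add hI (hg.const_mul _),
      integral_add hf (hfg.const_mul _), integral_const_mul, integral_const_mul] at h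
    linarith
  have := discrim_le_zero key
  unfold discrim at this
  nlinarith

theorem abs_mul_mul_sub_le {b c d b' c' d' : ℝ} (hc : |c| ≤ 1) (hd : |d| ≤ 1)
    (hb' : |b'| ≤ 1) (hc' : |c'| ≤ 1) :
    |b * c * d - b' * c' * d'| ≤ |b - b'| + |c - c'| + |d - d'| := by
  have e : b * c * d - b' * c' * d' = (b - b') * (c * d) + (c - c') * (b' * d)
    + (d - d') * (b' * c') := by ring
  rw [e]
  have h1 : |(b - b') * (c * d)| ≤ |b - b'| := by
    rw [abs_mul, abs_mul]
    exact mul_le_of_le_one_right (abs_nonneg _) (mul_le_one₀ hc (abs_nonneg _) hd)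
  have h2 : |(c - c') * (b' * d)| ≤ |c - c'| := by
    rw [abs_mul, abs_mul]
    exact mul_le_of_le_one_right (abs_nonneg _) (mul_le_one₀ hb' (abs_nonneg _) hd)
  have h3 : |(d - d') * (b' * c')| ≤ |d - d'| := by
    rw [abs_mul, abs_mul]
    exact mul_le_of_le_one_right (abs_nonneg _) (mul_le_one₀ hb' (abs_nonneg _) hc')
  exact (abs_add_three _ _ _).trans (by linarith)

/-- The correlation of four translates of `g`. -/
noncomputable def fourCorr (g : ℝ → ℝ) (d₂ d₃ d₄ : ℝ) : ℝ :=
  ∫ y, g y * (g (y + d₂) * g (y + d₃) * g (y + d₄))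

section FourCorr
variable {g : ℝ → ℝ}

theorem integrable_of_support_Icc {F : ℝ → ℝ} {C : ℝ} (hF : Measurable F) (hC : ∀ x, |F x| ≤ C)
    {p q : ℝ} (hs : ∀ x, F x ≠ 0 → x ∈ Set.Icc p q) : Integrable F :=
  integrable_of_bounded_of_support hF hC hs (by simp)

theorem abs_fourCorr_le_one (hg1 : ∀ x, |g x| ≤ 1) (hgs : ∀ x, g x ≠ 0 → x ∈ Set.Icc (0 : ℝ) 1)
    (d₂ d₃ d₄ : ℝ) : |fourCorr g d₂ d₃ d₄| ≤ 1 := by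
  refine (abs_integral_le_of_support (C := 1) (s := Set.Icc (0 : ℝ) 1) ?_ ?_ ?_).trans (by simp)
  · intro x
    rw [abs_mul, abs_mul, abs_mul]
    exact mul_le_one₀ (hg1 _) (by positivity)
      (mul_le_one₀ (mul_le_one₀ (hg1 _) (by positivity) (hg1 _)) (by positivity) (hg1 _))
  · intro x hx; exact hgs x (left_ne_zero_of_mul hx)
  · simp

theorem abs_fourCorr_sub_le (hgm : Measurable g) (hg1 : ∀ x, |g x| ≤ 1)
    (hgs : ∀ x, g x ≠ 0 → x ∈ Set.Icc (0 : ℝ) 1) {m : ℝ}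
    (hmod : ∀ δ, ∫ x, |g (x + δ) - g x| ≤ m * |δ|) (d₂ d₃ d₄ e₂ e₃ e₄ : ℝ) :
    |fourCorr g d₂ d₃ d₄ - fourCorr g e₂ e₃ e₄| ≤
      m * (|d₂ - e₂| + |d₃ - e₃| + |d₄ - e₄|) := by
  have hint : ∀ d, Integrable fun y => g (y + d) := fun d =>
    (integrable_of_support_Icc hgm hg1 hgs).comp_add_right d
  have hint4 : ∀ d₂ d₃ d₄, Integrable fun y => g y * (g (y + d₂) * g (y + d₃) * g (y + d₄)) := by
    intro d₂ d₃ d₄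
    refine integrable_of_support_Icc (C := 1) (p := 0) (q := 1) (by fun_prop) ?_ ?_
    · intro x
      rw [abs_mul, abs_mul, abs_mul]
      exact mul_le_one₀ (hg1 _) (by positivity)
        (mul_le_one₀ (mul_le_one₀ (hg1 _) (by positivity) (hg1 _)) (by positivity) (hg1 _))
    · intro x hx; exact hgs x (left_ne_zero_of_mul hx)
  have hm : ∀ d e, ∫ y, |g (y + d) - g (y + e)| ≤ m * |d - e| := by
    intro d e
    have := integral_add_right_eq_self (μ := volume) (fun y => |g (y + (d - e)) - g y|) e
    refine le_trans (le_of_eq ?_) (hmod (d - e))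
    rw [← this]
    congr 1; ext y
    rw [show y + e + (d - e) = y + d by ring]
  have habs : ∀ d e, Integrable fun y => |g (y + d) - g (y + e)| := fun d e =>
    ((hint d).sub (hint e)).abs
  unfold fourCorr
  rw [← integral_sub (hint4 _ _ _) (hint4 _ _ _)]
  calc |∫ y, (g y * (g (y + d₂) * g (y + d₃) * g (y + d₄))
        - g y * (g (y + e₂) * g (y + e₃) * g (y + e₄)))|
      ≤ ∫ y, |(g y * (g (y + d₂) * g (y + d₃) * g (y + d₄))
        - g y * (g (y + e₂) * g (y + e₃) * g (y + e₄)))| := abs_integral_le_integral_abs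
    _ ≤ ∫ y, (|g (y + d₂) - g (y + e₂)| + |g (y + d₃) - g (y + e₃)|
        + |g (y + d₄) - g (y + e₄)|) := by
        refine integral_mono ((hint4 _ _ _).sub (hint4 _ _ _)).abs
          (((habs _ _).add (habs _ _)).add (habs _ _)) ?_
        intro y
        dsimp only
        rw [← mul_sub, abs_mul]
        refine le_trans (mul_le_of_le_one_left (abs_nonneg _) (hg1 y)) ?_
        exact abs_mul_mul_sub_le (hg1 _) (hg1 _) (hg1 _) (hg1 _)
    _ = (∫ y, |g (y + d₂) - g (y + e₂)|) + (∫ y, |g (y + d₃) - g (y + e₃)|)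
        + ∫ y, |g (y + d₄) - g (y + e₄)| := by
        have hI : Integrable fun y => |g (y + d₂) - g (y + e₂)| + |g (y + d₃) - g (y + e₃)| :=
          (habs _ _).add (habs _ _)
        rw [integral_add hI (habs _ _), integral_add (habs _ _) (habs _ _)]
    _ ≤ _ := by
        have := hm d₂ e₂
        have := hm d₃ e₃
        have := hm d₄ e₄
        rw [mul_add, mul_add]
        linarith

theorem abs_integral_fourCorr_le (hgm : Measurable g) (hg1 : ∀ x, |g x| ≤ 1)
    (hgs : ∀ x, g x ≠ 0 → x ∈ Set.Icc (0 : ℝ) 1) {l : ℝ}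
    (hosc : ∀ x y, |∫ u in x..y, g u| ≤ 2 * l) (d₂ d₃ d₄ : ℝ) {κ r : ℝ} (hκ : κ ≠ 0)
    (hr : 0 ≤ r) :
    |∫ σ in (0 : ℝ)..r, fourCorr g (d₂ + κ * σ) d₃ d₄| ≤ 2 * l / |κ| := by
  unfold fourCorr
  rw [intervalIntegral.integral_of_le hr, integral_integral_swap]
  · have h2 : ∀ y, (∫ σ in Set.Ioc 0 r, g y * (g (y + (d₂ + κ * σ)) * g (y + d₃) * g (y + d₄)))
        = g y * (g (y + d₃) * g (y + d₄)) * ∫ σ in (0 : ℝ)..r, g (y + d₂ + κ * σ) := by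
      intro y
      rw [intervalIntegral.integral_of_le hr, ← integral_const_mul]
      congr 1; ext σ; rw [← add_assoc]; ring
    simp_rw [h2]
    refine (abs_integral_le_of_support (C := 2 * l / |κ|) (s := Set.Icc (0 : ℝ) 1)
      ?_ ?_ ?_).trans (by simp)
    · intro y
      rw [abs_mul]
      have h3 : |g y * (g (y + d₃) * g (y + d₄))| ≤ 1 := by
        rw [abs_mul, abs_mul]
        exact mul_le_one₀ (hg1 _) (by positivity) (mul_le_one₀ (hg1 _) (by positivity) (hg1 _))
      refine (mul_le_of_le_one_left (abs_nonneg _) h3).trans ?_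
      rw [intervalIntegral.integral_comp_add_mul _ hκ, smul_eq_mul, abs_mul, abs_inv,
        div_eq_inv_mul]
      gcongr
      exact hosc _ _
    · intro x hx; exact hgs x (left_ne_zero_of_mul (left_ne_zero_of_mul hx))
    · simp
  · refine integrable_of_bounded_of_support (C := 1) (s := Set.univ ×ˢ Set.Icc (0 : ℝ) 1)
      (by fun_prop) ?_ ?_ ?_
    · rintro ⟨s, x⟩
      simp only [Function.uncurry_apply_pair]
      rw [abs_mul, abs_mul, abs_mul]
      exact mul_le_one₀ (hg1 _) (by positivity)
        (mul_le_one₀ (mul_le_one₀ (hg1 _) (by positivity) (hg1 _)) (by positivity) (hg1 _))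
    · rintro ⟨s, x⟩ hx; exact ⟨trivial, hgs x (left_ne_zero_of_mul hx)⟩
    · rw [Measure.prod_prod]; simp

theorem measurable_fourCorr (hgm : Measurable g) {α : Type*} [MeasurableSpace α]
    {d₂ d₃ d₄ : α → ℝ} (h₂ : Measurable d₂) (h₃ : Measurable d₃) (h₄ : Measurable d₄) :
    Measurable fun z => fourCorr g (d₂ z) (d₃ z) (d₄ z) := by
  unfold fourCorr
  refine (StronglyMeasurable.integral_prod_right' (f := fun p : α × ℝ =>
    g p.2 * (g (p.2 + d₂ p.1) * g (p.2 + d₃ p.1) * g (p.2 + d₄ p.1))) ?_).measurable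
  exact Measurable.stronglyMeasurable (by fun_prop)

end FourCorr

theorem volume_real_closedBall_prod (z : (ℝ × ℝ) × ℝ) {R : ℝ} (hR : 0 ≤ R) :
    volume.real (Metric.closedBall z R) = 8 * R ^ 3 := by
  obtain ⟨⟨x, y⟩, w⟩ := z
  rw [← closedBall_prod_same, ← closedBall_prod_same, Measure.real, Measure.volume_eq_prod,
    Measure.prod_prod, Measure.volume_eq_prod, Measure.prod_prod]
  simp only [Real.volume_closedBall, ENNReal.toReal_mul]
  rw [ENNReal.toReal_ofReal (by positivity)]
  ring

/-- A Lipschitz bump of radius `r` around the origin of three-space. -/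
noncomputable def bump (r : ℝ) (e : (ℝ × ℝ) × ℝ) : ℝ := max 0 (1 - ‖e‖ / r)

section Bump
variable {r : ℝ}

theorem continuous_bump : Continuous (bump r) := by unfold bump; fun_prop

theorem bump_nonneg (e : (ℝ × ℝ) × ℝ) : 0 ≤ bump r e := le_max_left _ _

theorem bump_le_one (hr : 0 < r) (e : (ℝ × ℝ) × ℝ) : bump r e ≤ 1 :=
  max_le zero_le_one (by have := div_nonneg (norm_nonneg e) hr.le; linarith)

theorem norm_le_of_bump_ne_zero (hr : 0 < r) {e : (ℝ × ℝ) × ℝ} (h : bump r e ≠ 0) : ‖e‖ ≤ r := by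
  by_contra! h'
  apply h
  rw [bump, max_eq_left]
  rw [sub_nonpos, one_le_div hr]
  exact h'.le

theorem abs_bump_add_sub_le (hr : 0 < r) (e v : (ℝ × ℝ) × ℝ) :
    |bump r (e + v) - bump r e| ≤ ‖v‖ / r := by
  refine (abs_max_sub_max_le_max _ _ _ _).trans ?_
  rw [sub_self, abs_zero]
  refine max_le (by positivity) ?_
  rw [show 1 - ‖e + v‖ / r - (1 - ‖e‖ / r) = (‖e‖ - ‖e + v‖) / r by ring, abs_div, abs_of_pos hr]
  gcongr
  have := abs_norm_sub_norm_le e (e + v)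
  simpa using this

theorem integrable_bump_mul (hr : 0 < r) {F : (ℝ × ℝ) × ℝ → ℝ} (hF : Measurable F)
    (hF1 : ∀ e, |F e| ≤ 1) : Integrable fun e => bump r e * F e := by
  refine integrable_of_bounded_of_support (C := 1) (s := Metric.closedBall 0 r)
    (continuous_bump.measurable.mul hF) (fun e => ?_) (fun e he => ?_)
    measure_closedBall_lt_top.ne
  · rw [abs_mul, abs_of_nonneg (bump_nonneg e)]
    exact mul_le_one₀ (bump_le_one hr e) (abs_nonneg _) (hF1 e)
  · simpa using norm_le_of_bump_ne_zero hr (left_ne_zero_of_mul he)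

theorem integrable_bump (hr : 0 < r) : Integrable (bump r) := by
  simpa using integrable_bump_mul hr (F := fun _ => 1) measurable_const (by simp)

theorem abs_integral_bump_mul_le (hr : 0 < r) {F : (ℝ × ℝ) × ℝ → ℝ} {B : ℝ} (hB : 0 ≤ B)
    (hF1 : ∀ e, ‖e‖ ≤ r → |F e| ≤ B) : |∫ e, bump r e * F e| ≤ 8 * r ^ 3 * B := by
  refine (abs_integral_le_of_support (C := B) (s := Metric.closedBall 0 r) (fun e => ?_)
    (fun e he => ?_) measure_closedBall_lt_top).trans
    (by rw [volume_real_closedBall_prod _ hr.le]; linarith)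
  · rw [abs_mul, abs_of_nonneg (bump_nonneg e)]
    by_cases h : bump r e = 0
    · rw [h, zero_mul]; exact hB
    · exact (mul_le_of_le_one_left (abs_nonneg _) (bump_le_one hr e)).trans
        (hF1 e (norm_le_of_bump_ne_zero hr h))
  · simpa using norm_le_of_bump_ne_zero hr (left_ne_zero_of_mul he)

theorem half_pow_le_integral_bump (hr : 0 < r) : r ^ 3 / 2 ≤ ∫ e, bump r e := by
  have h1 : ∫ e in Metric.closedBall (0 : (ℝ × ℝ) × ℝ) (r / 2), (1 / 2 : ℝ) = r ^ 3 / 2 := by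
    rw [setIntegral_const, volume_real_closedBall_prod _ (by positivity), smul_eq_mul]; ring
  rw [← h1]
  refine (setIntegral_mono_on (integrableOn_const measure_closedBall_lt_top.ne)
    (integrable_bump hr).integrableOn measurableSet_closedBall fun e he => ?_).trans
    (setIntegral_le_integral (integrable_bump hr) (Filter.Eventually.of_forall bump_nonneg))
  have : ‖e‖ ≤ r / 2 := by simpa using he
  refine le_trans ?_ (le_max_right _ _)
  have : ‖e‖ / r ≤ 1 / 2 := by rw [div_le_iff₀ hr]; linarith
  linarith

theorem abs_integral_bump_mul_shift_le (hr : 0 < r) {F : (ℝ × ℝ) × ℝ → ℝ} (hF : Measurable F)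
    (hF1 : ∀ e, |F e| ≤ 1) {v : (ℝ × ℝ) × ℝ} (hv : ‖v‖ ≤ r) :
    |(∫ e, bump r e * F e) - ∫ e, bump r e * F (e + v)| ≤ 64 * r ^ 2 * ‖v‖ := by
  rw [← integral_add_right_eq_self (fun e => bump r e * F e) v]
  have hi : Integrable fun e => bump r (e + v) * F (e + v) :=
    (integrable_bump_mul hr hF hF1).comp_add_right v
  rw [← integral_sub hi (integrable_bump_mul hr (by fun_prop) (fun e => hF1 _))]
  refine (abs_integral_le_of_support (C := ‖v‖ / r) (s := Metric.closedBall 0 (2 * r))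
    (fun e => ?_) (fun e he => ?_) measure_closedBall_lt_top).trans ?_
  · rw [← sub_mul, abs_mul]
    exact (mul_le_of_le_one_right (abs_nonneg _) (hF1 _)).trans (abs_bump_add_sub_le hr e v)
  · rw [← sub_mul] at he
    have h := left_ne_zero_of_mul he
    simp only [Metric.mem_closedBall, dist_zero_right]
    by_contra! h'
    apply h
    have a1 : bump r e = 0 := by
      by_contra h2
      linarith [norm_le_of_bump_ne_zero hr h2]
    have a2 : bump r (e + v) = 0 := by
      by_contra h2
      have := norm_le_of_bump_ne_zero hr h2
      have := norm_sub_le (e + v) v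
      rw [add_sub_cancel_right] at this
      linarith
    rw [a1, a2, sub_zero]
  · rw [volume_real_closedBall_prod _ (by positivity)]
    refine le_of_eq ?_
    field_simp; ring

/-- Replacing `X Γ` by its average over a bump of radius `r`. -/
theorem abs_integral_mul_le_of_bump {X Γ : (ℝ × ℝ) × ℝ → ℝ} (hX : Measurable X)
    (hΓ : Measurable Γ) (hX1 : ∀ z, |X z| ≤ 1) (hΓ1 : ∀ z, |Γ z| ≤ 1) {L : ℝ}
    (hXL : ∀ z e, |X (z + e) - X z| ≤ L * ‖e‖) {z₀ : (ℝ × ℝ) × ℝ} {R : ℝ} (hR : 0 ≤ R)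
    (hXs : ∀ z, X z ≠ 0 → z ∈ Metric.closedBall z₀ R) (hr : 0 < r) {B : ℝ} (hB : 0 ≤ B)
    {G : Set ((ℝ × ℝ) × ℝ)}
    (hG : ∀ z ∈ G, X z ≠ 0 → |∫ e, bump r e * Γ (z + e)| ≤ r ^ 3 * B)
    {m : ℝ} (hbad : volume.real (Metric.closedBall z₀ R \ G) ≤ m) (hGm : MeasurableSet G) :
    |∫ z, X z * Γ z| ≤ 16 * R ^ 3 * B + 16 * m + L * r * (8 * (R + r) ^ 3) := by
  have hL : 0 ≤ L := by
    have := (abs_nonneg _).trans (hXL 0 ((1, 1), 1))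
    have h1 : ‖(((1 : ℝ), (1 : ℝ)), (1 : ℝ))‖ = 1 := by simp [Prod.norm_def]
    rwa [h1, mul_one] at this
  set Q := ∫ e, bump r e with hQ
  have hQp : r ^ 3 / 2 ≤ Q := half_pow_le_integral_bump hr
  have hQ0 : 0 < Q := lt_of_lt_of_le (by positivity) hQp
  have hmul1 : ∀ z w, |X z * Γ w| ≤ 1 := fun z w => by
    rw [abs_mul]; exact mul_le_one₀ (hX1 _) (abs_nonneg _) (hΓ1 _)
  have hXΓ : Integrable fun z => X z * Γ z :=
    integrable_of_bounded_of_support (C := 1) (hX.mul hΓ) (fun z => hmul1 z z)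
      (fun z hz => hXs z (left_ne_zero_of_mul hz)) measure_closedBall_lt_top.ne
  have hXΓe : ∀ e, Integrable fun z => X z * Γ (z + e) := fun e =>
    integrable_of_bounded_of_support (C := 1) (by fun_prop) (fun z => hmul1 z _)
      (fun z hz => hXs z (left_ne_zero_of_mul hz)) measure_closedBall_lt_top.ne
  -- comparison for a single shift
  have hshift : ∀ e, ‖e‖ ≤ r →
      |(∫ z, X z * Γ z) - ∫ z, X z * Γ (z + e)| ≤ L * r * (8 * (R + r) ^ 3) := by
    intro e he
    rw [← integral_add_right_eq_self (fun z => X z * Γ z) e,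
      ← integral_sub (hXΓ.comp_add_right e) (hXΓe e)]
    refine (abs_integral_le_of_support (C := L * r) (s := Metric.closedBall z₀ (R + r))
      (fun z => ?_) (fun z hz => ?_) measure_closedBall_lt_top).trans
      (le_of_eq (by rw [volume_real_closedBall_prod _ (by positivity)]))
    · rw [← sub_mul, abs_mul]
      refine (mul_le_of_le_one_right (abs_nonneg _) (hΓ1 _)).trans ((hXL z e).trans ?_)
      gcongr
    · rw [← sub_mul] at hz
      have h := left_ne_zero_of_mul hz
      by_contra h'
      apply h
      have a1 : X z = 0 := by
        by_contra h2
        exact h' (Metric.closedBall_subset_closedBall (by linarith) (hXs z h2))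
      have a2 : X (z + e) = 0 := by
        by_contra h2
        apply h'
        have h3 := hXs _ h2
        rw [mem_closedBall_iff_norm] at h3 ⊢
        have := norm_sub_le (z + e - z₀) e
        rw [show z + e - z₀ - e = z - z₀ by abel] at this
        linarith
      rw [a1, a2, sub_zero]
  have hjoint : Integrable (fun p : ((ℝ × ℝ) × ℝ) × ((ℝ × ℝ) × ℝ) =>
      bump r p.1 * (X p.2 * Γ (p.2 + p.1))) (volume.prod volume) := by
    refine integrable_of_bounded_of_support (C := 1)
      (s := Metric.closedBall 0 r ×ˢ Metric.closedBall z₀ R) ?_ ?_ ?_ ?_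
    · have := (continuous_bump (r := r)).measurable
      fun_prop
    · intro p
      rw [abs_mul, abs_of_nonneg (bump_nonneg _)]
      exact mul_le_one₀ (bump_le_one hr _) (abs_nonneg _) (hmul1 _ _)
    · intro p hp
      refine ⟨?_, hXs _ (left_ne_zero_of_mul (right_ne_zero_of_mul hp))⟩
      simpa using norm_le_of_bump_ne_zero hr (left_ne_zero_of_mul hp)
    · rw [Measure.prod_prod]
      exact ENNReal.mul_ne_top measure_closedBall_lt_top.ne measure_closedBall_lt_top.ne
  have hswap : ∫ e, bump r e * ∫ z, X z * Γ (z + e) = ∫ z, X z * ∫ e, bump r e * Γ (z + e) := by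
    have h1 : ∀ e, bump r e * ∫ z, X z * Γ (z + e) = ∫ z, bump r e * (X z * Γ (z + e)) :=
      fun e => (integral_const_mul _ _).symm
    have h2 : ∀ z, X z * ∫ e, bump r e * Γ (z + e) = ∫ e, bump r e * (X z * Γ (z + e)) :=
      fun z => by rw [← integral_const_mul]; congr 1; ext e; ring
    simp_rw [h1, h2]
    exact integral_integral_swap hjoint
  have hmain : |∫ z, X z * ∫ e, bump r e * Γ (z + e)| ≤ 8 * R ^ 3 * (r ^ 3 * B) + 8 * r ^ 3 * m := by
    have hI8 : ∀ z, |∫ e, bump r e * Γ (z + e)| ≤ 8 * r ^ 3 := fun z => by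
      simpa using abs_integral_bump_mul_le hr (F := fun e => Γ (z + e)) zero_le_one
        (fun e _ => hΓ1 _)
    have hbint : Integrable (fun z => (Metric.closedBall z₀ R).indicator (fun _ => r ^ 3 * B) z
        + (Metric.closedBall z₀ R \ G).indicator (fun _ => 8 * r ^ 3) z) := by
      refine Integrable.add ?_ ?_
      · exact (integrable_indicator_iff measurableSet_closedBall).2
          (integrableOn_const measure_closedBall_lt_top.ne)
      · exact (integrable_indicator_iff (measurableSet_closedBall.diff hGm)).2
          (integrableOn_const
            (measure_mono Set.sdiff_subset |>.trans_lt measure_closedBall_lt_top).ne)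
    refine (abs_integral_le_integral_abs).trans ((integral_mono_of_nonneg
      (Filter.Eventually.of_forall fun z => abs_nonneg _) hbint
      (Filter.Eventually.of_forall fun z => ?_)).trans ?_)
    · dsimp only
      by_cases hz : X z = 0
      · rw [hz, zero_mul, abs_zero]
        exact add_nonneg (Set.indicator_nonneg (fun _ _ => by positivity) _)
          (Set.indicator_nonneg (fun _ _ => by positivity) _)
      · rw [abs_mul]
        refine (mul_le_of_le_one_left (abs_nonneg _) (hX1 z)).trans ?_
        rw [Set.indicator_of_mem (hXs z hz)]
        by_cases hg : z ∈ G
        · rw [Set.indicator_of_notMem (fun h => h.2 hg), add_zero]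
          exact hG z hg hz
        · rw [Set.indicator_of_mem (show z ∈ Metric.closedBall z₀ R \ G from ⟨hXs z hz, hg⟩)]
          have := hI8 z
          have : 0 ≤ r ^ 3 * B := by positivity
          linarith
    · rw [integral_add, integral_indicator measurableSet_closedBall,
        integral_indicator (measurableSet_closedBall.diff hGm), setIntegral_const,
        setIntegral_const, volume_real_closedBall_prod _ hR, smul_eq_mul, smul_eq_mul]
      · nlinarith [pow_pos hr 3]
      · exact (integrable_indicator_iff measurableSet_closedBall).2
          (integrableOn_const measure_closedBall_lt_top.ne)
      · exact (integrable_indicator_iff (measurableSet_closedBall.diff hGm)).2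
          (integrableOn_const
            (measure_mono Set.sdiff_subset |>.trans_lt measure_closedBall_lt_top).ne)
  have hdiff : |Q * (∫ z, X z * Γ z) - ∫ e, bump r e * ∫ z, X z * Γ (z + e)|
      ≤ Q * (L * r * (8 * (R + r) ^ 3)) := by
    have hi : Integrable fun e => bump r e * ∫ z, X z * Γ (z + e) := by
      refine (hjoint.integral_prod_left).congr (Filter.Eventually.of_forall fun e => ?_)
      exact integral_const_mul (bump r e) (fun z => X z * Γ (z + e))
    rw [hQ, ← integral_mul_const, ← integral_mul_const,
      ← integral_sub ((integrable_bump hr).mul_const _) hi]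
    refine abs_integral_le_integral_abs.trans (integral_mono_of_nonneg
      (Filter.Eventually.of_forall fun z => abs_nonneg _) ((integrable_bump hr).mul_const _)
      (Filter.Eventually.of_forall fun e => ?_))
    dsimp only
    rw [← mul_sub, abs_mul, abs_of_nonneg (bump_nonneg e)]
    by_cases h : bump r e = 0
    · rw [h]; simp
    · exact mul_le_mul_of_nonneg_left (hshift e (norm_le_of_bump_ne_zero hr h)) (bump_nonneg e)
  rw [hswap] at hdiff
  have hfin : Q * |∫ z, X z * Γ z| ≤ Q * (L * r * (8 * (R + r) ^ 3))
      + (8 * R ^ 3 * (r ^ 3 * B) + 8 * r ^ 3 * m) := by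
    rw [← abs_of_pos hQ0, ← abs_mul, abs_of_pos hQ0]
    have := abs_sub_abs_le_abs_sub (Q * ∫ z, X z * Γ z) (∫ z, X z * ∫ e, bump r e * Γ (z + e))
    linarith
  have hm0 : 0 ≤ m := measureReal_nonneg.trans hbad
  have h2 : 8 * R ^ 3 * (r ^ 3 * B) + 8 * r ^ 3 * m ≤ Q * (16 * R ^ 3 * B + 16 * m) := by
    have : 0 ≤ 16 * R ^ 3 * B + 16 * m := by positivity
    nlinarith
  refine le_of_mul_le_mul_left ?_ hQ0
  linarith

end Bump

theorem abs_integral_bump_mul_le_of_line {r : ℝ} (hr : 0 < r) {Γ : (ℝ × ℝ) × ℝ → ℝ}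
    (hΓ : Measurable Γ) (hΓ1 : ∀ z, |Γ z| ≤ 1) {n : (ℝ × ℝ) × ℝ} {M r' B : ℝ} (hn : ‖n‖ ≤ M)
    (hr' : 0 ≤ r') (hM : r' * M ≤ r) (hB0 : 0 ≤ B)
    (hB : ∀ e, ‖e‖ ≤ r → |∫ σ in (0 : ℝ)..r', Γ (e + σ • n)| ≤ B) :
    r' * |∫ e, bump r e * Γ e| ≤ 64 * r ^ 2 * r' ^ 2 * M + 8 * r ^ 3 * B := by
  have hM0 : 0 ≤ M := (norm_nonneg n).trans hn
  have hbm := (continuous_bump (r := r)).measurable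
  have hjoint : Integrable (fun p : ((ℝ × ℝ) × ℝ) × ℝ => bump r p.1 * Γ (p.1 + p.2 • n))
      (volume.prod (volume.restrict (Set.Ioc 0 r'))) := by
    refine integrable_of_bounded_of_support (C := 1)
      (s := Metric.closedBall 0 r ×ˢ Set.univ) (by fun_prop) ?_ ?_ ?_
    · intro p
      rw [abs_mul, abs_of_nonneg (bump_nonneg _)]
      exact mul_le_one₀ (bump_le_one hr _) (abs_nonneg _) (hΓ1 _)
    · intro p hp
      exact ⟨by simpa using norm_le_of_bump_ne_zero hr (left_ne_zero_of_mul hp), trivial⟩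
    · rw [Measure.prod_prod]
      exact ENNReal.mul_ne_top measure_closedBall_lt_top.ne (by simp)
  have hswap : ∫ σ in (0 : ℝ)..r', (∫ e, bump r e * Γ (e + σ • n))
      = ∫ e, bump r e * ∫ σ in (0 : ℝ)..r', Γ (e + σ • n) := by
    simp_rw [intervalIntegral.integral_of_le hr']
    rw [integral_integral_swap (f := fun σ e => bump r e * Γ (e + σ • n)) hjoint.swap]
    congr 1; ext e
    rw [← integral_const_mul]
  have h1 : |∫ e, bump r e * ∫ σ in (0 : ℝ)..r', Γ (e + σ • n)| ≤ 8 * r ^ 3 * B :=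
    abs_integral_bump_mul_le hr hB0 hB
  have hint : IntervalIntegrable (fun σ => ∫ e, bump r e * Γ (e + σ • n)) volume 0 r' := by
    rw [intervalIntegrable_iff_integrableOn_Ioc_of_le hr']
    exact hjoint.integral_prod_right
  have h2 : |(∫ σ in (0 : ℝ)..r', (∫ e, bump r e * Γ e))
      - ∫ σ in (0 : ℝ)..r', (∫ e, bump r e * Γ (e + σ • n))| ≤ 64 * r ^ 2 * (r' * M) * r' := by
    rw [← intervalIntegral.integral_sub (by simp) hint]
    have := intervalIntegral.norm_integral_le_of_norm_le_const (a := 0) (b := r')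
      (f := fun σ => (∫ e, bump r e * Γ e) - ∫ e, bump r e * Γ (e + σ • n))
      (C := 64 * r ^ 2 * (r' * M)) ?_
    · simpa [abs_of_nonneg hr'] using this
    · intro σ hσ
      rw [Set.uIoc_of_le hr'] at hσ
      have hv : ‖σ • n‖ ≤ r' * M := by
        rw [norm_smul, Real.norm_eq_abs, abs_of_pos hσ.1]
        exact mul_le_mul hσ.2 hn (norm_nonneg _) hr'
      refine (abs_integral_bump_mul_shift_le hr hΓ hΓ1 (hv.trans hM)).trans ?_
      gcongr
  rw [hswap, intervalIntegral.integral_const, smul_eq_mul, sub_zero] at h2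
  have h3 := abs_sub_abs_le_abs_sub (r' * ∫ e, bump r e * Γ e)
    (∫ e, bump r e * ∫ σ in (0 : ℝ)..r', Γ (e + σ • n))
  rw [abs_mul, abs_of_nonneg hr'] at h3
  nlinarith

/-- Quantitative nondegeneracy of the curve `t ↦ (ω t, γ t)` near `a`, at scale `ρ`. -/
structure IsPhase (γ γ1 : ℝ → ℝ) (ω K a ρ : ℝ) : Prop where
  measurable : Measurable γ
  one_le_const : 1 ≤ K
  inv_le_scale : K⁻¹ ≤ ρ
  scale_le_one : ρ ≤ 1
  hasDerivAt : ∀ t ∈ Set.Icc (a - 2 * ρ) (a + 2 * ρ), HasDerivAt γ (γ1 t) t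
  lipschitz : ∀ t ∈ Set.Icc (a - 2 * ρ) (a + 2 * ρ), ∀ s ∈ Set.Icc (a - 2 * ρ) (a + 2 * ρ),
    |γ1 t - γ1 s| ≤ K * |t - s|
  abs_deriv_le : ∀ t ∈ Set.Icc (a - 2 * ρ) (a + 2 * ρ), |γ1 t| ≤ K
  inv_le_abs_deriv : ∀ t ∈ Set.Icc (a - 2 * ρ) (a + 2 * ρ), K⁻¹ ≤ |γ1 t|
  inv_le_abs_sub : ∀ t ∈ Set.Icc (a - 2 * ρ) (a + 2 * ρ), K⁻¹ ≤ |γ1 t - ω|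
  abs_omega_le : |ω| ≤ K
  curved : ∀ t s k, t ∈ Set.Icc (a - 2 * ρ) (a + 2 * ρ) → s ∈ Set.Icc (a - 2 * ρ) (a + 2 * ρ) →
    t + k ∈ Set.Icc (a - 2 * ρ) (a + 2 * ρ) → s + k ∈ Set.Icc (a - 2 * ρ) (a + 2 * ρ) →
    |k| * |t - s| ≤ K * |(1 - γ1 t / γ1 (t + k)) / (γ1 t - ω)
      - (1 - γ1 s / γ1 (s + k)) / (γ1 s - ω)|

theorem abs_sub_sub_deriv_mul_le {γ γ1 : ℝ → ℝ} {K p q : ℝ} (hK : 0 ≤ K)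
    (hd : ∀ t ∈ Set.Icc p q, HasDerivAt γ (γ1 t) t)
    (hl : ∀ t ∈ Set.Icc p q, ∀ s ∈ Set.Icc p q, |γ1 t - γ1 s| ≤ K * |t - s|)
    {x y z : ℝ} (hx : x ∈ Set.Icc p q) (hy : y ∈ Set.Icc p q) (hz : z ∈ Set.Icc p q) :
    |γ z - γ y - γ1 x * (z - y)| ≤ K * |z - y| * (|y - x| + |z - y|) := by
  have hsub : Set.uIcc y z ⊆ Set.Icc p q := Set.uIcc_subset_Icc hy hz
  have := (convex_uIcc y z).norm_image_sub_le_of_norm_hasDerivWithin_le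
    (f := fun u => γ u - γ1 x * u) (f' := fun u => γ1 u - γ1 x)
    (C := K * (|y - x| + |z - y|)) (fun u hu => by
      have h := ((hd u (hsub hu)).sub ((hasDerivAt_id u).const_mul (γ1 x))).hasDerivWithinAt
        (s := Set.uIcc y z)
      rw [mul_one] at h
      exact h)
    (fun u hu => by
      refine (hl u (hsub hu) x hx).trans (mul_le_mul_of_nonneg_left ?_ hK)
      have h1 := abs_add_le (u - y) (y - x)
      have h2 := Set.abs_sub_left_of_mem_uIcc hu
      rw [sub_add_sub_cancel] at h1
      linarith) Set.left_mem_uIcc Set.right_mem_uIcc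
  simp only [Real.norm_eq_abs] at this
  calc _ = |γ z - γ1 x * z - (γ y - γ1 x * y)| := by congr 1; ring
    _ ≤ _ := this
    _ = _ := by ring

section Phase
variable {γ γ1 : ℝ → ℝ} {ω K a ρ β : ℝ}

/-- The first difference of phases. -/
noncomputable def phase₂ (γ : ℝ → ℝ) (β : ℝ) (z : (ℝ × ℝ) × ℝ) : ℝ :=
  β * (γ (z.1.1 + z.2) - γ z.1.1)

/-- The second difference of phases. -/
noncomputable def phase₃ (γ : ℝ → ℝ) (ω β : ℝ) (z : (ℝ × ℝ) × ℝ) : ℝ :=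
  β * ((γ z.1.2 - ω * z.1.2) - (γ z.1.1 - ω * z.1.1))

/-- The third difference of phases. -/
noncomputable def phase₄ (γ : ℝ → ℝ) (ω β : ℝ) (z : (ℝ × ℝ) × ℝ) : ℝ :=
  β * ((γ (z.1.2 + z.2) - ω * z.1.2) - (γ z.1.1 - ω * z.1.1))

theorem IsPhase.exists_direction (h : IsPhase γ γ1 ω K a ρ) (hβ : 0 < β) {t s k : ℝ}
    (ht : t ∈ Set.Icc (a - ρ) (a + ρ)) (hs : s ∈ Set.Icc (a - ρ) (a + ρ))
    (htk : t + k ∈ Set.Icc (a - ρ) (a + ρ)) (hsk : s + k ∈ Set.Icc (a - ρ) (a + ρ)) {r : ℝ}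
    (hr0 : 0 ≤ r) (hr : 4 * r ≤ ρ) :
    ∃ (n : (ℝ × ℝ) × ℝ) (c : ℝ), ‖n‖ ≤ 2 * K ^ 2 ∧ |k| * |t - s| ≤ K ^ 3 * |c| ∧
      ∀ e σ, ‖e‖ ≤ r → 0 ≤ σ → σ * (2 * K ^ 2) ≤ r →
        |phase₂ γ β (((t, s), k) + e + σ • n) - (phase₂ γ β (((t, s), k) + e) + β * c * σ)|
          + |phase₃ γ ω β (((t, s), k) + e + σ • n) - phase₃ γ ω β (((t, s), k) + e)|
          + |phase₄ γ ω β (((t, s), k) + e + σ • n) - phase₄ γ ω β (((t, s), k) + e)|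
          ≤ 96 * β * K ^ 3 * σ * r := by
  have hK := h.one_le_const
  have hK0 : 0 < K := by linarith
  have hρ0 : 0 < ρ := lt_of_lt_of_le (inv_pos.2 hK0) h.inv_le_scale
  have hsub : ∀ x ∈ Set.Icc (a - ρ) (a + ρ), x ∈ Set.Icc (a - 2 * ρ) (a + 2 * ρ) :=
    fun x hx => ⟨by linarith [hx.1], by linarith [hx.2]⟩
  have hA := h.abs_deriv_le _ (hsub _ hs)
  have hB := h.abs_deriv_le _ (hsub _ htk)
  have hAω := h.inv_le_abs_sub _ (hsub _ ht)
  have hA'ω := h.inv_le_abs_sub _ (hsub _ hs)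
  have hBi := h.inv_le_abs_deriv _ (hsub _ htk)
  have hB'i := h.inv_le_abs_deriv _ (hsub _ hsk)
  have hω := h.abs_omega_le
  have hcurv := h.curved t s k (hsub _ ht) (hsub _ hs) (hsub _ htk) (hsub _ hsk)
  have herr : ∀ σ : ℝ, 0 ≤ σ → σ * (2 * K ^ 2) ≤ r → ∀ x ∈ Set.Icc (a - ρ) (a + ρ), ∀ dx v : ℝ,
      |dx| ≤ 2 * r → |v| ≤ 4 * K ^ 2 →
      |γ (x + dx + σ * v) - γ (x + dx) - γ1 x * (σ * v)| ≤ 16 * K ^ 3 * σ * r := by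
    intro σ hσ0 hσ x hx dx v hdx hv
    have hσv : |σ * v| ≤ 2 * r := by
      rw [abs_mul, abs_of_nonneg hσ0]
      nlinarith
    have hσv' : |σ * v| ≤ 4 * K ^ 2 * σ := by
      rw [abs_mul, abs_of_nonneg hσ0]
      nlinarith
    have h1 := abs_le.1 hdx
    have h2 := abs_le.1 hσv
    have key := abs_sub_sub_deriv_mul_le hK0.le h.hasDerivAt h.lipschitz (hsub x hx)
      (y := x + dx) (z := x + dx + σ * v)
      ⟨by linarith [hx.1], by linarith [hx.2]⟩ ⟨by linarith [hx.1], by linarith [hx.2]⟩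
    rw [add_sub_cancel_left, add_sub_cancel_left] at key
    refine key.trans ?_
    calc K * |σ * v| * (|dx| + |σ * v|) ≤ K * (4 * K ^ 2 * σ) * (2 * r + 2 * r) := by gcongr
      _ = _ := by ring
  have hKi : 0 < K⁻¹ := inv_pos.2 hK0
  have hAω0 : γ1 t - ω ≠ 0 := abs_pos.1 (hKi.trans_le hAω)
  have hA'ω0 : γ1 s - ω ≠ 0 := abs_pos.1 (hKi.trans_le hA'ω)
  have hB0 : γ1 (t + k) ≠ 0 := abs_pos.1 (hKi.trans_le hBi)
  have hB'0 : γ1 (s + k) ≠ 0 := abs_pos.1 (hKi.trans_le hB'i)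
  obtain ⟨nt, hnt⟩ : ∃ nt, nt = (γ1 s - ω) / (γ1 t - ω) := ⟨_, rfl⟩
  obtain ⟨nk, hnk⟩ : ∃ nk, nk = γ1 s / γ1 (s + k) - 1 := ⟨_, rfl⟩
  have hntb : |nt| ≤ 2 * K ^ 2 := by
    rw [hnt, abs_div, div_le_iff₀ (abs_pos.2 hAω0)]
    have h1 := abs_sub (γ1 s) ω
    have h2 : 2 * K ^ 2 * K⁻¹ ≤ 2 * K ^ 2 * |γ1 t - ω| := by gcongr
    have h3 : 2 * K ^ 2 * K⁻¹ = 2 * K := by field_simp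
    linarith
  have hnkb1 : |γ1 s / γ1 (s + k)| ≤ K ^ 2 := by
    rw [abs_div, div_le_iff₀ (abs_pos.2 hB'0)]
    have h2 : K ^ 2 * K⁻¹ ≤ K ^ 2 * |γ1 (s + k)| := by gcongr
    have h3 : K ^ 2 * K⁻¹ = K := by field_simp
    linarith
  have hK2 : 1 ≤ K ^ 2 := one_le_pow₀ hK
  have hnkb : |nk| ≤ 2 * K ^ 2 := by
    rw [hnk]
    have := abs_sub (γ1 s / γ1 (s + k)) 1
    rw [abs_one] at this
    linarith
  have e3 : (γ1 s - ω) - (γ1 t - ω) * nt = 0 := by rw [hnt]; field_simp; ring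
  have e4 : γ1 (s + k) * (1 + nk) - ω - (γ1 t - ω) * nt = 0 := by
    rw [hnt, hnk]; field_simp; ring
  refine ⟨((nt, 1), nk), γ1 (t + k) * (nt + nk) - γ1 t * nt, ?_, ?_, ?_⟩
  · simp only [Prod.norm_def, Real.norm_eq_abs, abs_one]
    exact max_le (max_le hntb (by linarith)) hnkb
  · have e : γ1 (t + k) * (nt + nk) - γ1 t * nt = γ1 (t + k) * (γ1 s - ω) *
        ((1 - γ1 t / γ1 (t + k)) / (γ1 t - ω) - (1 - γ1 s / γ1 (s + k)) / (γ1 s - ω)) := by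
      rw [hnt, hnk]; field_simp; ring
    rw [e, abs_mul, abs_mul]
    refine hcurv.trans ?_
    have h1 : K⁻¹ * K⁻¹ ≤ |γ1 (t + k)| * |γ1 s - ω| := by gcongr
    calc _ = K ^ 3 * (K⁻¹ * K⁻¹ * |(1 - γ1 t / γ1 (t + k)) / (γ1 t - ω)
          - (1 - γ1 s / γ1 (s + k)) / (γ1 s - ω)|) := by field_simp
      _ ≤ _ := by gcongr
  · rintro ⟨⟨et, es⟩, ek⟩ σ he hσ0 hσ
    simp only [Prod.norm_def, Real.norm_eq_abs, sup_le_iff] at he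
    obtain ⟨⟨het, hes⟩, hek⟩ := he
    have hsum : ∀ x y : ℝ, |x| ≤ r → |y| ≤ r → |x + y| ≤ 2 * r := fun x y hx hy =>
      (abs_add_le _ _).trans (by linarith)
    have hsum' : ∀ x y : ℝ, |x| ≤ 2 * K ^ 2 → |y| ≤ 2 * K ^ 2 → |x + y| ≤ 4 * K ^ 2 :=
      fun x y hx hy => (abs_add_le _ _).trans (by linarith)
    have r1 := herr σ hσ0 hσ t ht et nt (by linarith) (by linarith)
    have r2 := herr σ hσ0 hσ (t + k) htk (et + ek) (nt + nk) (hsum _ _ het hek)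
      (hsum' _ _ hntb hnkb)
    have r3 := herr σ hσ0 hσ s hs es 1 (by linarith) (by rw [abs_one]; linarith)
    have r4 := herr σ hσ0 hσ (s + k) hsk (es + ek) (1 + nk) (hsum _ _ hes hek)
      (hsum' _ _ (by rw [abs_one]; linarith) hnkb)
    simp only [phase₂, phase₃, phase₄, Prod.mk_add_mk, Prod.smul_mk, smul_eq_mul]
    rw [show t + et + σ * nt + (k + ek + σ * nk) = t + k + (et + ek) + σ * (nt + nk) by ring,
      show t + et + (k + ek) = t + k + (et + ek) by ring,
      show s + es + σ * 1 + (k + ek + σ * nk) = s + k + (es + ek) + σ * (1 + nk) by ring,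
      show s + es + (k + ek) = s + k + (es + ek) by ring]
    have d2 : β * (γ (t + k + (et + ek) + σ * (nt + nk)) - γ (t + et + σ * nt))
        - (β * (γ (t + k + (et + ek)) - γ (t + et))
          + β * (γ1 (t + k) * (nt + nk) - γ1 t * nt) * σ)
        = β * ((γ (t + k + (et + ek) + σ * (nt + nk)) - γ (t + k + (et + ek))
            - γ1 (t + k) * (σ * (nt + nk)))
          - (γ (t + et + σ * nt) - γ (t + et) - γ1 t * (σ * nt))) := by ring
    have d3 : β * (γ (s + es + σ * 1) - ω * (s + es + σ * 1)
          - (γ (t + et + σ * nt) - ω * (t + et + σ * nt)))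
        - β * (γ (s + es) - ω * (s + es) - (γ (t + et) - ω * (t + et)))
        = β * ((γ (s + es + σ * 1) - γ (s + es) - γ1 s * (σ * 1))
          - (γ (t + et + σ * nt) - γ (t + et) - γ1 t * (σ * nt))) := by
      linear_combination β * σ * e3
    have d4 : β * (γ (s + k + (es + ek) + σ * (1 + nk)) - ω * (s + es + σ * 1)
          - (γ (t + et + σ * nt) - ω * (t + et + σ * nt)))
        - β * (γ (s + k + (es + ek)) - ω * (s + es) - (γ (t + et) - ω * (t + et)))
        = β * ((γ (s + k + (es + ek) + σ * (1 + nk)) - γ (s + k + (es + ek))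
            - γ1 (s + k) * (σ * (1 + nk)))
          - (γ (t + et + σ * nt) - γ (t + et) - γ1 t * (σ * nt))) := by
      linear_combination β * σ * e4
    rw [d2, d3, d4, abs_mul, abs_mul, abs_mul, abs_of_pos hβ]
    have hE : ∀ x y : ℝ, |x| ≤ 16 * K ^ 3 * σ * r → |y| ≤ 16 * K ^ 3 * σ * r →
        β * |x - y| ≤ β * (32 * K ^ 3 * σ * r) := fun x y hx hy =>
      mul_le_mul_of_nonneg_left ((abs_sub _ _).trans (by linarith)) hβ.le
    have q2 := hE _ _ r2 r1
    have q3 := hE _ _ r3 r1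
    have q4 := hE _ _ r4 r1
    linarith

/-- The correlation appearing after two applications of the Cauchy-Schwarz inequality. -/
noncomputable def phaseCorr (g γ : ℝ → ℝ) (ω β : ℝ) (z : (ℝ × ℝ) × ℝ) : ℝ :=
  fourCorr g (phase₂ γ β z) (phase₃ γ ω β z) (phase₄ γ ω β z)

theorem measurable_phaseCorr {g : ℝ → ℝ} (hg : Measurable g) (hγ : Measurable γ) :
    Measurable (phaseCorr g γ ω β) := by
  unfold phaseCorr phase₂ phase₃ phase₄
  exact measurable_fourCorr hg (by fun_prop) (by fun_prop) (by fun_prop)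

/-- A bounded function on the unit interval oscillating at scale `l`. -/
structure IsOscillating (g : ℝ → ℝ) (l : ℝ) : Prop where
  measurable : Measurable g
  abs_le_one : ∀ x, |g x| ≤ 1
  support : ∀ x, g x ≠ 0 → x ∈ Set.Icc (0 : ℝ) 1
  modulus : ∀ δ, ∫ x, |g (x + δ) - g x| ≤ 6 / l * |δ|
  primitive : ∀ x y, |∫ u in x..y, g u| ≤ 2 * l

theorem IsPhase.abs_integral_bump_mul_phaseCorr_le (h : IsPhase γ γ1 ω K a ρ) (hβ : 0 < β)
    {μ : ℝ} (hμ : 0 < μ) (hμK : 100 * K ^ 4 * μ ≤ 1) {g : ℝ → ℝ}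
    (hg : IsOscillating g (β * μ ^ 16)) {t s k : ℝ}
    (ht : t ∈ Set.Icc (a - ρ) (a + ρ)) (hs : s ∈ Set.Icc (a - ρ) (a + ρ))
    (htk : t + k ∈ Set.Icc (a - ρ) (a + ρ)) (hsk : s + k ∈ Set.Icc (a - ρ) (a + ρ))
    (hk : μ ≤ |k|) (hts : μ ≤ |t - s|) :
    |∫ e, bump (μ ^ 8) e * phaseCorr g γ ω β (((t, s), k) + e)|
      ≤ (μ ^ 8) ^ 3 * (100 * K ^ 4 * μ) := by
  have hK := h.one_le_const
  have hK0 : 0 < K := by linarith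
  have hK4 : 1 ≤ K ^ 4 := one_le_pow₀ hK
  have hμ1 : 100 * μ ≤ 1 := by nlinarith
  have hρ : K⁻¹ ≤ ρ := h.inv_le_scale
  have hμ1' : μ ≤ 1 := by linarith
  have hμ8 : μ ^ 8 ≤ μ := by simpa using pow_le_pow_of_le_one hμ.le hμ1' (show 1 ≤ 8 by norm_num)
  have hμ4 : μ ^ 4 ≤ μ := by simpa using pow_le_pow_of_le_one hμ.le hμ1' (show 1 ≤ 4 by norm_num)
  have hKK4 : K ≤ K ^ 4 := by simpa using pow_le_pow_right₀ hK (show 1 ≤ 4 by norm_num)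
  have hK24 : K ^ 2 ≤ K ^ 4 := pow_le_pow_right₀ hK (by norm_num)
  have hK34 : K ^ 3 ≤ K ^ 4 := pow_le_pow_right₀ hK (by norm_num)
  have hr4 : 4 * μ ^ 8 ≤ ρ := by
    refine le_trans ?_ hρ
    rw [← one_div, le_div_iff₀ hK0]
    have : μ ^ 8 * K ≤ μ * K ^ 4 := by gcongr
    nlinarith
  obtain ⟨n, c, hn, hc, hphase⟩ := h.exists_direction hβ ht hs htk hsk (pow_pos hμ 8).le hr4
  have hM : μ ^ 12 * (2 * K ^ 2) ≤ μ ^ 8 := by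
    have : μ ^ 4 * K ^ 2 ≤ μ * K ^ 4 := by gcongr
    calc μ ^ 12 * (2 * K ^ 2) = μ ^ 8 * (2 * (μ ^ 4 * K ^ 2)) := by ring
      _ ≤ μ ^ 8 * 1 := by gcongr; nlinarith
      _ = _ := mul_one _
  have hc0 : μ ^ 2 / K ^ 3 ≤ |c| := by
    rw [div_le_iff₀ (by positivity)]
    nlinarith
  have hc00 : 0 < |c| := lt_of_lt_of_le (by positivity) hc0
  have hm : Measurable fun e => phaseCorr g γ ω β (((t, s), k) + e) :=
    (measurable_phaseCorr hg.measurable h.measurable).comp (measurable_const_add _)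
  have hle1 : ∀ d₂ d₃ d₄, |fourCorr g d₂ d₃ d₄| ≤ 1 :=
    abs_fourCorr_le_one hg.abs_le_one hg.support
  have hmain := abs_integral_bump_mul_le_of_line (pow_pos hμ 8) hm
    (fun e => hle1 _ _ _) hn (pow_pos hμ 12).le hM
    (B := 576 * K ^ 3 * μ ^ 4 * μ ^ 12 + 2 * K ^ 3 * μ ^ 14) (by positivity) ?_
  · refine le_of_mul_le_mul_left (hmain.trans ?_) (pow_pos hμ 12)
    have hμ2 : μ ^ 2 ≤ μ / 100 := by nlinarith
    have hμ3 : μ ^ 4 ≤ μ / 10000 := by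
      calc μ ^ 4 = μ ^ 2 * μ ^ 2 := by ring
        _ ≤ (μ / 100) * (1 / 100) := by gcongr; linarith
        _ = _ := by ring
    have b1 : K ^ 2 * μ ^ 4 ≤ K ^ 4 * (μ / 10000) := by gcongr
    have b2 : K ^ 3 * μ ^ 4 ≤ K ^ 4 * (μ / 10000) := by gcongr
    have b3 : K ^ 3 * μ ^ 2 ≤ K ^ 4 * (μ / 100) := by gcongr
    have hp : 0 < K ^ 4 * μ := by positivity
    calc _ = μ ^ 12 * ((μ ^ 8) ^ 3 *
          (128 * (K ^ 2 * μ ^ 4) + 4608 * (K ^ 3 * μ ^ 4) + 16 * (K ^ 3 * μ ^ 2))) := by ring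
      _ ≤ _ := by gcongr; linarith
  · intro e he
    have hfm : Measurable fun σ : ℝ => phaseCorr g γ ω β (((t, s), k) + (e + σ • n)) :=
      hm.comp (by fun_prop)
    have hgm : Measurable fun σ : ℝ => fourCorr g (phase₂ γ β (((t, s), k) + e) + β * c * σ)
        (phase₃ γ ω β (((t, s), k) + e)) (phase₄ γ ω β (((t, s), k) + e)) :=
      measurable_fourCorr hg.measurable (by fun_prop) (by fun_prop) (by fun_prop)
    have hii : ∀ {F : ℝ → ℝ}, Measurable F → (∀ x, |F x| ≤ 1) →
        IntervalIntegrable F volume 0 (μ ^ 12) := fun {F} hF hF1 => by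
      rw [intervalIntegrable_iff]
      exact Measure.integrableOn_of_bounded (M := 1) (by simp) hF.aestronglyMeasurable
        (Filter.Eventually.of_forall fun x => by simpa using hF1 x)
    have hκ : β * c ≠ 0 := mul_ne_zero hβ.ne' (abs_pos.1 hc00)
    have h1 := abs_integral_fourCorr_le hg.measurable hg.abs_le_one hg.support hg.primitive
      (phase₂ γ β (((t, s), k) + e)) (phase₃ γ ω β (((t, s), k) + e))
      (phase₄ γ ω β (((t, s), k) + e)) hκ (pow_pos hμ 12).le
    have h1' : 2 * (β * μ ^ 16) / |β * c| ≤ 2 * K ^ 3 * μ ^ 14 := by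
      rw [abs_mul, abs_of_pos hβ, div_le_iff₀ (by positivity)]
      calc 2 * (β * μ ^ 16) = 2 * K ^ 3 * μ ^ 14 * (β * (μ ^ 2 / K ^ 3)) := by field_simp
        _ ≤ _ := by gcongr
    have h2 : |(∫ σ in (0 : ℝ)..μ ^ 12, phaseCorr g γ ω β (((t, s), k) + (e + σ • n)))
        - ∫ σ in (0 : ℝ)..μ ^ 12, fourCorr g (phase₂ γ β (((t, s), k) + e) + β * c * σ)
        (phase₃ γ ω β (((t, s), k) + e)) (phase₄ γ ω β (((t, s), k) + e))|
        ≤ 576 * K ^ 3 * μ ^ 4 * μ ^ 12 := by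
      rw [← intervalIntegral.integral_sub (hii hfm fun _ => hle1 _ _ _)
        (hii hgm fun _ => hle1 _ _ _)]
      have := intervalIntegral.norm_integral_le_of_norm_le_const (a := 0) (b := μ ^ 12)
        (f := fun σ => phaseCorr g γ ω β (((t, s), k) + (e + σ • n))
          - fourCorr g (phase₂ γ β (((t, s), k) + e) + β * c * σ)
        (phase₃ γ ω β (((t, s), k) + e)) (phase₄ γ ω β (((t, s), k) + e)))
        (C := 576 * K ^ 3 * μ ^ 4) ?_
      · simpa only [sub_zero, abs_of_pos (pow_pos hμ 12), Real.norm_eq_abs] using this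
      · intro σ hσ
        rw [Set.uIoc_of_le (pow_pos hμ 12).le] at hσ
        have hσM : σ * (2 * K ^ 2) ≤ μ ^ 8 :=
          (mul_le_mul_of_nonneg_right hσ.2 (by positivity)).trans hM
        have h3 := hphase e σ he hσ.1.le hσM
        have h4 := abs_fourCorr_sub_le hg.measurable hg.abs_le_one hg.support hg.modulus
          (phase₂ γ β (((t, s), k) + (e + σ • n))) (phase₃ γ ω β (((t, s), k) + (e + σ • n)))
          (phase₄ γ ω β (((t, s), k) + (e + σ • n)))
          (phase₂ γ β (((t, s), k) + e) + β * c * σ)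
          (phase₃ γ ω β (((t, s), k) + e)) (phase₄ γ ω β (((t, s), k) + e))
        rw [Real.norm_eq_abs]
        refine h4.trans ?_
        rw [← add_assoc]
        calc _ ≤ 6 / (β * μ ^ 16) * (96 * β * K ^ 3 * σ * μ ^ 8) := by gcongr
          _ ≤ 6 / (β * μ ^ 16) * (96 * β * K ^ 3 * μ ^ 12 * μ ^ 8) := by
            gcongr
            exact hσ.2
          _ = _ := by field_simp; ring
    have h5 := abs_sub_abs_le_abs_sub
      (∫ σ in (0 : ℝ)..μ ^ 12, phaseCorr g γ ω β (((t, s), k) + (e + σ • n)))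
      (∫ σ in (0 : ℝ)..μ ^ 12, fourCorr g (phase₂ γ β (((t, s), k) + e) + β * c * σ)
        (phase₃ γ ω β (((t, s), k) + e)) (phase₄ γ ω β (((t, s), k) + e)))
    linarith

end Phase

/-- The tent function of height one supported on `[a - ρ, a + ρ]`. -/
noncomputable def tent (a ρ t : ℝ) : ℝ := max 0 (1 - |t - a| / ρ)

section Tent
variable {a ρ : ℝ}

theorem continuous_tent : Continuous (tent a ρ) := by unfold tent; fun_prop

theorem measurable_tent : Measurable (tent a ρ) := continuous_tent.measurable

theorem tent_nonneg (t : ℝ) : 0 ≤ tent a ρ t := le_max_left _ _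

theorem tent_le_one (hρ : 0 < ρ) (t : ℝ) : tent a ρ t ≤ 1 :=
  max_le zero_le_one (by have := div_nonneg (abs_nonneg (t - a)) hρ.le; linarith)

theorem abs_tent_le_one (hρ : 0 < ρ) (t : ℝ) : |tent a ρ t| ≤ 1 := by
  rw [abs_of_nonneg (tent_nonneg t)]; exact tent_le_one hρ t

theorem mem_Icc_of_tent_ne_zero (hρ : 0 < ρ) {t : ℝ} (h : tent a ρ t ≠ 0) :
    t ∈ Set.Icc (a - ρ) (a + ρ) := by
  by_contra h'
  apply h
  rw [tent, max_eq_left]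
  rw [sub_nonpos, one_le_div hρ]
  by_contra! h2
  have := abs_lt.1 h2
  exact h' ⟨by linarith, by linarith⟩

theorem abs_tent_sub_le (hρ : 0 < ρ) (s t : ℝ) :
    |tent a ρ s - tent a ρ t| ≤ |s - t| / ρ := by
  refine (abs_max_sub_max_le_max _ _ _ _).trans ?_
  rw [sub_self, abs_zero]
  refine max_le (by positivity) ?_
  rw [show 1 - |s - a| / ρ - (1 - |t - a| / ρ) = (|t - a| - |s - a|) / ρ by ring, abs_div,
    abs_of_pos hρ]
  refine div_le_div_of_nonneg_right ?_ hρ.le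
  have := abs_abs_sub_abs_le (t - a) (s - a)
  rwa [sub_sub_sub_cancel_right, abs_sub_comm t s] at this

/-- The product of four tents attached to `t`, `t + k`, `s`, `s + k`. -/
noncomputable def fourTent (a ρ : ℝ) (z : (ℝ × ℝ) × ℝ) : ℝ :=
  tent a ρ z.1.1 * (tent a ρ (z.1.1 + z.2) * tent a ρ z.1.2 * tent a ρ (z.1.2 + z.2))

theorem measurable_fourTent : Measurable (fourTent a ρ) := by
  have := measurable_tent (a := a) (ρ := ρ)
  unfold fourTent
  fun_prop

theorem abs_fourTent_le_one (hρ : 0 < ρ) (z : (ℝ × ℝ) × ℝ) : |fourTent a ρ z| ≤ 1 := by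
  have := abs_tent_le_one (a := a) hρ
  rw [fourTent, abs_mul, abs_mul, abs_mul]
  exact mul_le_one₀ (this _) (by positivity)
    (mul_le_one₀ (mul_le_one₀ (this _) (by positivity) (this _)) (by positivity) (this _))

theorem mem_Icc_of_fourTent_ne_zero (hρ : 0 < ρ) {z : (ℝ × ℝ) × ℝ} (h : fourTent a ρ z ≠ 0) :
    z.1.1 ∈ Set.Icc (a - ρ) (a + ρ) ∧ z.1.2 ∈ Set.Icc (a - ρ) (a + ρ) ∧
      z.1.1 + z.2 ∈ Set.Icc (a - ρ) (a + ρ) ∧ z.1.2 + z.2 ∈ Set.Icc (a - ρ) (a + ρ) := by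
  have h1 := left_ne_zero_of_mul h
  have h2 := right_ne_zero_of_mul h
  have h3 := left_ne_zero_of_mul h2
  exact ⟨mem_Icc_of_tent_ne_zero hρ h1, mem_Icc_of_tent_ne_zero hρ (right_ne_zero_of_mul h3),
    mem_Icc_of_tent_ne_zero hρ (left_ne_zero_of_mul h3),
    mem_Icc_of_tent_ne_zero hρ (right_ne_zero_of_mul h2)⟩

theorem mem_closedBall_of_fourTent_ne_zero (hρ : 0 < ρ) {z : (ℝ × ℝ) × ℝ}
    (h : fourTent a ρ z ≠ 0) : z ∈ Metric.closedBall ((a, a), (0 : ℝ)) (2 * ρ) := by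
  obtain ⟨h1, h2, h3, h4⟩ := mem_Icc_of_fourTent_ne_zero hρ h
  rw [mem_closedBall_iff_norm]
  simp only [Prod.norm_def, Prod.fst_sub, Prod.snd_sub, Real.norm_eq_abs, sup_le_iff, sub_zero]
  refine ⟨⟨abs_le.2 ⟨by linarith [h1.1], by linarith [h1.2]⟩,
    abs_le.2 ⟨by linarith [h2.1], by linarith [h2.2]⟩⟩,
    abs_le.2 ⟨by linarith [h1.2, h3.1], by linarith [h1.1, h3.2]⟩⟩

theorem abs_fourTent_add_sub_le (hρ : 0 < ρ) (z e : (ℝ × ℝ) × ℝ) :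
    |fourTent a ρ (z + e) - fourTent a ρ z| ≤ 6 / ρ * ‖e‖ := by
  obtain ⟨⟨t, s⟩, k⟩ := z
  obtain ⟨⟨et, es⟩, ek⟩ := e
  have h1 := abs_tent_le_one (a := a) hρ
  have hL := abs_tent_sub_le (a := a) hρ
  have he : ‖((et, es), ek)‖ = max (max |et| |es|) |ek| := rfl
  have het : |et| ≤ ‖((et, es), ek)‖ := by rw [he]; simp
  have hes : |es| ≤ ‖((et, es), ek)‖ := by rw [he]; simp
  have hek : |ek| ≤ ‖((et, es), ek)‖ := by rw [he]; simp
  generalize ‖((et, es), ek)‖ = E at *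
  simp only [fourTent, Prod.mk_add_mk]
  have hm := abs_mul_mul_sub_le (b := tent a ρ (t + et + (k + ek))) (b' := tent a ρ (t + k))
    (c := tent a ρ (s + es)) (c' := tent a ρ s)
    (d := tent a ρ (s + es + (k + ek))) (d' := tent a ρ (s + k)) (h1 _) (h1 _) (h1 _) (h1 _)
  have g1 := (hL (t + et) t).trans (show _ ≤ E / ρ by gcongr; simpa using het)
  have g2 := (hL (t + et + (k + ek)) (t + k)).trans (show _ ≤ 2 * E / ρ by
    gcongr
    rw [show t + et + (k + ek) - (t + k) = et + ek by ring]
    exact (abs_add_le _ _).trans (by linarith))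
  have g3 := (hL (s + es) s).trans (show _ ≤ E / ρ by gcongr; simpa using hes)
  have g4 := (hL (s + es + (k + ek)) (s + k)).trans (show _ ≤ 2 * E / ρ by
    gcongr
    rw [show s + es + (k + ek) - (s + k) = es + ek by ring]
    exact (abs_add_le _ _).trans (by linarith))
  have hm2 := abs_mul_mul_sub_le (b := tent a ρ (t + et)) (b' := tent a ρ t)
    (c := tent a ρ (t + et + (k + ek)) * tent a ρ (s + es) * tent a ρ (s + es + (k + ek)))
    (c' := tent a ρ (t + k) * tent a ρ s * tent a ρ (s + k)) (d := 1) (d' := 1)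
    (by rw [abs_mul, abs_mul]; exact mul_le_one₀ (mul_le_one₀ (h1 _) (by positivity) (h1 _))
          (by positivity) (h1 _)) (by simp) (h1 _)
    (by rw [abs_mul, abs_mul]; exact mul_le_one₀ (mul_le_one₀ (h1 _) (by positivity) (h1 _))
          (by positivity) (h1 _))
  rw [mul_one, mul_one, sub_self, abs_zero, add_zero] at hm2
  have : 6 / ρ * E = E / ρ + 2 * E / ρ + E / ρ + 2 * E / ρ := by ring
  linarith

theorem volume_real_near_diagonal_le {μ : ℝ} (hμ : 0 < μ) (hρ : 0 < ρ) :
    volume.real (Metric.closedBall ((a, a), (0 : ℝ)) ρ \ {z | μ ≤ |z.2| ∧ μ ≤ |z.1.1 - z.1.2|})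
      ≤ 16 * ρ ^ 2 * μ := by
  set T : Set (ℝ × ℝ) := (fun z : ℝ × ℝ => (z.1, -z.1 + z.2)) ⁻¹'
    (Metric.closedBall a ρ ×ˢ Metric.ball 0 μ) with hT
  have hTv : volume T = ENNReal.ofReal (4 * ρ * μ) := by
    rw [hT, Measure.volume_eq_prod, (measurePreserving_prod_neg_add volume volume).measure_preimage
      (measurableSet_closedBall.prod measurableSet_ball).nullMeasurableSet, Measure.prod_prod,
      Real.volume_closedBall, Real.volume_ball, ← ENNReal.ofReal_mul (by positivity)]
    congr 1; ring
  have hsub : Metric.closedBall ((a, a), (0 : ℝ)) ρ \ {z | μ ≤ |z.2| ∧ μ ≤ |z.1.1 - z.1.2|} ⊆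
      (Metric.closedBall (a, a) ρ ×ˢ Metric.ball 0 μ) ∪ (T ×ˢ Metric.closedBall 0 ρ) := by
    rintro ⟨⟨t, s⟩, k⟩ ⟨h1, h2⟩
    rw [← closedBall_prod_same] at h1
    by_cases hk : |k| < μ
    · exact Or.inl ⟨h1.1, by simpa using hk⟩
    · refine Or.inr ⟨⟨?_, ?_⟩, h1.2⟩
      · have := h1.1
        rw [← closedBall_prod_same] at this
        exact this.1
      · simp only [Set.mem_ofPred_eq, not_and] at h2
        have := not_le.1 (h2 (not_lt.1 hk))
        simp only [Metric.mem_ball, dist_zero_right, Real.norm_eq_abs]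
        rwa [abs_sub_comm, ← neg_add_eq_sub] at this
  have hv : volume ((Metric.closedBall (a, a) ρ ×ˢ Metric.ball 0 μ) ∪
      (T ×ˢ Metric.closedBall (0 : ℝ) ρ)) ≤ ENNReal.ofReal (16 * ρ ^ 2 * μ) := by
    refine (measure_union_le _ _).trans ?_
    rw [Measure.volume_eq_prod, Measure.prod_prod, Measure.prod_prod, hTv, ← closedBall_prod_same,
      Measure.volume_eq_prod, Measure.prod_prod, Real.volume_closedBall, Real.volume_closedBall,
      Real.volume_ball, ← ENNReal.ofReal_mul (by positivity), ← ENNReal.ofReal_mul (by positivity),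
      ← ENNReal.ofReal_mul (by positivity), ← ENNReal.ofReal_add (by positivity) (by positivity)]
    exact ENNReal.ofReal_le_ofReal (by nlinarith)
  exact ENNReal.toReal_le_of_le_ofReal (by positivity) ((measure_mono hsub).trans hv)

theorem IsPhase.abs_integral_fourTent_mul_le {γ γ1 : ℝ → ℝ} {ω K β : ℝ}
    (h : IsPhase γ γ1 ω K a ρ) (hβ : 0 < β)
    {μ : ℝ} (hμ : 0 < μ) (hμK : 100 * K ^ 4 * μ ≤ 1) {g : ℝ → ℝ}
    (hg : IsOscillating g (β * μ ^ 16)) :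
    |∫ z, fourTent a ρ z * phaseCorr g γ ω β z| ≤ 20000 * K ^ 4 * μ := by
  have hK := h.one_le_const
  have hK0 : 0 < K := by linarith
  have hρ0 : 0 < ρ := lt_of_lt_of_le (inv_pos.2 hK0) h.inv_le_scale
  have hρ1 := h.scale_le_one
  have hK4 : 1 ≤ K ^ 4 := one_le_pow₀ hK
  have hKK4 : K ≤ K ^ 4 := by simpa using pow_le_pow_right₀ hK (show 1 ≤ 4 by norm_num)
  have hμ1 : μ ≤ 1 := by nlinarith
  have hμ8 : μ ^ 8 ≤ μ := by simpa using pow_le_pow_of_le_one hμ.le hμ1 (show 1 ≤ 8 by norm_num)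
  have key := abs_integral_mul_le_of_bump (measurable_fourTent (a := a) (ρ := ρ))
    (measurable_phaseCorr (ω := ω) (β := β) hg.measurable h.measurable)
    (abs_fourTent_le_one hρ0) (fun z => abs_fourCorr_le_one hg.abs_le_one hg.support _ _ _)
    (abs_fourTent_add_sub_le hρ0) (z₀ := ((a, a), 0)) (R := 2 * ρ) (by positivity)
    (fun z => mem_closedBall_of_fourTent_ne_zero hρ0) (pow_pos hμ 8)
    (B := 100 * K ^ 4 * μ) (by positivity) (G := {z | μ ≤ |z.2| ∧ μ ≤ |z.1.1 - z.1.2|})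
    ?_ (volume_real_near_diagonal_le hμ (by positivity)) ?_
  · have h1 : 6 / ρ ≤ 6 * K := by
      rw [div_le_iff₀ hρ0]
      have := mul_le_mul_of_nonneg_left h.inv_le_scale hK0.le
      rw [mul_inv_cancel₀ hK0.ne'] at this
      linarith
    refine key.trans ?_
    calc _ ≤ 16 * (2 * 1) ^ 3 * (100 * K ^ 4 * μ) + 16 * (16 * (2 * 1) ^ 2 * μ)
          + 6 * K * μ * (8 * (2 * 1 + 1) ^ 3) := by gcongr; linarith
      _ ≤ _ := by nlinarith
  · rintro ⟨⟨t, s⟩, k⟩ ⟨hk, hts⟩ hX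
    obtain ⟨h1, h2, h3, h4⟩ := mem_Icc_of_fourTent_ne_zero hρ0 hX
    exact h.abs_integral_bump_mul_phaseCorr_le hβ hμ hμK hg h1 h2 h3 h4 hk hts
  · have m1 : Measurable fun z : (ℝ × ℝ) × ℝ => |z.2| := by fun_prop
    have m2 : Measurable fun z : (ℝ × ℝ) × ℝ => |z.1.1 - z.1.2| := by fun_prop
    exact (measurableSet_le measurable_const m1).inter (measurableSet_le measurable_const m2)

end Tent

theorem integral_integral_rotate {F : ℝ → ℝ → ℝ → ℝ}
    (hF : Integrable fun p : (ℝ × ℝ) × ℝ => F p.1.1 p.1.2 p.2) :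
    ∫ p : ℝ × ℝ, ∫ y, F p.1 p.2 y = ∫ q : ℝ × ℝ, ∫ t, F t q.1 q.2 := by
  have hF' : Integrable (fun p : ℝ × ℝ × ℝ => F p.1 p.2.1 p.2.2) := by
    have h := ((measurePreserving_prodAssoc (volume : Measure ℝ) (volume : Measure ℝ)
      (volume : Measure ℝ)).symm).integrable_comp_of_integrable hF
    exact h
  calc _ = ∫ p : (ℝ × ℝ) × ℝ, F p.1.1 p.1.2 p.2 := (integral_prod _ hF).symm
    _ = ∫ p : ℝ × ℝ × ℝ, F p.1 p.2.1 p.2.2 := by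
      exact (measurePreserving_prodAssoc (volume : Measure ℝ) (volume : Measure ℝ)
        (volume : Measure ℝ)).integral_comp' (fun p : ℝ × ℝ × ℝ => F p.1 p.2.1 p.2.2)
    _ = _ := integral_prod_symm _ hF'

theorem volume_prod_Icc_ne_top (a b c d : ℝ) :
    (volume : Measure (ℝ × ℝ)) (Set.Icc a b ×ˢ Set.Icc c d) ≠ ⊤ := by
  rw [Measure.volume_eq_prod, Measure.prod_prod]
  exact ENNReal.mul_ne_top (by simp) (by simp)

/-- A measurable function bounded by one and supported in the unit interval. -/
structure IsUnitBounded (f : ℝ → ℝ) : Prop where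
  measurable : Measurable f
  abs_le_one : ∀ x, |f x| ≤ 1
  support : ∀ x, f x ≠ 0 → x ∈ Set.Icc (0 : ℝ) 1

theorem IsUnitBounded.integrable {f : ℝ → ℝ} (h : IsUnitBounded f) : Integrable f :=
  integrable_of_support_Icc h.measurable h.abs_le_one h.support

theorem IsUnitBounded.abs_integral_le_one {f : ℝ → ℝ} (h : IsUnitBounded f) : |∫ x, f x| ≤ 1 :=
  (abs_integral_le_of_support h.abs_le_one h.support (by simp)).trans (by simp)

theorem IsUnitBounded.mul {f g : ℝ → ℝ} (hf : IsUnitBounded f) (hg : Measurable g)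
    (hg1 : ∀ x, |g x| ≤ 1) : IsUnitBounded fun x => f x * g x :=
  ⟨hf.measurable.mul hg, fun x => by
    rw [abs_mul]; exact mul_le_one₀ (hf.abs_le_one x) (abs_nonneg _) (hg1 x),
    fun x hx => hf.support x (left_ne_zero_of_mul hx)⟩

section CauchySchwarz
variable {a ρ ω β : ℝ} {γ f₀ f₁ g : ℝ → ℝ}

/-- The kernel left after the first application of the Cauchy-Schwarz inequality. -/
noncomputable def kernelCS (a ρ ω β : ℝ) (γ g : ℝ → ℝ) (t k y : ℝ) : ℝ :=
  (tent a ρ t * tent a ρ (t + k)) *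
    (g (y + β * (γ t - ω * t)) * g (y + β * (γ (t + k) - ω * t)))

set_option maxHeartbeats 1000000 in
theorem sq_trilinear_le (hρ : 0 < ρ) (hρ1 : ρ ≤ 1) (hγ : Measurable γ) (h₀ : IsUnitBounded f₀)
    (h₁ : IsUnitBounded f₁) (hg : IsUnitBounded g) :
    (∫ x, ∫ t, tent a ρ t * (f₀ x * f₁ (x + β * (ω * t)) * g (x + β * γ t))) ^ 2 ≤
      ∫ q : ℝ × ℝ, (f₁ q.2 * f₁ (q.2 + β * (ω * q.1))) *
        ∫ t, kernelCS a ρ ω β γ g t q.1 q.2 := by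
  have hχm := measurable_tent (a := a) (ρ := ρ)
  have hf₁ := h₁.measurable
  have hgm := hg.measurable
  have hχ1 := abs_tent_le_one (a := a) hρ
  set u : ℝ → ℝ → ℝ := fun x t => tent a ρ t * (f₁ (x + β * (ω * t)) * g (x + β * γ t)) with hu
  have hum : Measurable fun p : ℝ × ℝ => u p.1 p.2 := by simp only [hu]; fun_prop
  have hu1 : ∀ x t, |u x t| ≤ 1 := fun x t => by
    simp only [hu]
    rw [abs_mul, abs_mul]
    exact mul_le_one₀ (hχ1 _) (by positivity)
      (mul_le_one₀ (h₁.abs_le_one _) (by positivity) (hg.abs_le_one _))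
  have hut : ∀ x t, u x t ≠ 0 → t ∈ Set.Icc (a - ρ) (a + ρ) := fun x t h =>
    mem_Icc_of_tent_ne_zero hρ (left_ne_zero_of_mul h)
  set M : ℝ := |β * ω| * (|a| + ρ) with hM
  have hux : ∀ x t, u x t ≠ 0 → x ∈ Set.Icc (-M) (1 + M) := fun x t h => by
    have h1 := hut x t h
    have h2 := h₁.support _ (left_ne_zero_of_mul (right_ne_zero_of_mul h))
    have h3 : |β * (ω * t)| ≤ M := by
      rw [← mul_assoc, abs_mul, hM]
      gcongr
      have := abs_le.1 (le_refl |a|)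
      exact abs_le.2 ⟨by linarith [h1.1], by linarith [h1.2]⟩
    have := abs_le.1 h3
    exact ⟨by linarith [h2.1], by linarith [h2.2]⟩
  have hA1 : ∀ x, |∫ t, u x t| ≤ 2 * ρ := fun x =>
    (abs_integral_le_of_support (hu1 x) (hut x) (by simp)).trans
      (by rw [one_mul, Real.volume_real_Icc_of_le (by linarith)]; linarith)
  have hAx : ∀ x, (∫ t, u x t) ≠ 0 → x ∈ Set.Icc (-M) (1 + M) := fun x hx => by
    by_contra h
    apply hx
    have : ∀ t, u x t = 0 := fun t => by
      by_contra h2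
      exact h (hux x t h2)
    simp [this]
  have hAm : Measurable fun x => ∫ t, u x t :=
    (StronglyMeasurable.integral_prod_right' (f := fun p : ℝ × ℝ => u p.1 p.2)
      hum.stronglyMeasurable).measurable
  have e0 : ∀ x, ∫ t, tent a ρ t * (f₀ x * f₁ (x + β * (ω * t)) * g (x + β * γ t))
      = f₀ x * ∫ t, u x t := fun x => by
    rw [← integral_const_mul]; congr 1; ext t; simp only [hu]; ring
  simp_rw [e0]
  have hCS := sq_integral_mul_le (μ := volume) (f := f₀) (g := fun x => ∫ t, u x t)
    (by simpa only [sq] using (h₀.mul h₀.measurable h₀.abs_le_one).integrable)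
    (integrable_of_support_Icc (C := 4) (p := -M) (q := 1 + M) (hAm.pow_const 2)
      (fun x => by
        rw [abs_pow]
        nlinarith [hA1 x, abs_nonneg (∫ t, u x t)])
      (fun x hx => hAx x ((pow_ne_zero_iff two_ne_zero).1 hx)))
    (integrable_of_support_Icc (C := 2) (p := 0) (q := 1) (h₀.measurable.mul hAm)
      (fun x => by
        rw [abs_mul]
        nlinarith [hA1 x, abs_nonneg (∫ t, u x t), h₀.abs_le_one x, abs_nonneg (f₀ x)])
      (fun x hx => h₀.support x (left_ne_zero_of_mul hx)))
  refine hCS.trans ?_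
  have hf0 : ∫ x, f₀ x ^ 2 ≤ 1 := by
    simpa only [sq] using
      (abs_le.1 (h₀.mul h₀.measurable h₀.abs_le_one).abs_integral_le_one).2
  refine (mul_le_of_le_one_left (integral_nonneg fun x => sq_nonneg _) hf0).trans (le_of_eq ?_)
  have huu : ∀ x t t', |u x t * u x t'| ≤ 1 := fun x t t' => by
    rw [abs_mul]; exact mul_le_one₀ (hu1 _ _) (abs_nonneg _) (hu1 _ _)
  have hjoint : Integrable (fun z : ℝ × ℝ × ℝ => u z.1 z.2.1 * u z.1 z.2.2)
      (volume.prod volume) := by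
    refine integrable_of_bounded_of_support (C := 1)
      (s := Set.Icc (-M) (1 + M) ×ˢ (Set.Icc (a - ρ) (a + ρ) ×ˢ Set.Icc (a - ρ) (a + ρ)))
      ?_ (fun z => huu _ _ _) ?_ ?_
    · simp only [hu]
      fun_prop
    · intro z hz
      exact ⟨hux _ _ (left_ne_zero_of_mul hz), hut _ _ (left_ne_zero_of_mul hz),
        hut _ _ (right_ne_zero_of_mul hz)⟩
    · rw [Measure.prod_prod]
      exact ENNReal.mul_ne_top (by simp) (volume_prod_Icc_ne_top _ _ _ _)
  have e1 : ∫ x, (∫ t, u x t) ^ 2 = ∫ p : ℝ × ℝ, ∫ x, u x p.1 * u x p.2 := by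
    rw [← integral_integral_swap (f := fun x (p : ℝ × ℝ) => u x p.1 * u x p.2) hjoint]
    congr 1; ext x
    rw [sq, Measure.volume_eq_prod, integral_prod_mul]
  have e2 : ∀ p : ℝ × ℝ, ∫ x, u x p.1 * u x p.2 =
      ∫ y, u (y + -(β * (ω * p.1))) p.1 * u (y + -(β * (ω * p.1))) p.2 := fun p =>
    (integral_add_right_eq_self (fun x => u x p.1 * u x p.2) _).symm
  have e3 : ∫ p : ℝ × ℝ, (∫ y, u (y + -(β * (ω * p.1))) p.1 * u (y + -(β * (ω * p.1))) p.2)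
      = ∫ p : ℝ × ℝ, ∫ y, u (y + -(β * (ω * p.1))) p.1 * u (y + -(β * (ω * p.1))) (p.1 + p.2) :=
    ((measurePreserving_prod_add (volume : Measure ℝ) (volume : Measure ℝ)).integral_comp
      (MeasurableEquiv.shearAddRight ℝ).measurableEmbedding
      (fun p : ℝ × ℝ => ∫ y, u (y + -(β * (ω * p.1))) p.1 * u (y + -(β * (ω * p.1))) p.2)).symm
  have e4 : ∀ t k y : ℝ, u (y + -(β * (ω * t))) t * u (y + -(β * (ω * t))) (t + k) =
      (f₁ y * f₁ (y + β * (ω * k))) * kernelCS a ρ ω β γ g t k y := fun t k y => by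
    simp only [hu, kernelCS]
    rw [show y + -(β * (ω * t)) + β * (ω * t) = y by ring,
      show y + -(β * (ω * t)) + β * (ω * (t + k)) = y + β * (ω * k) by ring,
      show y + -(β * (ω * t)) + β * γ t = y + β * (γ t - ω * t) by ring,
      show y + -(β * (ω * t)) + β * γ (t + k) = y + β * (γ (t + k) - ω * t) by ring]
    ring
  rw [e1]
  simp_rw [e2]
  rw [e3]
  simp_rw [e4]
  rw [integral_integral_rotate (F := fun t k y => (f₁ y * f₁ (y + β * (ω * k))) *
    kernelCS a ρ ω β γ g t k y)]
  · congr 1; ext q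
    rw [integral_const_mul]
  · simp_rw [← e4]
    refine integrable_of_bounded_of_support (C := 1)
      (s := (Set.Icc (a - ρ) (a + ρ) ×ˢ Set.Icc (-(2 * ρ)) (2 * ρ)) ×ˢ Set.Icc 0 1)
      ?_ (fun z => huu _ _ _) ?_ ?_
    · simp only [hu]
      fun_prop
    · intro z hz
      have h1 := hut _ _ (left_ne_zero_of_mul hz)
      have h2 := hut _ _ (right_ne_zero_of_mul hz)
      rw [e4] at hz
      exact ⟨⟨h1, by linarith [h1.2, h2.1], by linarith [h1.1, h2.2]⟩,
        h₁.support _ (left_ne_zero_of_mul (left_ne_zero_of_mul hz))⟩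
    · rw [Measure.volume_eq_prod, Measure.prod_prod]
      exact ENNReal.mul_ne_top (volume_prod_Icc_ne_top _ _ _ _) (by simp)

theorem integral_kernelCS_mul (t s k : ℝ) :
    ∫ y, kernelCS a ρ ω β γ g t k y * kernelCS a ρ ω β γ g s k y =
      fourTent a ρ ((t, s), k) * phaseCorr g γ ω β ((t, s), k) := by
  rw [phaseCorr, fourCorr, fourTent, ← integral_const_mul,
    ← integral_add_right_eq_self (fun y => tent a ρ t * (tent a ρ (t + k) * tent a ρ s *
      tent a ρ (s + k)) * (g y * (g (y + phase₂ γ β ((t, s), k)) *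
      g (y + phase₃ γ ω β ((t, s), k)) * g (y + phase₄ γ ω β ((t, s), k))))) (β * (γ t - ω * t))]
  congr 1; ext y
  simp only [kernelCS, phase₂, phase₃, phase₄]
  rw [show y + β * (γ t - ω * t) + β * (γ (t + k) - γ t) = y + β * (γ (t + k) - ω * t) by ring,
    show y + β * (γ t - ω * t) + β * (γ s - ω * s - (γ t - ω * t)) = y + β * (γ s - ω * s) by ring,
    show y + β * (γ t - ω * t) + β * (γ (s + k) - ω * s - (γ t - ω * t))
      = y + β * (γ (s + k) - ω * s) by ring]
  ring

set_option maxHeartbeats 1000000 in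
theorem sq_integral_mul_kernelCS_le {γ1 : ℝ → ℝ} {K : ℝ} (h : IsPhase γ γ1 ω K a ρ)
    (h₁ : IsUnitBounded f₁) (hg : IsUnitBounded g) :
    (∫ q : ℝ × ℝ, (f₁ q.2 * f₁ (q.2 + β * (ω * q.1))) *
        ∫ t, kernelCS a ρ ω β γ g t q.1 q.2) ^ 2 ≤
      4 * ∫ z, fourTent a ρ z * phaseCorr g γ ω β z := by
  have hK0 : 0 < K := by linarith [h.one_le_const]
  have hρ : 0 < ρ := lt_of_lt_of_le (inv_pos.2 hK0) h.inv_le_scale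
  have hρ1 := h.scale_le_one
  have hχm := measurable_tent (a := a) (ρ := ρ)
  have hf₁ := h₁.measurable
  have hgm := hg.measurable
  have hγ := h.measurable
  have hχ1 := abs_tent_le_one (a := a) hρ
  obtain ⟨M, hM⟩ := (isCompact_Icc (a := a - ρ) (b := a + ρ)).exists_bound_of_continuousOn
    (f := fun t => β * (γ t - ω * t)) (fun t ht => by
      have := (h.hasDerivAt t ⟨by linarith [ht.1], by linarith [ht.2]⟩).continuousAt
      exact (by fun_prop : ContinuousAt (fun t => β * (γ t - ω * t)) t).continuousWithinAt)
  have hw1 : ∀ t k y, |kernelCS a ρ ω β γ g t k y| ≤ 1 := fun t k y => by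
    rw [kernelCS, abs_mul, abs_mul, abs_mul]
    exact mul_le_one₀ (mul_le_one₀ (hχ1 _) (by positivity) (hχ1 _)) (by positivity)
      (mul_le_one₀ (hg.abs_le_one _) (by positivity) (hg.abs_le_one _))
  have hws : ∀ t k y, kernelCS a ρ ω β γ g t k y ≠ 0 → t ∈ Set.Icc (a - ρ) (a + ρ) ∧
      (k, y) ∈ Set.Icc (-2) 2 ×ˢ Set.Icc (-M) (1 + M) := fun t k y hne => by
    have ht := mem_Icc_of_tent_ne_zero hρ (left_ne_zero_of_mul (left_ne_zero_of_mul hne))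
    have htk := mem_Icc_of_tent_ne_zero hρ (right_ne_zero_of_mul (left_ne_zero_of_mul hne))
    have hy := hg.support _ (left_ne_zero_of_mul (right_ne_zero_of_mul hne))
    have hb := abs_le.1 (hM t ht)
    exact ⟨ht, ⟨by linarith [ht.2, htk.1], by linarith [ht.1, htk.2]⟩,
      ⟨by linarith [hy.1], by linarith [hy.2]⟩⟩
  have hwm : Measurable fun z : ℝ × (ℝ × ℝ) => kernelCS a ρ ω β γ g z.1 z.2.1 z.2.2 := by
    unfold kernelCS; fun_prop
  set W : ℝ × ℝ → ℝ := fun q => ∫ t, kernelCS a ρ ω β γ g t q.1 q.2 with hW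
  have hWm : Measurable W :=
    (StronglyMeasurable.integral_prod_left' (f := fun z : ℝ × (ℝ × ℝ) =>
      kernelCS a ρ ω β γ g z.1 z.2.1 z.2.2) hwm.stronglyMeasurable).measurable
  have hW1 : ∀ q, |W q| ≤ 2 := fun q =>
    (abs_integral_le_of_support (hw1 · q.1 q.2) (fun t ht => (hws t _ _ ht).1) (by simp)).trans
      (by rw [one_mul, Real.volume_real_Icc_of_le (by linarith)]; linarith)
  have hWs : ∀ q, W q ≠ 0 → q ∈ Set.Icc (-2) 2 ×ˢ Set.Icc (-M) (1 + M) := fun q hq => by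
    by_contra hn
    apply hq
    have : ∀ t, kernelCS a ρ ω β γ g t q.1 q.2 = 0 := fun t => by
      by_contra h2
      exact hn (hws t _ _ h2).2
    simp [hW, this]
  set v : ℝ × ℝ → ℝ := fun q => (Set.Icc (-2 : ℝ) 2).indicator (fun _ => (1 : ℝ)) q.1 *
    (f₁ q.2 * f₁ (q.2 + β * (ω * q.1))) with hv
  have hvm : Measurable v := by
    have : Measurable ((Set.Icc (-2 : ℝ) 2).indicator (fun _ => (1 : ℝ))) :=
      measurable_const.indicator measurableSet_Icc
    simp only [hv]
    fun_prop
  have hv1 : ∀ q, |v q| ≤ 1 := fun q => by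
    simp only [hv]
    rw [abs_mul, abs_mul]
    refine mul_le_one₀ ?_ (by positivity)
      (mul_le_one₀ (h₁.abs_le_one _) (by positivity) (h₁.abs_le_one _))
    rw [Set.indicator_apply]
    split_ifs <;> simp
  have hvs : ∀ q, v q ≠ 0 → q ∈ Set.Icc (-2 : ℝ) 2 ×ˢ Set.Icc (0 : ℝ) 1 := fun q hq =>
    ⟨Set.mem_of_indicator_ne_zero (left_ne_zero_of_mul hq),
      h₁.support _ (left_ne_zero_of_mul (right_ne_zero_of_mul hq))⟩
  have e0 : ∫ q : ℝ × ℝ, (f₁ q.2 * f₁ (q.2 + β * (ω * q.1))) * W q = ∫ q, v q * W q := by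
    congr 1; ext q
    by_cases hq : W q = 0
    · rw [hq, mul_zero, mul_zero]
    · simp only [hv]
      rw [Set.indicator_of_mem (hWs q hq).1, one_mul]
  rw [e0]
  have hv2 : ∀ q, |v q ^ 2| ≤ 1 := fun q => by
    rw [abs_pow]; exact pow_le_one₀ (abs_nonneg _) (hv1 q)
  have hCS := sq_integral_mul_le (μ := volume) (f := v) (g := W)
    (integrable_of_bounded_of_support (hvm.pow_const 2) hv2
      (fun q hq => hvs q ((pow_ne_zero_iff two_ne_zero).1 hq)) (volume_prod_Icc_ne_top _ _ _ _))
    (integrable_of_bounded_of_support (C := 4) (hWm.pow_const 2)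
      (fun q => by rw [abs_pow]; nlinarith [hW1 q, abs_nonneg (W q)])
      (fun q hq => hWs q ((pow_ne_zero_iff two_ne_zero).1 hq)) (volume_prod_Icc_ne_top _ _ _ _))
    (integrable_of_bounded_of_support (C := 2) (hvm.mul hWm)
      (fun q => by
        rw [abs_mul]
        nlinarith [hW1 q, abs_nonneg (W q), hv1 q, abs_nonneg (v q)])
      (fun q hq => hvs q (left_ne_zero_of_mul hq)) (volume_prod_Icc_ne_top _ _ _ _))
  have hv4 : ∫ q, v q ^ 2 ≤ 4 := by
    refine (le_abs_self _).trans ((abs_integral_le_of_support hv2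
      (fun q hq => hvs q ((pow_ne_zero_iff two_ne_zero).1 hq))
      (volume_prod_Icc_ne_top _ _ _ _).lt_top).trans (le_of_eq ?_))
    rw [Measure.volume_eq_prod, measureReal_prod_prod, Real.volume_real_Icc_of_le (by norm_num),
      Real.volume_real_Icc_of_le (by norm_num)]
    norm_num
  refine hCS.trans ((mul_le_mul_of_nonneg_right hv4
    (integral_nonneg fun q => sq_nonneg _)).trans (le_of_eq ?_))
  congr 1
  have hww : ∀ t s k y, |kernelCS a ρ ω β γ g t k y * kernelCS a ρ ω β γ g s k y| ≤ 1 :=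
    fun t s k y => by
      rw [abs_mul]; exact mul_le_one₀ (hw1 _ _ _) (abs_nonneg _) (hw1 _ _ _)
  have hjoint : Integrable (fun z : (ℝ × ℝ) × (ℝ × ℝ) =>
      kernelCS a ρ ω β γ g z.2.1 z.1.1 z.1.2 * kernelCS a ρ ω β γ g z.2.2 z.1.1 z.1.2)
      (volume.prod volume) := by
    refine integrable_of_bounded_of_support (C := 1)
      (s := (Set.Icc (-2) 2 ×ˢ Set.Icc (-M) (1 + M)) ×ˢ
        (Set.Icc (a - ρ) (a + ρ) ×ˢ Set.Icc (a - ρ) (a + ρ)))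
      ?_ (fun z => hww _ _ _ _) ?_ ?_
    · unfold kernelCS
      fun_prop
    · intro z hz
      have h2 := hws _ _ _ (left_ne_zero_of_mul hz)
      exact ⟨h2.2, h2.1, (hws _ _ _ (right_ne_zero_of_mul hz)).1⟩
    · rw [Measure.prod_prod]
      exact ENNReal.mul_ne_top (volume_prod_Icc_ne_top _ _ _ _) (volume_prod_Icc_ne_top _ _ _ _)
  calc ∫ q, W q ^ 2
      = ∫ q : ℝ × ℝ, ∫ p : ℝ × ℝ,
          kernelCS a ρ ω β γ g p.1 q.1 q.2 * kernelCS a ρ ω β γ g p.2 q.1 q.2 := by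
        congr 1; ext q
        rw [sq]
        exact (integral_prod_mul (fun t => kernelCS a ρ ω β γ g t q.1 q.2)
          (fun t => kernelCS a ρ ω β γ g t q.1 q.2)).symm
    _ = ∫ p : ℝ × ℝ, ∫ q : ℝ × ℝ,
          kernelCS a ρ ω β γ g p.1 q.1 q.2 * kernelCS a ρ ω β γ g p.2 q.1 q.2 :=
        integral_integral_swap (f := fun (q p : ℝ × ℝ) =>
          kernelCS a ρ ω β γ g p.1 q.1 q.2 * kernelCS a ρ ω β γ g p.2 q.1 q.2) hjoint
    _ = ∫ p : ℝ × ℝ, ∫ k, fourTent a ρ (p, k) * phaseCorr g γ ω β (p, k) := by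
        congr 1; ext p
        rw [Measure.volume_eq_prod, integral_prod]
        · congr 1; ext k
          exact integral_kernelCS_mul p.1 p.2 k
        · refine integrable_of_bounded_of_support (C := 1)
            (s := Set.Icc (-2) 2 ×ˢ Set.Icc (-M) (1 + M)) ?_ (fun q => hww _ _ _ _)
            (fun q hq => (hws _ _ _ (left_ne_zero_of_mul hq)).2)
            (volume_prod_Icc_ne_top _ _ _ _)
          exact (hwm.comp (measurable_prodMk_left (x := p.1))).mul
            (hwm.comp (measurable_prodMk_left (x := p.2)))
    _ = ∫ z, fourTent a ρ z * phaseCorr g γ ω β z := by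
        refine (integral_prod (fun z => fourTent a ρ z * phaseCorr g γ ω β z) ?_).symm
        refine integrable_of_bounded_of_support (C := 1)
          (measurable_fourTent.mul (measurable_phaseCorr hgm hγ)) (fun z => ?_)
          (fun z hz => mem_closedBall_of_fourTent_ne_zero hρ (left_ne_zero_of_mul hz))
          measure_closedBall_lt_top.ne
        rw [abs_mul]
        exact mul_le_one₀ (abs_fourTent_le_one hρ z) (abs_nonneg _)
          (abs_fourCorr_le_one hg.abs_le_one hg.support _ _ _)

theorem IsPhase.trilinear_pow_four_le {γ1 : ℝ → ℝ} {K : ℝ} (h : IsPhase γ γ1 ω K a ρ)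
    (hβ : 0 < β) {μ : ℝ} (hμ : 0 < μ) (hμK : 100 * K ^ 4 * μ ≤ 1) (h₀ : IsUnitBounded f₀)
    (h₁ : IsUnitBounded f₁) (hg : IsOscillating g (β * μ ^ 16)) :
    (∫ x, ∫ t, tent a ρ t * (f₀ x * f₁ (x + β * (ω * t)) * g (x + β * γ t))) ^ 4 ≤
      80000 * K ^ 4 * μ := by
  have hK0 : 0 < K := by linarith [h.one_le_const]
  have hρ : 0 < ρ := lt_of_lt_of_le (inv_pos.2 hK0) h.inv_le_scale
  have hg' : IsUnitBounded g := ⟨hg.measurable, hg.abs_le_one, hg.support⟩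
  have b1 := sq_trilinear_le (a := a) (ω := ω) (β := β) hρ h.scale_le_one h.measurable h₀ h₁ hg'
  have b2 := sq_integral_mul_kernelCS_le (β := β) h h₁ hg'
  have b3 := (abs_le.1 (h.abs_integral_fourTent_mul_le hβ hμ hμK hg)).2
  calc _ = ((∫ x, ∫ t, tent a ρ t * (f₀ x * f₁ (x + β * (ω * t)) * g (x + β * γ t))) ^ 2) ^ 2 := by
        ring
    _ ≤ (∫ q : ℝ × ℝ, (f₁ q.2 * f₁ (q.2 + β * (ω * q.1))) *
          ∫ t, kernelCS a ρ ω β γ g t q.1 q.2) ^ 2 := pow_le_pow_left₀ (sq_nonneg _) b1 2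
    _ ≤ _ := b2
    _ ≤ 4 * (20000 * K ^ 4 * μ) := by gcongr
    _ = _ := by ring

end CauchySchwarz

section Dyadic

/-- The average of `f` over the cell `((j - 1) / 2 ^ n, j / 2 ^ n]` containing `x`. -/
noncomputable def dyadicAvg (f : ℝ → ℝ) (n : ℕ) (x : ℝ) : ℝ :=
  2 ^ n * ∫ u in (((⌈2 ^ n * x⌉ : ℤ) : ℝ) - 1) / 2 ^ n..((⌈2 ^ n * x⌉ : ℤ) : ℝ) / 2 ^ n, f u

/-- Functions constant on the dyadic cells of level `n`, and vanishing outside `(0, 1]`. -/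
structure IsDyadicStep (n : ℕ) (φ : ℝ → ℝ) : Prop where
  const : ∃ c : ℤ → ℝ, ∀ x, φ x = c ⌈2 ^ n * x⌉
  support : ∀ x, φ x ≠ 0 → x ∈ Set.Ioc 0 1

theorem mem_Ioc_dyadic_iff (n : ℕ) (j : ℤ) (x : ℝ) :
    x ∈ Set.Ioc (((j : ℝ) - 1) / 2 ^ n) (j / 2 ^ n) ↔ ⌈2 ^ n * x⌉ = j := by
  rw [Int.ceil_eq_iff, Set.mem_Ioc, div_lt_iff₀' (by positivity), le_div_iff₀' (by positivity)]

theorem ceil_two_pow_mem_Icc {n : ℕ} {x : ℝ} (hx : x ∈ Set.Ioc (0 : ℝ) 1) :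
    ⌈2 ^ n * x⌉ ∈ Finset.Icc (1 : ℤ) (2 ^ n) := by
  rw [Finset.mem_Icc]
  refine ⟨Int.one_le_ceil_iff.2 (mul_pos (by positivity) hx.1), Int.ceil_le.2 ?_⟩
  push_cast
  exact mul_le_of_le_one_right (by positivity) hx.2

theorem IsDyadicStep.eq_sum {n : ℕ} {φ : ℝ → ℝ} (h : IsDyadicStep n φ) :
    ∃ c : ℤ → ℝ, (∀ x, φ x = c ⌈2 ^ n * x⌉) ∧ ∀ x, φ x = ∑ j ∈ Finset.Icc (1 : ℤ) (2 ^ n),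
      c j * (Set.Ioc (((j : ℝ) - 1) / 2 ^ n) (j / 2 ^ n)).indicator (fun _ => (1 : ℝ)) x := by
  obtain ⟨c, hc⟩ := h.const
  refine ⟨c, hc, fun x => ?_⟩
  simp only [Set.indicator_apply, mem_Ioc_dyadic_iff, mul_ite, mul_one, mul_zero,
    Finset.sum_ite_eq]
  split_ifs with hm
  · exact hc x
  · by_contra hne
    exact hm (ceil_two_pow_mem_Icc (h.support x hne))

theorem ceil_two_pow_eq_of_le {n m : ℕ} (hnm : n ≤ m) (x : ℝ) :
    ⌈2 ^ n * x⌉ = ⌈((⌈2 ^ m * x⌉ : ℤ) : ℝ) / 2 ^ (m - n)⌉ := by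
  have e : (2 : ℝ) ^ m = 2 ^ n * 2 ^ (m - n) := by rw [← pow_add, Nat.add_sub_cancel' hnm]
  refine eq_of_forall_ge_iff fun z => ?_
  rw [Int.ceil_le, Int.ceil_le, div_le_iff₀ (by positivity)]
  have : (z : ℝ) * 2 ^ (m - n) = ((z * 2 ^ (m - n) : ℤ) : ℝ) := by push_cast; ring
  rw [this, Int.cast_le, Int.ceil_le, ← this, e, mul_right_comm]
  exact (mul_le_mul_iff_left₀ (by positivity)).symm

theorem IsDyadicStep.mono {n m : ℕ} (hnm : n ≤ m) {φ : ℝ → ℝ} (h : IsDyadicStep n φ) :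
    IsDyadicStep m φ := by
  obtain ⟨c, hc⟩ := h.const
  refine ⟨⟨fun z => c ⌈((z : ℤ) : ℝ) / 2 ^ (m - n)⌉, fun x => ?_⟩, h.support⟩
  rw [hc, ceil_two_pow_eq_of_le hnm]

theorem IsDyadicStep.mul {n : ℕ} {φ ψ : ℝ → ℝ} (h : IsDyadicStep n φ) (h' : IsDyadicStep n ψ) :
    IsDyadicStep n fun x => φ x * ψ x := by
  obtain ⟨c, hc⟩ := h.const
  obtain ⟨d, hd⟩ := h'.const
  exact ⟨⟨fun z => c z * d z, fun x => by rw [hc, hd]⟩,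
    fun x hx => h.support x (left_ne_zero_of_mul hx)⟩

theorem IsDyadicStep.sub {n : ℕ} {φ ψ : ℝ → ℝ} (h : IsDyadicStep n φ) (h' : IsDyadicStep n ψ) :
    IsDyadicStep n fun x => φ x - ψ x := by
  obtain ⟨c, hc⟩ := h.const
  obtain ⟨d, hd⟩ := h'.const
  refine ⟨⟨fun z => c z - d z, fun x => by rw [hc, hd]⟩, fun x hx => ?_⟩
  by_contra hn
  apply hx
  have h1 : φ x = 0 := by by_contra hc; exact hn (h.support x hc)
  have h2 : ψ x = 0 := by by_contra hc; exact hn (h'.support x hc)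
  simp [h1, h2]

theorem IsDyadicStep.measurable {n : ℕ} {φ : ℝ → ℝ} (h : IsDyadicStep n φ) : Measurable φ := by
  obtain ⟨c, hc⟩ := h.const
  rw [funext hc]
  exact (Measurable.of_discrete (f := c)).comp (Int.measurable_ceil.comp (by fun_prop))

theorem integral_abs_indicator_Ioc_shift_le (p q δ : ℝ) :
    ∫ x, |(Set.Ioc p q).indicator (fun _ => (1 : ℝ)) (x + δ) -
      (Set.Ioc p q).indicator (fun _ => (1 : ℝ)) x| ≤ 2 * |δ| := by
  have hle : ∀ x, |(Set.Ioc p q).indicator (fun _ => (1 : ℝ)) (x + δ) -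
      (Set.Ioc p q).indicator (fun _ => (1 : ℝ)) x| ≤
      (Set.Icc (p - max δ 0) (p - min δ 0)).indicator (fun _ => (1 : ℝ)) x +
      (Set.Icc (q - max δ 0) (q - min δ 0)).indicator (fun _ => (1 : ℝ)) x := by
    intro x
    have m1 := le_max_left δ 0
    have m2 := le_max_right δ 0
    have m3 := min_le_left δ 0
    have m4 := min_le_right δ 0
    by_cases h1 : x ∈ Set.Icc (p - max δ 0) (p - min δ 0)
    · rw [Set.indicator_of_mem h1]
      have : 0 ≤ (Set.Icc (q - max δ 0) (q - min δ 0)).indicator (fun _ => (1 : ℝ)) x :=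
        Set.indicator_nonneg (fun _ _ => zero_le_one) _
      refine le_trans ?_ (le_add_of_nonneg_right this)
      simp only [Set.indicator_apply]
      split_ifs <;> simp
    by_cases h2 : x ∈ Set.Icc (q - max δ 0) (q - min δ 0)
    · rw [Set.indicator_of_mem h2]
      have : 0 ≤ (Set.Icc (p - max δ 0) (p - min δ 0)).indicator (fun _ => (1 : ℝ)) x :=
        Set.indicator_nonneg (fun _ _ => zero_le_one) _
      refine le_trans ?_ (le_add_of_nonneg_left this)
      simp only [Set.indicator_apply]
      split_ifs <;> simp
    rw [Set.indicator_of_notMem h1, Set.indicator_of_notMem h2]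
    have key : x + δ ∈ Set.Ioc p q ↔ x ∈ Set.Ioc p q := by
      simp only [Set.mem_Icc, not_and_or, not_le] at h1 h2
      simp only [Set.mem_Ioc]
      constructor
      · rintro ⟨g1, g2⟩
        constructor
        · rcases h1 with h | h <;> linarith
        · rcases h2 with h | h <;> linarith
      · rintro ⟨g1, g2⟩
        constructor
        · rcases h1 with h | h <;> linarith
        · rcases h2 with h | h <;> linarith
    simp [Set.indicator_apply, key]
  have hI : ∀ r, Integrable ((Set.Icc (r - max δ 0) (r - min δ 0)).indicator
      (fun _ => (1 : ℝ))) := fun r =>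
    (integrable_indicator_iff measurableSet_Icc).2 (integrableOn_const (by simp))
  refine (integral_mono_of_nonneg (Filter.Eventually.of_forall fun _ => abs_nonneg _)
    ((hI p).add (hI q)) (Filter.Eventually.of_forall hle)).trans (le_of_eq ?_)
  have hv : ∀ r, ∫ x, (Set.Icc (r - max δ 0) (r - min δ 0)).indicator (fun _ => (1 : ℝ)) x
      = |δ| := fun r => by
    have h3 : max δ 0 - min δ 0 = |δ| := by
      rw [max_sub_min_eq_abs']; simp
    rw [integral_indicator measurableSet_Icc, setIntegral_const, smul_eq_mul, mul_one,
      Real.volume_real_Icc_of_le (by linarith [min_le_max (a := δ) (b := 0)])]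
    linarith
  rw [integral_add' (hI p) (hI q), hv, hv]
  ring

theorem IsDyadicStep.integral_abs_shift_le {n : ℕ} {φ : ℝ → ℝ} (h : IsDyadicStep n φ) {C : ℝ}
    (hC : ∀ x, |φ x| ≤ C) (δ : ℝ) : ∫ x, |φ (x + δ) - φ x| ≤ 2 * C * 2 ^ n * |δ| := by
  obtain ⟨c, hc, hs⟩ := h.eq_sum
  have hcC : ∀ j, |c j| ≤ C := fun j => by
    have := hC (j / 2 ^ n)
    rwa [hc, mul_div_cancel₀ _ (by positivity), Int.ceil_intCast] at this
  set I : ℤ → ℝ → ℝ := fun j =>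
    (Set.Ioc (((j : ℝ) - 1) / 2 ^ n) (j / 2 ^ n)).indicator (fun _ => (1 : ℝ)) with hI
  have hint : ∀ j, Integrable (I j) := fun j =>
    (integrable_indicator_iff measurableSet_Ioc).2 (integrableOn_const (by simp))
  have hint2 : ∀ j, Integrable fun x => |c j| * |I j (x + δ) - I j x| := fun j =>
    ((((hint j).comp_add_right δ).sub (hint j)).abs).const_mul _
  calc ∫ x, |φ (x + δ) - φ x|
      ≤ ∫ x, ∑ j ∈ Finset.Icc (1 : ℤ) (2 ^ n), |c j| * |I j (x + δ) - I j x| := by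
        refine integral_mono_of_nonneg (Filter.Eventually.of_forall fun _ => abs_nonneg _)
          (integrable_finsetSum _ fun j _ => hint2 j) (Filter.Eventually.of_forall fun x => ?_)
        simp only
        rw [hs, hs, ← Finset.sum_sub_distrib]
        refine (Finset.abs_sum_le_sum_abs _ _).trans (Finset.sum_le_sum fun j _ => ?_)
        rw [← mul_sub, abs_mul]
    _ = ∑ j ∈ Finset.Icc (1 : ℤ) (2 ^ n), |c j| * ∫ x, |I j (x + δ) - I j x| := by
        rw [integral_finsetSum _ fun j _ => hint2 j]
        exact Finset.sum_congr rfl fun j _ => integral_const_mul _ _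
    _ ≤ ∑ j ∈ Finset.Icc (1 : ℤ) (2 ^ n), C * (2 * |δ|) := by
        refine Finset.sum_le_sum fun j _ => mul_le_mul (hcC j)
          (integral_abs_indicator_Ioc_shift_le _ _ _)
          (integral_nonneg fun _ => abs_nonneg _) ((abs_nonneg _).trans (hcC j))
    _ = _ := by
        rw [Finset.sum_const, Int.card_Icc, nsmul_eq_mul]
        have : (((2 : ℤ) ^ n + 1 - 1).toNat : ℝ) = 2 ^ n := by
          rw [show (2 : ℤ) ^ n + 1 - 1 = ((2 ^ n : ℕ) : ℤ) by push_cast; ring, Int.toNat_natCast]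
          push_cast; rfl
        rw [this]; ring

end Dyadic

section Dyadic

theorem mem_Ioc_zero_one_iff (n : ℕ) (u : ℝ) :
    u ∈ Set.Ioc (0 : ℝ) 1 ↔ ⌈2 ^ n * u⌉ ∈ Finset.Icc (1 : ℤ) (2 ^ n) := by
  refine ⟨ceil_two_pow_mem_Icc, fun h1 => ?_⟩
  rw [Finset.mem_Icc] at h1
  refine ⟨pos_of_mul_pos_right (Int.one_le_ceil_iff.1 h1.1) (by positivity), ?_⟩
  have := Int.ceil_le.1 h1.2
  push_cast at this
  exact le_of_mul_le_mul_left (by linarith) (by positivity : (0 : ℝ) < 2 ^ n)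

/-- Measurable functions with values in `[0, 1]` vanishing outside `(0, 1]`. -/
structure IsDensity (f : ℝ → ℝ) : Prop where
  measurable : Measurable f
  nonneg : ∀ x, 0 ≤ f x
  le_one : ∀ x, f x ≤ 1
  support : ∀ x, f x ≠ 0 → x ∈ Set.Ioc 0 1

theorem IsDensity.isUnitBounded {f : ℝ → ℝ} (h : IsDensity f) : IsUnitBounded f :=
  ⟨h.measurable, fun x => by rw [abs_of_nonneg (h.nonneg x)]; exact h.le_one x,
    fun x hx => Set.Ioc_subset_Icc_self (h.support x hx)⟩

theorem IsDensity.integrable {f : ℝ → ℝ} (h : IsDensity f) : Integrable f :=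
  h.isUnitBounded.integrable

theorem IsDensity.mul {f g : ℝ → ℝ} (hf : IsDensity f) (hg : IsDensity g) :
    IsDensity fun x => f x * g x :=
  ⟨hf.measurable.mul hg.measurable, fun x => mul_nonneg (hf.nonneg x) (hg.nonneg x),
    fun x => mul_le_one₀ (hf.le_one x) (hg.nonneg x) (hg.le_one x),
    fun x hx => hf.support x (left_ne_zero_of_mul hx)⟩

theorem IsDensity.isUnitBounded_sub {f g : ℝ → ℝ} (hf : IsDensity f) (hg : IsDensity g) :
    IsUnitBounded fun x => f x - g x := by
  refine ⟨hf.measurable.sub hg.measurable, fun x => ?_, fun x hx => ?_⟩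
  · rw [abs_le]
    constructor <;> linarith [hf.nonneg x, hf.le_one x, hg.nonneg x, hg.le_one x]
  · by_contra hn
    apply hx
    have h1 : f x = 0 := by
      by_contra hc; exact hn (Set.Ioc_subset_Icc_self (hf.support x hc))
    have h2 : g x = 0 := by
      by_contra hc; exact hn (Set.Ioc_subset_Icc_self (hg.support x hc))
    simp [h1, h2]

theorem isDyadicStep_dyadicAvg {f : ℝ → ℝ} (hf : ∀ x, f x ≠ 0 → x ∈ Set.Ioc (0 : ℝ) 1) (n : ℕ) :
    IsDyadicStep n (dyadicAvg f n) := by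
  refine ⟨⟨fun z => 2 ^ n * ∫ u in ((z : ℝ) - 1) / 2 ^ n..(z : ℝ) / 2 ^ n, f u,
    fun x => rfl⟩, fun x hx => ?_⟩
  by_contra hn
  apply hx
  rw [dyadicAvg, intervalIntegral.integral_of_le (by gcongr; linarith),
    setIntegral_eq_zero_of_forall_eq_zero, mul_zero]
  intro u hu
  rw [mem_Ioc_dyadic_iff] at hu
  by_contra hne
  have h1 := ceil_two_pow_mem_Icc (n := n) (hf u hne)
  rw [hu] at h1
  exact hn ((mem_Ioc_zero_one_iff n x).2 h1)

theorem integral_mul_eq_sum {n : ℕ} {φ h : ℝ → ℝ} {c : ℤ → ℝ} (hh : Integrable h)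
    (hs : ∀ x, φ x = ∑ j ∈ Finset.Icc (1 : ℤ) (2 ^ n),
      c j * (Set.Ioc (((j : ℝ) - 1) / 2 ^ n) (j / 2 ^ n)).indicator (fun _ => (1 : ℝ)) x) :
    ∫ x, h x * φ x = ∑ j ∈ Finset.Icc (1 : ℤ) (2 ^ n),
      c j * ∫ x in ((j : ℝ) - 1) / 2 ^ n..j / 2 ^ n, h x := by
  have e : ∀ x, h x * φ x = ∑ j ∈ Finset.Icc (1 : ℤ) (2 ^ n),
      c j * (Set.Ioc (((j : ℝ) - 1) / 2 ^ n) (j / 2 ^ n)).indicator h x := fun x => by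
    rw [hs, Finset.mul_sum]
    refine Finset.sum_congr rfl fun j _ => ?_
    simp only [Set.indicator_apply]
    split_ifs <;> ring
  simp_rw [e]
  rw [integral_finsetSum _ fun j _ => (hh.indicator measurableSet_Ioc).const_mul _]
  refine Finset.sum_congr rfl fun j _ => ?_
  rw [integral_const_mul, integral_indicator measurableSet_Ioc,
    intervalIntegral.integral_of_le (by gcongr; linarith)]

theorem intervalIntegral_dyadicAvg (f : ℝ → ℝ) (n : ℕ) (j : ℤ) :
    ∫ x in ((j : ℝ) - 1) / 2 ^ n..j / 2 ^ n, dyadicAvg f n x =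
      ∫ x in ((j : ℝ) - 1) / 2 ^ n..j / 2 ^ n, f x := by
  have hle : ((j : ℝ) - 1) / 2 ^ n ≤ j / 2 ^ n := by gcongr; linarith
  rw [intervalIntegral.integral_of_le hle, setIntegral_congr_fun (g := fun _ =>
    2 ^ n * ∫ x in ((j : ℝ) - 1) / 2 ^ n..j / 2 ^ n, f x) measurableSet_Ioc
    fun x hx => by rw [mem_Ioc_dyadic_iff] at hx; simp only [dyadicAvg, hx],
    setIntegral_const, Real.volume_real_Ioc_of_le hle, smul_eq_mul]
  field_simp
  ring

theorem IsDensity.isDensity_dyadicAvg {f : ℝ → ℝ} (h : IsDensity f) (n : ℕ) : IsDensity (dyadicAvg f n) := by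
  have hs := isDyadicStep_dyadicAvg h.support n
  have hle : ∀ j : ℤ, ((j : ℝ) - 1) / 2 ^ n ≤ j / 2 ^ n := fun j => by gcongr; linarith
  refine ⟨hs.measurable, fun x => ?_, fun x => ?_, hs.support⟩
  · exact mul_nonneg (by positivity) (intervalIntegral.integral_nonneg (hle _) fun u _ => h.nonneg u)
  · have h1 : ∫ u in (((⌈2 ^ n * x⌉ : ℤ) : ℝ) - 1) / 2 ^ n..((⌈2 ^ n * x⌉ : ℤ) : ℝ) / 2 ^ n, f u
        ≤ ∫ u in (((⌈2 ^ n * x⌉ : ℤ) : ℝ) - 1) / 2 ^ n..((⌈2 ^ n * x⌉ : ℤ) : ℝ) / 2 ^ n, (1 : ℝ) :=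
      intervalIntegral.integral_mono_on (hle _) h.integrable.intervalIntegrable
        (by simp) fun u _ => h.le_one u
    rw [intervalIntegral.integral_const, smul_eq_mul, mul_one, ← sub_div, sub_sub_cancel] at h1
    calc 2 ^ n * _ ≤ (2 : ℝ) ^ n * (1 / 2 ^ n) := by gcongr
      _ = 1 := by field_simp

theorem IsDyadicStep.integrable_mul {n : ℕ} {φ g : ℝ → ℝ} (hφ : IsDyadicStep n φ)
    (hg : Integrable g) : Integrable fun x => g x * φ x := by
  obtain ⟨c, -, hs⟩ := hφ.eq_sum
  refine hg.mul_bdd (c := ∑ j ∈ Finset.Icc (1 : ℤ) (2 ^ n), |c j|)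
    hφ.measurable.aestronglyMeasurable (Filter.Eventually.of_forall fun x => ?_)
  rw [hs x, Real.norm_eq_abs]
  refine (Finset.abs_sum_le_sum_abs _ _).trans (Finset.sum_le_sum fun j _ => ?_)
  simp only [Set.indicator_apply]
  split_ifs <;> simp

variable {f : ℝ → ℝ}

theorem IsDensity.integral_dyadicAvg_mul (h : IsDensity f) {n m : ℕ} (hnm : n ≤ m) {φ : ℝ → ℝ}
    (hφ : IsDyadicStep n φ) : ∫ x, dyadicAvg f m x * φ x = ∫ x, f x * φ x := by
  obtain ⟨c, -, hs⟩ := (hφ.mono hnm).eq_sum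
  rw [integral_mul_eq_sum (h.isDensity_dyadicAvg m).integrable hs, integral_mul_eq_sum h.integrable hs]
  simp_rw [intervalIntegral_dyadicAvg]

theorem abs_intervalIntegral_le_of_forall_step {h : ℝ → ℝ} (hh : IsUnitBounded h) {n : ℕ}
    (h0 : ∀ φ, IsDyadicStep n φ → ∫ x, h x * φ x = 0)
    (hs : ∀ x, h x ≠ 0 → x ∈ Set.Ioc (0 : ℝ) 1) (x y : ℝ) :
    |∫ u in x..y, h u| ≤ 2 * (2 ^ n)⁻¹ := by
  have key : ∀ x, |∫ u in Set.Iic x, h u| ≤ (2 ^ n)⁻¹ := fun x => by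
    set φ : ℝ → ℝ := {u | u ∈ Set.Ioc (0 : ℝ) 1 ∧ ⌈2 ^ n * u⌉ < ⌈2 ^ n * x⌉}.indicator 1 with hφ
    have hstep : IsDyadicStep n φ := by
      refine ⟨⟨fun z => if z ∈ Finset.Icc (1 : ℤ) (2 ^ n) ∧ z < ⌈2 ^ n * x⌉ then 1 else 0,
        fun u => ?_⟩, fun u hu => (Set.mem_of_indicator_ne_zero hu).1⟩
      have hiff := mem_Ioc_zero_one_iff n u
      simp only [hφ, Set.indicator_apply, Set.mem_ofPred_eq, hiff, Pi.one_apply]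
    have e1 : ∫ u in Set.Iic x, h u = ∫ u, h u * ((Set.Iic x).indicator 1 u - φ u) := by
      have i1 : Integrable fun u => h u * (Set.Iic x).indicator 1 u := by
        refine (hh.integrable.indicator (measurableSet_Iic (a := x))).congr
          (Filter.Eventually.of_forall fun u => ?_)
        simp only [Set.indicator_apply, Pi.one_apply]
        split_ifs <;> simp
      have i2 : Integrable fun u => h u * φ u := by
        refine integrable_of_support_Icc (C := 1) (p := 0) (q := 1)
          (hh.measurable.mul hstep.measurable) (fun u => ?_)
          (fun u hu => hh.support u (left_ne_zero_of_mul hu))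
        rw [abs_mul]
        refine mul_le_one₀ (hh.abs_le_one u) (abs_nonneg _) ?_
        simp only [hφ, Set.indicator_apply, Pi.one_apply]
        split_ifs <;> simp
      simp_rw [mul_sub]
      rw [integral_sub i1 i2, h0 φ hstep, sub_zero, ← integral_indicator measurableSet_Iic]
      congr 1; ext u
      simp only [Set.indicator_apply, Pi.one_apply]
      split_ifs <;> simp
    have hd : ∀ u ∈ Set.Ioc (0 : ℝ) 1, (Set.Iic x).indicator 1 u - φ u ≠ 0 →
        u ∈ Set.Ioc ((((⌈2 ^ n * x⌉ : ℤ) : ℝ) - 1) / 2 ^ n) ((⌈2 ^ n * x⌉ : ℤ) / 2 ^ n) := by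
      intro u hu hne
      rw [mem_Ioc_dyadic_iff]
      by_contra hc
      apply hne
      rcases lt_or_gt_of_ne hc with hlt | hgt
      · have hux : u ≤ x := by
          by_contra! hcon
          exact absurd hlt (not_lt.2 (Int.ceil_mono (by gcongr)))
        simp [hφ, hlt, hux, hu.1, hu.2]
      · have hux : ¬ u ≤ x := fun hcon =>
          absurd hgt (not_lt.2 (Int.ceil_mono (by gcongr)))
        simp [hφ, hux, hgt.le]
    rw [e1]
    refine (abs_integral_le_of_support (C := 1) (fun u => ?_) (fun u hu =>
      hd u (hs u (left_ne_zero_of_mul hu)) (right_ne_zero_of_mul hu)) (by simp)).trans ?_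
    · rw [abs_mul]
      refine mul_le_one₀ (hh.abs_le_one u) (abs_nonneg _) ?_
      simp only [hφ, Set.indicator_apply, Pi.one_apply]
      split_ifs <;> simp
    · rw [Real.volume_real_Ioc_of_le (by gcongr; linarith), ← sub_div, sub_sub_cancel, one_mul,
        one_div]
  rw [← intervalIntegral.integral_Iic_sub_Iic hh.integrable.integrableOn hh.integrable.integrableOn]
  have h1 := abs_le.1 (key x)
  have h2 := abs_le.1 (key y)
  exact abs_le.2 ⟨by linarith, by linarith⟩

theorem IsDensity.isOscillating_dyadicAvg_sub (h : IsDensity f) (n : ℕ) :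
    IsOscillating (fun x => dyadicAvg f (n + 1) x - dyadicAvg f n x) (2 ^ n)⁻¹ := by
  have hu := (h.isDensity_dyadicAvg (n + 1)).isUnitBounded_sub (h.isDensity_dyadicAvg n)
  have hs := ((isDyadicStep_dyadicAvg h.support n).mono n.le_succ)
  have hs1 := isDyadicStep_dyadicAvg h.support (n + 1)
  refine ⟨hu.measurable, hu.abs_le_one, hu.support, fun δ => ?_, fun x y => ?_⟩
  · refine ((hs1.sub hs).integral_abs_shift_le hu.abs_le_one δ).trans ?_
    rw [div_inv_eq_mul, pow_succ]
    have : 0 ≤ 2 ^ n * |δ| := by positivity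
    linarith
  · refine abs_intervalIntegral_le_of_forall_step hu (fun φ hφ => ?_) (hs1.sub hs).support x y
    simp_rw [sub_mul]
    rw [integral_sub (hφ.integrable_mul (h.isDensity_dyadicAvg (n + 1)).integrable)
      (hφ.integrable_mul (h.isDensity_dyadicAvg n).integrable), h.integral_dyadicAvg_mul n.le_succ hφ,
      h.integral_dyadicAvg_mul le_rfl hφ, sub_self]

theorem IsDensity.abs_intervalIntegral_sub_dyadicAvg_le (h : IsDensity f) (n : ℕ) (x y : ℝ) :
    |∫ u in x..y, (f u - dyadicAvg f n u)| ≤ 2 * (2 ^ n)⁻¹ := by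
  refine abs_intervalIntegral_le_of_forall_step (h.isUnitBounded_sub (h.isDensity_dyadicAvg n))
    (fun φ hφ => ?_) (fun x hx => ?_) x y
  · simp_rw [sub_mul]
    rw [integral_sub (hφ.integrable_mul h.integrable)
      (hφ.integrable_mul (h.isDensity_dyadicAvg n).integrable),
      h.integral_dyadicAvg_mul le_rfl hφ, sub_self]
  · by_contra hn
    apply hx
    have h1 : f x = 0 := by by_contra hc; exact hn (h.support x hc)
    have h2 : dyadicAvg f n x = 0 := by
      by_contra hc; exact hn ((h.isDensity_dyadicAvg n).support x hc)
    rw [h1, h2, sub_self]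

theorem IsDensity.integral_sq_dyadicAvg_sub (h : IsDensity f) {n m : ℕ} (hnm : n ≤ m) :
    ∫ x, (dyadicAvg f m x - dyadicAvg f n x) ^ 2 =
      (∫ x, dyadicAvg f m x ^ 2) - ∫ x, dyadicAvg f n x ^ 2 := by
  have hn := h.isDensity_dyadicAvg n
  have hm := h.isDensity_dyadicAvg m
  have hs := isDyadicStep_dyadicAvg h.support n
  have e1 : ∫ x, dyadicAvg f m x * dyadicAvg f n x =
      ∫ x, dyadicAvg f n x * dyadicAvg f n x :=
    (h.integral_dyadicAvg_mul hnm hs).trans (h.integral_dyadicAvg_mul le_rfl hs).symm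
  have e2 : ∀ x, (dyadicAvg f m x - dyadicAvg f n x) ^ 2 =
      dyadicAvg f m x * dyadicAvg f m x
        - 2 * (dyadicAvg f m x * dyadicAvg f n x)
        + dyadicAvg f n x * dyadicAvg f n x := fun x => by ring
  have i1 := (hm.mul hm).integrable
  have i2 := (hm.mul hn).integrable.const_mul 2
  have i3 := (hn.mul hn).integrable
  simp_rw [e2]
  rw [integral_add (f := fun x => dyadicAvg f m x * dyadicAvg f m x
      - 2 * (dyadicAvg f m x * dyadicAvg f n x)) (i1.sub i2) i3, integral_sub i1 i2, integral_const_mul, e1]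
  simp_rw [sq]
  ring

/-- Dyadic averages at two scales correlate with the function itself. -/
theorem IsDensity.cube_integral_le (h : IsDensity f) {n m : ℕ} (hnm : n ≤ m) :
    (∫ x, f x) ^ 3 ≤ ∫ x, f x * (dyadicAvg f m x * dyadicAvg f n x) := by
  set A := dyadicAvg f n with hA
  set B := dyadicAvg f m with hB
  set I := ∫ x, f x with hI
  have dA : IsDensity A := h.isDensity_dyadicAvg n
  have dB : IsDensity B := h.isDensity_dyadicAvg m
  have sA : IsDyadicStep n A := isDyadicStep_dyadicAvg h.support n
  have sB : IsDyadicStep m B := isDyadicStep_dyadicAvg h.support m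
  have hI0 : 0 ≤ I := integral_nonneg h.nonneg
  have e1 : ∫ x, f x * (B x * A x) = ∫ x, B x * (B x * A x) :=
    (h.integral_dyadicAvg_mul le_rfl (sB.mul (sA.mono hnm))).symm
  have e2 : ∫ x, B x * (A x * A x) = ∫ x, A x * (A x * A x) :=
    (h.integral_dyadicAvg_mul hnm (sA.mul sA)).trans
      (h.integral_dyadicAvg_mul le_rfl (sA.mul sA)).symm
  have sOne : IsDyadicStep n ((Set.Ioc (0 : ℝ) 1).indicator 1) := by
    refine ⟨⟨fun z => if z ∈ Finset.Icc (1 : ℤ) (2 ^ n) then 1 else 0, fun u => ?_⟩,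
      fun u hu => Set.mem_of_indicator_ne_zero hu⟩
    have hiff := mem_Ioc_zero_one_iff n u
    simp only [Set.indicator_apply, hiff, Pi.one_apply]
  have hone : ∀ {g : ℝ → ℝ}, IsDensity g → ∀ x, g x * (Set.Ioc (0 : ℝ) 1).indicator 1 x = g x := by
    intro g hg x
    by_cases hx : x ∈ Set.Ioc (0 : ℝ) 1
    · simp [hx]
    · have : g x = 0 := by by_contra hc; exact hx (hg.support x hc)
      simp [this]
  have e3 : ∫ x, A x = I := by
    have := h.integral_dyadicAvg_mul (le_refl n) sOne
    simpa only [← hA, hone dA, hone h] using this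
  have i1 := (dB.mul (dB.mul dA)).integrable
  have i2 := (dB.mul (dA.mul dA)).integrable
  have i3 := (dA.mul (dA.mul dA)).integrable
  have b1 : 2 * (∫ x, B x * (A x * A x)) - ∫ x, A x * (A x * A x) ≤ ∫ x, B x * (B x * A x) := by
    rw [← integral_const_mul, ← integral_sub (i2.const_mul 2) i3]
    refine integral_mono ((i2.const_mul 2).sub i3) i1 fun x => ?_
    have := mul_nonneg (dA.nonneg x) (sq_nonneg (B x - A x))
    simp only
    nlinarith
  have hind : Integrable ((Set.Ioc (0 : ℝ) 1).indicator (1 : ℝ → ℝ)) :=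
    (integrable_indicator_iff measurableSet_Ioc).2 (integrableOn_const (by simp))
  have b2 : 3 * I ^ 2 * (∫ x, A x) - 2 * I ^ 3 * (∫ x, (Set.Ioc (0 : ℝ) 1).indicator 1 x) ≤
      ∫ x, A x * (A x * A x) := by
    rw [← integral_const_mul, ← integral_const_mul,
      ← integral_sub (dA.integrable.const_mul _) (hind.const_mul _)]
    refine integral_mono ((dA.integrable.const_mul _).sub (hind.const_mul _)) i3 fun x => ?_
    simp only
    by_cases hx : x ∈ Set.Ioc (0 : ℝ) 1
    · simp only [Set.indicator_of_mem hx, Pi.one_apply]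
      have := mul_nonneg (by linarith [dA.nonneg x] : 0 ≤ A x + 2 * I) (sq_nonneg (A x - I))
      nlinarith
    · have : A x = 0 := by by_contra hc; exact hx (dA.support x hc)
      simp [this, Set.indicator_of_notMem hx]
  have e4 : ∫ x, (Set.Ioc (0 : ℝ) 1).indicator (1 : ℝ → ℝ) x = 1 := by
    rw [integral_indicator measurableSet_Ioc]; simp
  rw [e3, e4] at b2
  rw [e1]
  nlinarith

end Dyadic

section Dyadic
open Filter Topology

theorem dyadicAvg_eq_average_closedBall (f : ℝ → ℝ) (n : ℕ) (x : ℝ) :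
    dyadicAvg f n x =
      ⨍ y in Metric.closedBall (((⌈2 ^ n * x⌉ : ℤ) - 1 / 2) / (2 : ℝ) ^ n) (1 / 2 * (1 / 2) ^ n),
        f y := by
  have hle : ((⌈2 ^ n * x⌉ : ℤ) - 1 : ℝ) / 2 ^ n ≤ (⌈2 ^ n * x⌉ : ℤ) / 2 ^ n := by
    gcongr; linarith
  have hp : (0 : ℝ) < 2 ^ n := by positivity
  rw [Real.closedBall_eq_Icc, one_div_pow,
    show ((⌈2 ^ n * x⌉ : ℤ) - 1 / 2) / (2 : ℝ) ^ n - 1 / 2 * (1 / 2 ^ n) =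
      ((⌈2 ^ n * x⌉ : ℤ) - 1 : ℝ) / 2 ^ n by field_simp; ring,
    show ((⌈2 ^ n * x⌉ : ℤ) - 1 / 2) / (2 : ℝ) ^ n + 1 / 2 * (1 / 2 ^ n) =
      (⌈2 ^ n * x⌉ : ℤ) / 2 ^ n by field_simp; ring,
    setAverage_eq, Real.volume_real_Icc_of_le hle, dyadicAvg,
    intervalIntegral.integral_of_le hle, integral_Icc_eq_integral_Ioc, smul_eq_mul, ← sub_div,
    sub_sub_cancel, one_div, inv_inv]

theorem IsDensity.tendsto_integral_abs_sub_dyadicAvg {f : ℝ → ℝ} (h : IsDensity f) :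
    Tendsto (fun n => ∫ x, |f x - dyadicAvg f n x|) atTop (𝓝 0) := by
  have hae : ∀ᵐ x, Tendsto (fun n => dyadicAvg f n x) atTop (𝓝 (f x)) := by
    filter_upwards [IsUnifLocDoublingMeasure.ae_tendsto_average (μ := volume)
      h.integrable.locallyIntegrable 1] with x hx
    simp_rw [dyadicAvg_eq_average_closedBall]
    refine hx (l := atTop) (fun n : ℕ => ((⌈2 ^ n * x⌉ : ℤ) - 1 / 2) / (2 : ℝ) ^ n)
      (fun n : ℕ => 1 / 2 * (1 / 2) ^ n) ?_ (Eventually.of_forall fun n => ?_)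
    · refine tendsto_nhdsWithin_iff.2 ⟨?_, Eventually.of_forall fun n => ?_⟩
      · have := (tendsto_pow_atTop_nhds_zero_of_lt_one (r := (1 / 2 : ℝ)) (by norm_num)
          (by norm_num)).const_mul (1 / 2)
        rwa [mul_zero] at this
      · exact Set.mem_Ioi.2 (by positivity)
    · have hp : (0 : ℝ) < 2 ^ n := by positivity
      have h1 := Int.le_ceil (2 ^ n * x)
      have h2 := Int.ceil_lt_add_one (2 ^ n * x)
      rw [Metric.mem_closedBall, Real.dist_eq, one_mul, one_div_pow,
        show x - ((⌈2 ^ n * x⌉ : ℤ) - 1 / 2) / (2 : ℝ) ^ n =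
          (2 ^ n * x - ((⌈2 ^ n * x⌉ : ℤ) - 1 / 2)) / 2 ^ n by field_simp,
        abs_div, abs_of_pos hp, mul_one_div]
      gcongr
      rw [abs_le]
      constructor <;> linarith
  have := tendsto_integral_of_dominated_convergence (F := fun n x => |f x - dyadicAvg f n x|)
    (f := fun _ => (0 : ℝ)) (μ := volume) ((Set.Icc (0 : ℝ) 1).indicator 1)
    (fun n => (h.measurable.sub (h.isDensity_dyadicAvg n).measurable).abs.aestronglyMeasurable)
    ((integrable_indicator_iff measurableSet_Icc).2 (integrableOn_const (by simp)))
    (fun n => Eventually.of_forall fun x => ?_) ?_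
  · simpa using this
  · have hu := h.isUnitBounded_sub (h.isDensity_dyadicAvg n)
    rw [Real.norm_eq_abs, abs_abs]
    by_cases hx : x ∈ Set.Icc (0 : ℝ) 1
    · simpa [Set.indicator_of_mem hx] using hu.abs_le_one x
    · have : f x - dyadicAvg f n x = 0 := by by_contra hc; exact hx (hu.support x hc)
      simp [this, Set.indicator_of_notMem hx]
  · filter_upwards [hae] with x hx
    simpa using ((tendsto_const_nhds (x := f x)).sub hx).abs

end Dyadic

section WindowAverage

/-- Bounded jointly measurable functions `F t x` vanishing for `x` outside `[0, 1]`. -/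
structure IsAdmissible (F : ℝ → ℝ → ℝ) : Prop where
  measurable : Measurable fun z : ℝ × ℝ => F z.1 z.2
  bounded : ∃ C, ∀ t x, |F t x| ≤ C
  support : ∀ t x, F t x ≠ 0 → x ∈ Set.Icc 0 1

/-- The integral of `F t x` against the weight `tent a ρ t`. -/
noncomputable def windowIntegral (a ρ : ℝ) (F : ℝ → ℝ → ℝ) : ℝ :=
  ∫ t, tent a ρ t * ∫ x, F t x

variable {F G : ℝ → ℝ → ℝ} {a ρ : ℝ}

theorem IsAdmissible.sub (hF : IsAdmissible F) (hG : IsAdmissible G) :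
    IsAdmissible fun t x => F t x - G t x := by
  obtain ⟨C, hC⟩ := hF.bounded
  obtain ⟨D, hD⟩ := hG.bounded
  refine ⟨hF.measurable.sub hG.measurable, ⟨C + D, fun t x => ?_⟩, fun t x hx => ?_⟩
  · exact (abs_sub _ _).trans (add_le_add (hC t x) (hD t x))
  · by_contra hn
    apply hx
    have h1 : F t x = 0 := by by_contra hc; exact hn (hF.support t x hc)
    have h2 : G t x = 0 := by by_contra hc; exact hn (hG.support t x hc)
    simp [h1, h2]

theorem IsAdmissible.integrable (hF : IsAdmissible F) (t : ℝ) : Integrable (F t) := by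
  obtain ⟨C, hC⟩ := hF.bounded
  exact integrable_of_support_Icc (hF.measurable.comp measurable_prodMk_left) (hC t)
    (hF.support t)

theorem IsAdmissible.integrable_tent_mul (hF : IsAdmissible F) (hρ : 0 < ρ) :
    Integrable fun t => tent a ρ t * ∫ x, F t x := by
  obtain ⟨C, hC⟩ := hF.bounded
  have hC' : ∀ t, |∫ x, F t x| ≤ C := fun t =>
    (abs_integral_le_of_support (hC t) (hF.support t) (by simp)).trans (by simp)
  refine integrable_of_support_Icc (C := C) (p := a - ρ) (q := a + ρ)
    ((measurable_tent).mul (StronglyMeasurable.integral_prod_right'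
      (f := fun p : ℝ × ℝ => F p.1 p.2) hF.measurable.stronglyMeasurable).measurable)
    (fun t => ?_) (fun t ht => mem_Icc_of_tent_ne_zero hρ (left_ne_zero_of_mul ht))
  rw [abs_mul]
  calc _ ≤ 1 * C := mul_le_mul (abs_tent_le_one hρ t) (hC' t) (abs_nonneg _) zero_le_one
    _ = C := one_mul C

theorem integral_tent (a : ℝ) (hρ : 0 < ρ) : ∫ t, tent a ρ t = ρ := by
  have e : ∀ t, tent a ρ t = (Set.Icc (a - ρ) (a + ρ)).indicator (fun t => 1 - |t - a| / ρ) t :=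
    fun t => by
      rw [Set.indicator_apply]
      split_ifs with h
      · rw [tent, max_eq_right]
        have : |t - a| ≤ ρ := abs_le.2 ⟨by linarith [h.1], by linarith [h.2]⟩
        have := div_le_one_of_le₀ this hρ.le
        linarith
      · by_contra hc
        exact h (mem_Icc_of_tent_ne_zero hρ hc)
  simp_rw [e]
  rw [integral_indicator measurableSet_Icc, integral_Icc_eq_integral_Ioc,
    ← intervalIntegral.integral_of_le (by linarith),
    ← intervalIntegral.integral_add_adjacent_intervals (b := a)
      (Continuous.intervalIntegrable (by fun_prop) _ _)
      (Continuous.intervalIntegrable (by fun_prop) _ _)]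
  have e1 : ∫ t in a - ρ..a, (1 - |t - a| / ρ) = ∫ t in a - ρ..a, (1 + (t - a) / ρ) := by
    refine intervalIntegral.integral_congr fun t ht => ?_
    rw [Set.uIcc_of_le (by linarith)] at ht
    rw [abs_of_nonpos (by linarith [ht.2])]
    ring
  have e2 : ∫ t in a..a + ρ, (1 - |t - a| / ρ) = ∫ t in a..a + ρ, (1 - (t - a) / ρ) := by
    refine intervalIntegral.integral_congr fun t ht => ?_
    rw [Set.uIcc_of_le (by linarith)] at ht
    rw [abs_of_nonneg (by linarith [ht.1])]
  have c1 : ∫ t in a - ρ..a, (t - a) = -(ρ ^ 2 / 2) := by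
    rw [intervalIntegral.integral_comp_sub_right (fun t => t) a, integral_id]; ring
  have c2 : ∫ t in a..a + ρ, (t - a) = ρ ^ 2 / 2 := by
    rw [intervalIntegral.integral_comp_sub_right (fun t => t) a, integral_id]; ring
  rw [e1, e2, intervalIntegral.integral_add intervalIntegrable_const
      (Continuous.intervalIntegrable (by fun_prop) _ _),
    intervalIntegral.integral_sub intervalIntegrable_const (Continuous.intervalIntegrable (by fun_prop) _ _),
    intervalIntegral.integral_div, intervalIntegral.integral_div, c1, c2]
  simp
  field_simp
  ring

theorem windowIntegral_sub (hF : IsAdmissible F) (hG : IsAdmissible G) (hρ : 0 < ρ) :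
    windowIntegral a ρ (fun t x => F t x - G t x) = windowIntegral a ρ F - windowIntegral a ρ G := by
  rw [windowIntegral, windowIntegral, windowIntegral,
    ← integral_sub (hF.integrable_tent_mul hρ) (hG.integrable_tent_mul hρ)]
  congr 1; ext t
  rw [integral_sub (hF.integrable t) (hG.integrable t), mul_sub]

theorem abs_windowIntegral_le (hρ : 0 < ρ) {e : ℝ}
    (h : ∀ t ∈ Set.Icc (a - ρ) (a + ρ), |∫ x, F t x| ≤ e) : |windowIntegral a ρ F| ≤ ρ * e := by
  have hi : Integrable (tent a ρ) :=
    integrable_of_support_Icc measurable_tent (abs_tent_le_one hρ)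
      (fun t ht => mem_Icc_of_tent_ne_zero hρ ht)
  calc |windowIntegral a ρ F| ≤ ∫ t, |tent a ρ t * ∫ x, F t x| := abs_integral_le_integral_abs
    _ ≤ ∫ t, tent a ρ t * e := by
        refine integral_mono_of_nonneg (Filter.Eventually.of_forall fun _ => abs_nonneg _)
          (hi.mul_const e) (Filter.Eventually.of_forall fun t => ?_)
        simp only
        by_cases ht : tent a ρ t = 0
        · simp [ht]
        · rw [abs_mul, abs_of_nonneg (tent_nonneg t)]
          exact mul_le_mul_of_nonneg_left (h t (mem_Icc_of_tent_ne_zero hρ ht)) (tent_nonneg t)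
    _ = ρ * e := by rw [integral_mul_const, integral_tent a hρ]

theorem windowIntegral_eq_integral_integral (hF : IsAdmissible F) (hρ : 0 < ρ) :
    windowIntegral a ρ F = ∫ x, ∫ t, tent a ρ t * F t x := by
  obtain ⟨C, hC⟩ := hF.bounded
  rw [windowIntegral]
  simp_rw [← integral_const_mul]
  refine integral_integral_swap (f := fun t x => tent a ρ t * F t x)
    (integrable_of_bounded_of_support (C := C) (s := Set.Icc (a - ρ) (a + ρ) ×ˢ Set.Icc 0 1)
    ((measurable_tent.comp measurable_fst).mul hF.measurable) (fun z => ?_) (fun z hz =>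
      ⟨mem_Icc_of_tent_ne_zero hρ (left_ne_zero_of_mul hz),
        hF.support _ _ (right_ne_zero_of_mul hz)⟩) (volume_prod_Icc_ne_top _ _ _ _))
  simp only [Function.uncurry]
  rw [abs_mul]
  calc _ ≤ 1 * C := mul_le_mul (abs_tent_le_one hρ _) (hC _ _) (abs_nonneg _) zero_le_one
    _ = C := one_mul C

theorem abs_integral_tent_mul_le {D : ℝ → ℝ} (hρ : 0 < ρ) (hD : Measurable D)
    (hD1 : ∀ t, |D t| ≤ 1) {e : ℝ} (h : ∀ x y, |∫ u in x..y, D u| ≤ e) :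
    |∫ t, tent a ρ t * D t| ≤ e := by
  have e1 : ∀ t, tent a ρ t * D t =
      ρ⁻¹ * ∫ s in Set.Ioo 0 ρ, (Set.Ioo (a - s) (a + s)).indicator D t := fun t => by
    have hi : ∀ s, (Set.Ioo (a - s) (a + s)).indicator D t =
        (Set.Ioi |t - a|).indicator (fun _ => D t) s := fun s => by
      simp only [Set.indicator_apply, Set.mem_Ioo, Set.mem_Ioi, abs_lt]
      refine if_congr ⟨fun h => ⟨by linarith [h.1], by linarith [h.2]⟩,
        fun h => ⟨by linarith [h.1], by linarith [h.2]⟩⟩ rfl rfl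
    simp_rw [hi]
    rw [setIntegral_indicator measurableSet_Ioi, setIntegral_const, smul_eq_mul,
      show Set.Ioo 0 ρ ∩ Set.Ioi |t - a| = Set.Ioo |t - a| ρ by
        ext s
        simp only [Set.mem_inter_iff, Set.mem_Ioo, Set.mem_Ioi]
        exact ⟨fun h => ⟨h.2, h.1.2⟩, fun h => ⟨⟨(abs_nonneg _).trans_lt h.1, h.2⟩, h.1⟩⟩,
      measureReal_def, Real.volume_Ioo, ← mul_assoc]
    congr 1
    rw [ENNReal.toReal_ofReal', tent, mul_max_of_nonneg _ _ (inv_nonneg.2 hρ.le), mul_zero,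
      max_comm]
    congr 1
    field_simp
  simp_rw [e1]
  rw [integral_const_mul]
  have hsw : ∫ t, ∫ s in Set.Ioo 0 ρ, (Set.Ioo (a - s) (a + s)).indicator D t =
      ∫ s in Set.Ioo 0 ρ, ∫ t, (Set.Ioo (a - s) (a + s)).indicator D t := by
    have hm : Measurable fun z : ℝ × ℝ => (Set.Ioo 0 ρ).indicator
        (fun s => (Set.Ioo (a - s) (a + s)).indicator D z.1) z.2 := by
      have h1 : MeasurableSet {z : ℝ × ℝ | z.2 ∈ Set.Ioo 0 ρ ∧ z.1 ∈ Set.Ioo (a - z.2) (a + z.2)} := by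
        simp only [Set.mem_Ioo]
        measurability
      convert (hD.comp measurable_fst).indicator h1 using 1
      ext z
      simp only [Set.indicator_apply, Set.mem_ofPred_eq, Function.comp_apply]
      split_ifs <;> tauto
    have := integral_integral_swap (μ := volume) (ν := volume) (f := fun t s =>
      (Set.Ioo 0 ρ).indicator (fun s => (Set.Ioo (a - s) (a + s)).indicator D t) s)
      (integrable_of_bounded_of_support (C := 1) (s := Set.Icc (a - ρ) (a + ρ) ×ˢ Set.Icc 0 ρ)
      hm (fun z => ?_) (fun z hz => ?_) (volume_prod_Icc_ne_top _ _ _ _))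
    · simp_rw [integral_indicator (measurableSet_Ioo (a := (0 : ℝ)) (b := ρ))] at this
      rw [this, ← integral_indicator measurableSet_Ioo]
      congr 1; ext s
      by_cases hs : s ∈ Set.Ioo 0 ρ <;> simp [hs]
    · simp only [Function.uncurry, Set.indicator_apply]
      split_ifs <;> simp [hD1]
    · simp only [Function.uncurry] at hz
      have h1 := Set.mem_of_indicator_ne_zero hz
      simp only [Set.indicator_of_mem h1] at hz
      have h2 := Set.mem_of_indicator_ne_zero hz
      exact ⟨⟨by linarith [h1.2, h2.1], by linarith [h1.2, h2.2]⟩, h1.1.le, h1.2.le⟩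
  rw [hsw, abs_mul, abs_of_pos (inv_pos.2 hρ)]
  have hb : |∫ s in Set.Ioo 0 ρ, ∫ t, (Set.Ioo (a - s) (a + s)).indicator D t| ≤ e * ρ := by
    refine (norm_setIntegral_le_of_norm_le_const (C := e)
      (f := fun s => ∫ t, (Set.Ioo (a - s) (a + s)).indicator D t) (μ := volume) (s := Set.Ioo 0 ρ)
      (by rw [Real.volume_Ioo]; exact ENNReal.ofReal_lt_top) (fun s hs => ?_)).trans
      (le_of_eq (by rw [Real.volume_real_Ioo_of_le hρ.le, sub_zero]))
    rw [integral_indicator measurableSet_Ioo, ← integral_Ioc_eq_integral_Ioo,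
      ← intervalIntegral.integral_of_le (by linarith [hs.1])]
    exact h _ _
  calc _ ≤ ρ⁻¹ * (e * ρ) := by gcongr
    _ = e := by field_simp

end WindowAverage

section Pattern

variable {f h₁ h₂ : ℝ → ℝ} {a ρ : ℝ}

theorem isAdmissible_mul_mul {φ₁ φ₂ : ℝ → ℝ} (hf : IsUnitBounded f) (m₁ : Measurable h₁)
    (b₁ : ∀ x, |h₁ x| ≤ 1) (m₂ : Measurable h₂) (b₂ : ∀ x, |h₂ x| ≤ 1) (hφ₁ : Measurable φ₁)
    (hφ₂ : Measurable φ₂) :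
    IsAdmissible fun t x => f x * (h₁ (x + φ₁ t) * h₂ (x + φ₂ t)) := by
  have := hf.measurable
  refine ⟨by fun_prop, ⟨1, fun t x => ?_⟩, fun t x hx => hf.support x (left_ne_zero_of_mul hx)⟩
  rw [abs_mul, abs_mul]
  exact mul_le_one₀ (hf.abs_le_one _) (by positivity)
    (mul_le_one₀ (b₁ _) (by positivity) (b₂ _))

theorem abs_windowIntegral_sub_le {F G : ℝ → ℝ → ℝ} (hF : IsAdmissible F) (hG : IsAdmissible G)
    (hρ : 0 < ρ) {e : ℝ}
    (h : ∀ t ∈ Set.Icc (a - ρ) (a + ρ), |∫ x, (F t x - G t x)| ≤ e) :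
    |windowIntegral a ρ F - windowIntegral a ρ G| ≤ ρ * e := by
  rw [← windowIntegral_sub hF hG hρ]
  exact abs_windowIntegral_le hρ h

theorem abs_integral_le_of_abs_le_abs {F k : ℝ → ℝ} (hk : Integrable k)
    (h : ∀ x, |F x| ≤ |k x|) : |∫ x, F x| ≤ ∫ x, |k x| :=
  abs_integral_le_integral_abs.trans
    (integral_mono_of_nonneg (Filter.Eventually.of_forall fun _ => abs_nonneg _) hk.abs
      (Filter.Eventually.of_forall h))

theorem IsUnitBounded.integral_abs_le {h : ℝ → ℝ} (hh : IsUnitBounded h) {e : ℝ} (he : 0 ≤ e)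
    (h2 : ∫ x, h x ^ 2 ≤ e ^ 2) : ∫ x, |h x| ≤ e := by
  have hind : Integrable ((Set.Icc (0 : ℝ) 1).indicator (1 : ℝ → ℝ)) :=
    (integrable_indicator_iff measurableSet_Icc).2 (integrableOn_const (by simp))
  have e1 : ∀ x, (Set.Icc (0 : ℝ) 1).indicator (1 : ℝ → ℝ) x * |h x| = |h x| := fun x => by
    by_cases hx : x ∈ Set.Icc (0 : ℝ) 1
    · simp [hx]
    · have : h x = 0 := by by_contra hc; exact hx (hh.support x hc)
      simp [this]
  have e2 : ∀ x, (Set.Icc (0 : ℝ) 1).indicator (1 : ℝ → ℝ) x ^ 2 =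
      (Set.Icc (0 : ℝ) 1).indicator (1 : ℝ → ℝ) x := fun x => by
    simp only [Set.indicator_apply]; split_ifs <;> simp
  have hsq : Integrable fun x => h x ^ 2 := by
    simpa only [sq] using (hh.mul hh.measurable hh.abs_le_one).integrable
  have := sq_integral_mul_le (μ := volume) (f := (Set.Icc (0 : ℝ) 1).indicator (1 : ℝ → ℝ))
    (g := fun x => |h x|) (by simpa only [e2] using hind) (by simpa only [sq_abs] using hsq)
    (by simpa only [e1] using hh.integrable.abs)
  simp only [e1, e2, sq_abs] at this
  rw [integral_indicator measurableSet_Icc] at this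
  simp only [Pi.one_apply, integral_const, smul_eq_mul, mul_one, measureReal_restrict_apply_univ,
    Real.volume_real_Icc, sub_zero, max_eq_left zero_le_one, one_mul] at this
  exact le_of_sq_le_sq (this.trans h2) he

theorem exists_sum_pow_le : ∃ θ : ℝ, 0 < θ ∧ θ < 1 ∧ θ ^ 64 = 1 / 2 ∧
    ∀ n : ℕ, ∑ i ∈ Finset.range n, θ ^ i ≤ 100 := by
  refine ⟨(1 / 2 : ℝ) ^ ((64 : ℕ) : ℝ)⁻¹, by positivity, Real.rpow_lt_one (by norm_num)
    (by norm_num) (by positivity), Real.rpow_inv_natCast_pow (by norm_num) (by norm_num), fun n => ?_⟩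
  set θ := (1 / 2 : ℝ) ^ ((64 : ℕ) : ℝ)⁻¹ with hθ
  have h0 : 0 < θ := by positivity
  have h64 : θ ^ 64 = 1 / 2 := Real.rpow_inv_natCast_pow (by norm_num) (by norm_num)
  have h99 : θ ≤ 99 / 100 := by
    by_contra! hc
    have := pow_lt_pow_left₀ hc (by norm_num) (n := 64) (by norm_num)
    rw [h64] at this
    norm_num at this
  have := geom_sum_mul_neg θ n
  have hs : 0 ≤ ∑ i ∈ Finset.range n, θ ^ i := Finset.sum_nonneg fun i _ => by positivity
  have hp : 0 < θ ^ n := by positivity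
  nlinarith

variable {γ γ1 : ℝ → ℝ} {ω K β : ℝ}

theorem IsPhase.abs_windowIntegral_dyadicAvg_sub_le (h : IsPhase γ γ1 ω K a ρ) (hβ : 0 < β)
    (hf : IsDensity f) {e : ℝ} (he : 0 < e) (he1 : e ≤ 1) {m : ℕ}
    (hm : (2 ^ m)⁻¹ ≤ β * (ρ * e / (1700 * K)) ^ 64) {M : ℕ} (hM : m ≤ M) :
    |windowIntegral a ρ (fun t x => f x * (f (x + β * (ω * t)) * dyadicAvg f M (x + β * γ t))) -
      windowIntegral a ρ (fun t x => f x * (f (x + β * (ω * t)) * dyadicAvg f m (x + β * γ t)))| ≤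
      ρ * e := by
  have hK1 := h.one_le_const
  have hK0 : 0 < K := by linarith
  have hρ : 0 < ρ := lt_of_lt_of_le (inv_pos.2 hK0) h.inv_le_scale
  have hρ1 := h.scale_le_one
  obtain ⟨θ, hθ0, hθ1, hθ, hsum⟩ := exists_sum_pow_le
  set lam : ℝ := ((2 ^ m)⁻¹ / β) ^ ((64 : ℕ) : ℝ)⁻¹ with hlam
  have hl0 : 0 < lam := by positivity
  have hl64 : lam ^ 64 = (2 ^ m)⁻¹ / β :=
    Real.rpow_inv_natCast_pow (by positivity) (by norm_num)
  have hlle : lam ≤ ρ * e / (1700 * K) := by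
    refine le_of_pow_le_pow_left₀ (n := 64) (by norm_num) (by positivity) ?_
    rw [hl64, div_le_iff₀ hβ, mul_comm]
    exact hm
  have hlK : 1700 * K * lam ≤ ρ * e := by
    rw [le_div_iff₀ (by positivity)] at hlle; linarith
  have hγ := h.measurable
  have adm : ∀ k, IsAdmissible fun t x =>
      f x * (f (x + β * (ω * t)) * dyadicAvg f k (x + β * γ t)) := fun k =>
    isAdmissible_mul_mul (φ₁ := fun t => β * (ω * t)) (φ₂ := fun t => β * γ t) hf.isUnitBounded
      hf.measurable hf.isUnitBounded.abs_le_one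
      (hf.isDensity_dyadicAvg k).measurable (hf.isDensity_dyadicAvg k).isUnitBounded.abs_le_one
      (by fun_prop) (by fun_prop)
  have hstep : ∀ i, |windowIntegral a ρ (fun t x =>
        f x * (f (x + β * (ω * t)) * dyadicAvg f (m + (i + 1)) (x + β * γ t))) -
      windowIntegral a ρ (fun t x =>
        f x * (f (x + β * (ω * t)) * dyadicAvg f (m + i) (x + β * γ t)))| ≤
      17 * K * lam * θ ^ i := fun i => by
    have hosc := hf.isOscillating_dyadicAvg_sub (m + i)
    set μ : ℝ := (lam * θ ^ i) ^ 4 with hμ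
    have hθi : θ ^ i ≤ 1 := pow_le_one₀ hθ0.le hθ1.le
    have hl : ((2 : ℝ) ^ (m + i))⁻¹ = β * μ ^ 16 := by
      rw [hμ, show ((lam * θ ^ i) ^ 4) ^ 16 = lam ^ 64 * (θ ^ 64) ^ i by ring, hθ, hl64, pow_add,
        mul_inv, one_div, inv_pow]
      field_simp
    rw [hl] at hosc
    have hK4 : 100 * K ^ 4 * μ ≤ 1 := by
      have h1 : 1700 * K * (lam * θ ^ i) ≤ 1 := by
        have : lam * θ ^ i ≤ lam := mul_le_of_le_one_right hl0.le hθi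
        have : 1700 * K * (lam * θ ^ i) ≤ 1700 * K * lam := by gcongr
        nlinarith
      have h2 : (1700 * K * (lam * θ ^ i)) ^ 4 ≤ 1 := pow_le_one₀ (by positivity) h1
      have h3 : 0 ≤ K ^ 4 * μ := by positivity
      have h4 : (1700 * K * (lam * θ ^ i)) ^ 4 = 1700 ^ 4 * (K ^ 4 * μ) := by rw [hμ]; ring
      rw [h4] at h2
      linarith
    have key := h.trilinear_pow_four_le hβ (by positivity : 0 < μ) hK4 hf.isUnitBounded
      hf.isUnitBounded hosc
    rw [← windowIntegral_sub (adm _) (adm _) hρ,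
      windowIntegral_eq_integral_integral ((adm _).sub (adm _)) hρ]
    have e1 : ∀ x t, tent a ρ t *
        (f x * (f (x + β * (ω * t)) * dyadicAvg f (m + (i + 1)) (x + β * γ t)) -
          f x * (f (x + β * (ω * t)) * dyadicAvg f (m + i) (x + β * γ t))) =
        tent a ρ t * (f x * f (x + β * (ω * t)) * (dyadicAvg f (m + i + 1) (x + β * γ t) -
          dyadicAvg f (m + i) (x + β * γ t))) := fun x t => by
      rw [← add_assoc]; ring
    simp_rw [e1]
    refine le_of_pow_le_pow_left₀ (n := 4) (by norm_num) (by positivity) ?_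
    rw [Even.pow_abs (by decide)]
    refine key.trans ?_
    have h3 : 0 ≤ K ^ 4 * μ := by positivity
    have h4 : (17 * K * lam * θ ^ i) ^ 4 = 83521 * (K ^ 4 * μ) := by rw [hμ]; ring
    rw [h4]
    linarith
  obtain ⟨j, rfl⟩ := Nat.exists_eq_add_of_le hM
  have hind : ∀ j, |windowIntegral a ρ (fun t x =>
        f x * (f (x + β * (ω * t)) * dyadicAvg f (m + j) (x + β * γ t))) -
      windowIntegral a ρ (fun t x => f x * (f (x + β * (ω * t)) * dyadicAvg f m (x + β * γ t)))| ≤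
      17 * K * lam * ∑ i ∈ Finset.range j, θ ^ i := fun j => by
    induction j with
    | zero => simp
    | succ j ih =>
      rw [Finset.sum_range_succ, mul_add]
      calc _ ≤ _ := abs_sub_le _ (windowIntegral a ρ (fun t x =>
            f x * (f (x + β * (ω * t)) * dyadicAvg f (m + j) (x + β * γ t)))) _
        _ ≤ _ := by rw [add_comm]; exact add_le_add ih (hstep j)
  refine (hind j).trans ?_
  calc _ ≤ 17 * K * lam * 100 := by gcongr; exact hsum j
    _ = 1700 * K * lam := by ring
    _ ≤ _ := hlK

end Pattern

section Pattern

variable {f : ℝ → ℝ} {a ρ : ℝ} {γ γ1 : ℝ → ℝ} {ω K β : ℝ}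

theorem integral_abs_comp_add {k : ℝ → ℝ} (u : ℝ) : ∫ x, |k (x + u)| = ∫ x, |k x| :=
  integral_add_right_eq_self (fun x => |k x|) u

theorem IsDensity.abs_integral_mul_mul_le (hf : IsDensity f) {h k : ℝ → ℝ}
    (b : ∀ x, |h x| ≤ 1) (hk : Integrable k) : |∫ x, f x * (h x * k x)| ≤ ∫ x, |k x| :=
  abs_integral_le_of_abs_le_abs hk fun x => by
    rw [abs_mul, abs_mul]
    have h1 : |h x| * |k x| ≤ |k x| := mul_le_of_le_one_left (abs_nonneg _) (b x)
    exact (mul_le_of_le_one_left (by positivity) (hf.isUnitBounded.abs_le_one x)).trans h1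

theorem IsDensity.integral_abs_dyadicAvg_sub_le (hf : IsDensity f) {n m : ℕ} (hnm : n ≤ m) {e : ℝ}
    (he : 0 ≤ e) (h : (∫ x, dyadicAvg f m x ^ 2) - ∫ x, dyadicAvg f n x ^ 2 ≤ e ^ 2) :
    ∫ x, |dyadicAvg f m x - dyadicAvg f n x| ≤ e :=
  ((hf.isDensity_dyadicAvg m).isUnitBounded_sub (hf.isDensity_dyadicAvg n)).integral_abs_le he
    (by rw [hf.integral_sq_dyadicAvg_sub hnm]; exact h)

theorem IsDensity.integral_abs_dyadicAvg_shift_le (hf : IsDensity f) (n : ℕ) (δ : ℝ) :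
    ∫ x, |dyadicAvg f n (x + δ) - dyadicAvg f n x| ≤ 2 ^ (n + 1) * |δ| := by
  refine ((isDyadicStep_dyadicAvg hf.support n).integral_abs_shift_le
    (hf.isDensity_dyadicAvg n).isUnitBounded.abs_le_one δ).trans (le_of_eq ?_)
  ring

/-- If all scales match, a function of positive mean has a nontrivial three-term pattern. -/
theorem IsPhase.exists_pattern (h : IsPhase γ γ1 ω K a ρ) (hβ : 0 < β) (hω : ω ≠ 0)
    (hf : IsDensity f) {e : ℝ} (he : 0 < e) (he1 : e ≤ 1) (hfe : 16 * e ≤ (∫ x, f x) ^ 3)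
    {n m n' m' : ℕ} (hnm : n ≤ m) (hnm' : n' ≤ m') (hnn : n ≤ n')
    (hm : (2 ^ m)⁻¹ ≤ β * (ρ * e / (1700 * K)) ^ 64)
    (hE : (∫ x, dyadicAvg f m x ^ 2) - ∫ x, dyadicAvg f n x ^ 2 ≤ e ^ 2)
    (hn : ∀ t ∈ Set.Icc (a - ρ) (a + ρ), 2 ^ (n + 1) * |β * γ t| ≤ e)
    (hm' : 2 * (2 ^ m')⁻¹ ≤ ρ * e * (β * |ω|))
    (hE' : (∫ x, dyadicAvg f m' x ^ 2) - ∫ x, dyadicAvg f n' x ^ 2 ≤ e ^ 2)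
    (hn' : ∀ t ∈ Set.Icc (a - ρ) (a + ρ), 2 ^ (n' + 1) * |β * (ω * t)| ≤ e) :
    ∃ x, ∃ t ∈ Set.Icc (a - ρ) (a + ρ),
      f x ≠ 0 ∧ f (x + β * (ω * t)) ≠ 0 ∧ f (x + β * γ t) ≠ 0 := by
  by_contra! hno
  have hK0 : 0 < K := by linarith [h.one_le_const]
  have hρ : 0 < ρ := lt_of_lt_of_le (inv_pos.2 hK0) h.inv_le_scale
  have hγ := h.measurable
  have hu := hf.isUnitBounded
  have hd := fun k => hf.isDensity_dyadicAvg k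
  have hdu := fun k => (hd k).isUnitBounded
  have adm : ∀ {g k : ℝ → ℝ} {φ₁ φ₂ : ℝ → ℝ}, IsDensity g → IsDensity k → Measurable φ₁ →
      Measurable φ₂ → IsAdmissible fun t x => f x * (g (x + φ₁ t) * k (x + φ₂ t)) :=
    fun hg hk m₁ m₂ => isAdmissible_mul_mul hu hg.measurable hg.isUnitBounded.abs_le_one
      hk.measurable hk.isUnitBounded.abs_le_one m₁ m₂
  have mω : Measurable fun t : ℝ => β * (ω * t) := by fun_prop
  have mγ : Measurable fun t : ℝ => β * γ t := by fun_prop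
  have m0 : Measurable fun _ : ℝ => (0 : ℝ) := measurable_const
  have diff : ∀ {g k l : ℝ → ℝ} (u v w : ℝ),
      IsDensity g → IsDensity k → IsDensity l → |∫ x, (f x * (g (x + u) * k (x + v)) -
        f x * (g (x + u) * l (x + w)))| ≤ ∫ x, |k (x + v) - l (x + w)| := by
    intro g k l u v w hg hk hl
    simp_rw [← mul_sub]
    exact hf.abs_integral_mul_mul_le (fun x => hg.isUnitBounded.abs_le_one _)
      ((hk.integrable.comp_add_right v).sub (hl.integrable.comp_add_right w))
  obtain ⟨M, hmM, hM⟩ : ∃ M, m ≤ M ∧ ∫ x, |f x - dyadicAvg f M x| ≤ e := by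
    have := (hf.tendsto_integral_abs_sub_dyadicAvg.eventually (gt_mem_nhds he)).and
      (Filter.eventually_ge_atTop m)
    obtain ⟨M, h1, h2⟩ := this.exists
    exact ⟨M, h2, h1.le⟩
  have s0 : windowIntegral a ρ
      (fun t x => f x * (f (x + β * (ω * t)) * f (x + β * γ t))) = 0 := by
    rw [windowIntegral]
    refine integral_eq_zero_of_ae (Filter.Eventually.of_forall fun t => ?_)
    simp only [Pi.zero_apply, mul_eq_zero]
    by_cases ht : tent a ρ t = 0
    · exact Or.inl ht
    · refine Or.inr (integral_eq_zero_of_ae (Filter.Eventually.of_forall fun x => ?_))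
      simp only [Pi.zero_apply, mul_eq_zero]
      by_contra! hc
      exact hc.2.2 (hno x t (mem_Icc_of_tent_ne_zero hρ ht) hc.1 hc.2.1)
  have s1 := abs_windowIntegral_sub_le (a := a) (e := e) (adm hf hf mω mγ) (adm hf (hd M) mω mγ) hρ
    fun t _ => (diff _ _ _ hf hf (hd M)).trans
      (by rw [integral_abs_comp_add (k := fun x => f x - dyadicAvg f M x)]; exact hM)
  have s2 := h.abs_windowIntegral_dyadicAvg_sub_le hβ hf he he1 hm hmM
  have s3 := abs_windowIntegral_sub_le (a := a) (e := e) (adm hf (hd m) mω mγ)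
    (adm hf (hd n) mω mγ) hρ fun t _ => (diff _ _ _ hf (hd m) (hd n)).trans
      (by rw [integral_abs_comp_add (k := fun x => dyadicAvg f m x - dyadicAvg f n x)]
          exact hf.integral_abs_dyadicAvg_sub_le hnm he.le hE)
  have s4 := abs_windowIntegral_sub_le (a := a) (e := e) (adm hf (hd n) mω mγ)
    (adm hf (hd n) mω m0) hρ fun t ht => (diff _ _ _ hf (hd n) (hd n)).trans
      (by simp only [add_zero]; exact (hf.integral_abs_dyadicAvg_shift_le n _).trans (hn t ht))
  have s5 : |windowIntegral a ρ (fun t x => f x * (f (x + β * (ω * t)) * dyadicAvg f n (x + 0))) -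
      windowIntegral a ρ (fun t x => f x * (dyadicAvg f m' (x + β * (ω * t)) *
        dyadicAvg f n (x + 0)))| ≤ ρ * e := by
    rw [← windowIntegral_sub (adm hf (hd n) mω m0) (adm (hd m') (hd n) mω m0) hρ,
      windowIntegral_eq_integral_integral ((adm hf (hd n) mω m0).sub (adm (hd m') (hd n) mω m0)) hρ]
    have e1 : ∀ x, ∫ t, tent a ρ t * (f x * (f (x + β * (ω * t)) * dyadicAvg f n (x + 0)) -
        f x * (dyadicAvg f m' (x + β * (ω * t)) * dyadicAvg f n (x + 0))) =
        f x * dyadicAvg f n x * ∫ t, tent a ρ t * (f (x + β * ω * t) -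
          dyadicAvg f m' (x + β * ω * t)) := fun x => by
      rw [← integral_const_mul]; congr 1; ext t; rw [add_zero, mul_assoc β]; ring
    simp_rw [e1]
    have hD := hf.isUnitBounded_sub (hd m')
    have hDm := hD.measurable
    have b1 : ∀ x, |∫ t, tent a ρ t * (f (x + β * ω * t) - dyadicAvg f m' (x + β * ω * t))| ≤
        ρ * e := fun x => by
      refine abs_integral_tent_mul_le hρ (D := fun t => f (x + β * ω * t) -
        dyadicAvg f m' (x + β * ω * t)) (hDm.comp (by fun_prop : Measurable fun t =>
          x + β * ω * t)) (fun t => hD.abs_le_one _) fun y z => ?_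
      rw [intervalIntegral.integral_comp_add_mul (fun x => f x - dyadicAvg f m' x)
        (mul_ne_zero hβ.ne' hω), smul_eq_mul, abs_mul, abs_inv, abs_mul, abs_of_pos hβ]
      have hw := abs_pos.2 hω
      rw [inv_mul_le_iff₀ (by positivity), mul_comm (β * |ω|)]
      exact (hf.abs_intervalIntegral_sub_dyadicAvg_le m' _ _).trans hm'
    refine (abs_integral_le_of_support (C := ρ * e) (s := Set.Icc (0 : ℝ) 1) (fun x => ?_)
      (fun x hx => hu.support x (left_ne_zero_of_mul (left_ne_zero_of_mul hx))) (by simp)).trans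
      (by simp)
    rw [abs_mul]
    refine (mul_le_of_le_one_left (abs_nonneg _) ?_).trans (b1 x)
    rw [abs_mul]
    exact mul_le_one₀ (hu.abs_le_one x) (abs_nonneg _) ((hdu n).abs_le_one x)
  have diff' : ∀ {g k l : ℝ → ℝ} (u v w : ℝ),
      IsDensity g → IsDensity k → IsDensity l → |∫ x, (f x * (k (x + v) * g (x + u)) -
        f x * (l (x + w) * g (x + u)))| ≤ ∫ x, |k (x + v) - l (x + w)| := by
    intro g k l u v w hg hk hl
    simp_rw [mul_comm _ (g _)]
    exact diff u v w hg hk hl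
  have s6 := abs_windowIntegral_sub_le (a := a) (e := e) (adm (hd m') (hd n) mω m0)
    (adm (hd n') (hd n) mω m0) hρ fun t _ => (diff' _ _ _ (hd n) (hd m') (hd n')).trans
      (by rw [integral_abs_comp_add (k := fun x => dyadicAvg f m' x - dyadicAvg f n' x)]
          exact hf.integral_abs_dyadicAvg_sub_le hnm' he.le hE')
  have s7 := abs_windowIntegral_sub_le (a := a) (e := e) (adm (hd n') (hd n) mω m0)
    (adm (hd n') (hd n) m0 m0) hρ fun t ht => (diff' _ _ _ (hd n) (hd n') (hd n')).trans
      (by simp only [add_zero]; exact (hf.integral_abs_dyadicAvg_shift_le n' _).trans (hn' t ht))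
  have s8 : ρ * (16 * e) ≤ windowIntegral a ρ
      (fun _ x => f x * (dyadicAvg f n' (x + 0) * dyadicAvg f n (x + 0))) := by
    rw [windowIntegral, integral_mul_const, integral_tent a hρ]
    simp only [add_zero]
    gcongr
    exact hfe.trans (hf.cube_integral_le hnn)
  have hpos : 0 < ρ * e := by positivity
  rw [s0] at s1
  rw [abs_le] at s1 s2 s3 s4 s5 s6 s7
  linarith [s1.1, s1.2, s2.1, s2.2, s3.1, s3.2, s4.1, s4.2, s5.1, s5.2, s6.1, s6.2, s7.1, s7.2]

end Pattern

theorem le_abs_sub_of_hasDerivAt {f f' : ℝ → ℝ} {c : ℝ} {x y : ℝ}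
    (hd : ∀ u ∈ Set.uIcc x y, HasDerivAt f (f' u) u) (hc : ∀ u ∈ Set.uIcc x y, c ≤ |f' u|) :
    c * |y - x| ≤ |f y - f x| := by
  wlog h : x < y generalizing x y with H
  · rcases eq_or_lt_of_le (not_lt.1 h) with rfl | h'
    · simp
    · rw [abs_sub_comm, abs_sub_comm (f y)]
      exact H (by rwa [Set.uIcc_comm]) (by rwa [Set.uIcc_comm]) h'
  rw [Set.uIcc_of_le h.le] at hd hc
  obtain ⟨u, hu, he⟩ := exists_hasDerivAt_eq_slope f f' h
    (fun u hu => (hd u hu).continuousAt.continuousWithinAt)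
    fun u hu => hd u (Set.Ioo_subset_Icc_self hu)
  rw [eq_div_iff (by linarith)] at he
  rw [← he, abs_mul]
  exact mul_le_mul_of_nonneg_right (hc u (Set.Ioo_subset_Icc_self hu)) (abs_nonneg _)

/-- The mixed derivative of `(1 - γ1 t / γ1 (t + k)) / (γ1 t - ω)` in `t` and `k` controls its
increments. -/
theorem curved_of_le_abs_deriv {γ1 γ2 A A1 B B1 : ℝ → ℝ} {ω c p q : ℝ}
    (h1 : ∀ t ∈ Set.Icc p q, HasDerivAt γ1 (γ2 t) t)
    (hA : ∀ t ∈ Set.Icc p q, HasDerivAt A (A1 t) t)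
    (hB : ∀ t ∈ Set.Icc p q, HasDerivAt B (B1 t) t)
    (hγ : ∀ t ∈ Set.Icc p q, γ1 t ≠ 0) 
    (hAe : ∀ t ∈ Set.Icc p q, A t = γ1 t / (γ1 t - ω))
    (hBe : ∀ t ∈ Set.Icc p q, B t = γ2 t / γ1 t ^ 2)
    (hc : ∀ t ∈ Set.Icc p q, ∀ s ∈ Set.Icc p q, c ≤ |A1 t * B s + A t * B1 s|) {t s k : ℝ}
    (ht : t ∈ Set.Icc p q) (hs : s ∈ Set.Icc p q) (htk : t + k ∈ Set.Icc p q)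
    (hsk : s + k ∈ Set.Icc p q) :
    c * (|k| * |t - s|) ≤ |(1 - γ1 t / γ1 (t + k)) / (γ1 t - ω)
      - (1 - γ1 s / γ1 (s + k)) / (γ1 s - ω)| := by
  have hmem : ∀ {r : ℝ}, r ∈ Set.Icc p q → r + k ∈ Set.Icc p q → ∀ u ∈ Set.uIcc 0 k,
      r + u ∈ Set.Icc p q := fun {r} hr hrk u hu => by
    have : r + u ∈ Set.uIcc (r + 0) (r + k) := by
      rcases Set.mem_uIcc.1 hu with h | h
      · exact Set.mem_uIcc.2 (Or.inl ⟨by linarith [h.1], by linarith [h.2]⟩)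
      · exact Set.mem_uIcc.2 (Or.inr ⟨by linarith [h.1], by linarith [h.2]⟩)
    exact Set.uIcc_subset_Icc (by simpa using hr) hrk this
  have hder : ∀ {r : ℝ}, r ∈ Set.Icc p q → r + k ∈ Set.Icc p q → ∀ u ∈ Set.uIcc 0 k,
      HasDerivAt (fun u => (1 - γ1 r / γ1 (r + u)) / (γ1 r - ω)) (A r * B (r + u)) u := by
    intro r hr hrk u hu
    have hm := hmem hr hrk u hu
    have := (((hasDerivAt_const u (γ1 r)).div ((h1 _ hm).comp_const_add r u) (hγ _ hm)).const_sub
      1).div_const (γ1 r - ω)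
    refine this.congr_deriv ?_
    rw [hAe r hr, hBe _ hm]
    have := hγ _ hm
    by_cases h0 : γ1 r - ω = 0
    · simp [h0]
    · field_simp
      ring
  have key := le_abs_sub_of_hasDerivAt (x := 0) (y := k) (c := c * |t - s|)
    (fun u hu => (hder ht htk u hu).sub (hder hs hsk u hu)) (fun u hu => by
      have hmt := hmem ht htk u hu
      have hms := hmem hs hsk u hu
      have hin : ∀ r ∈ Set.uIcc s t, r ∈ Set.Icc p q ∧ r + u ∈ Set.Icc p q := by
        intro r hr
        refine ⟨Set.uIcc_subset_Icc hs ht hr, ?_⟩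
        rcases Set.mem_uIcc.1 hr with h | h
        · exact ⟨by linarith [hms.1, h.1], by linarith [hmt.2, h.2]⟩
        · exact ⟨by linarith [hmt.1, h.1], by linarith [hms.2, h.2]⟩
      exact le_abs_sub_of_hasDerivAt (f := fun r => A r * B (r + u)) (x := s) (y := t)
        (fun r hr => (hA r (hin r hr).1).mul ((hB _ (hin r hr).2).comp_add_const r u))
        fun r hr => hc r (hin r hr).1 _ (hin r hr).2)
  have e0 : ∀ {r : ℝ}, r ∈ Set.Icc p q → (1 - γ1 r / γ1 (r + 0)) / (γ1 r - ω) = 0 := by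
    intro r hr
    rw [add_zero, div_self (hγ r hr), sub_self, zero_div]
  simp only [Pi.sub_apply, e0 ht, e0 hs, sub_zero] at key
  linarith [key, mul_comm |k| |t - s|, mul_assoc c |t - s| |k|]

/-- A function strictly monotone on an interval extends to an increasing homeomorphism. -/
theorem exists_homeomorph_eqOn_Icc {f : ℝ → ℝ} {l r : ℝ} (hlr : l ≤ r)
    (hf : ContinuousOn f (Set.Icc l r)) (hm : StrictMonoOn f (Set.Icc l r)) :
    ∃ e : ℝ ≃ₜ ℝ, StrictMono e ∧ Set.EqOn e f (Set.Icc l r) := by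
  let g : ℝ → ℝ := fun x => Set.projIcc l r hlr x
  let F : ℝ → ℝ := fun x => f (g x) + (x - g x)
  have hgm : ∀ x, g x ∈ Set.Icc l r := fun x => (Set.projIcc l r hlr x).2
  have hg : Continuous g := continuous_subtype_val.comp continuous_projIcc
  have hF : Continuous F := (hf.comp_continuous hg hgm).add (continuous_id.sub hg)
  have hmono : StrictMono F := by
    intro x y hxy
    have h1 : g x ≤ g y := Set.monotone_projIcc hlr hxy.le
    have h2 : g y - g x ≤ y - x := by
      have := Set.abs_projIcc_sub_projIcc (c := y) (d := x) hlr
      rw [abs_of_pos (by linarith : 0 < y - x)] at this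
      exact (le_abs_self _).trans this
    rcases h1.eq_or_lt with h | h
    · simp only [F, h]; linarith
    · have := hm (hgm x) (hgm y) h
      simp only [F]; linarith
  have htop : Filter.Tendsto F Filter.atTop Filter.atTop := by
    have : Filter.Tendsto (fun x => f r + (x - r)) Filter.atTop Filter.atTop :=
      Filter.tendsto_atTop_add_const_left _ _ (Filter.tendsto_atTop_add_const_right _ (-r) Filter.tendsto_id)
    refine this.congr' ?_
    filter_upwards [Filter.eventually_ge_atTop r] with x hx
    simp only [F, g, Set.projIcc_of_right_le hlr hx]
  have hbot : Filter.Tendsto F Filter.atBot Filter.atBot := by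
    have : Filter.Tendsto (fun x => f l + (x - l)) Filter.atBot Filter.atBot :=
      Filter.tendsto_atBot_add_const_left _ _ (Filter.tendsto_atBot_add_const_right _ (-l) Filter.tendsto_id)
    refine this.congr' ?_
    filter_upwards [Filter.eventually_le_atBot l] with x hx
    simp only [F, g, Set.projIcc_of_le_left hlr hx]
  refine ⟨(hmono.orderIsoOfSurjective F (hF.surjective htop hbot)).toHomeomorph, hmono, ?_⟩
  intro x hx
  change F x = f x
  simp only [F, g, Set.projIcc_of_mem hlr hx]
  ring

theorem Polynomial.exists_local_inverse {p : ℝ[X]} {x₀ σ c : ℝ} (hσ : 0 < σ) (hc : 0 < c)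
    (hp : ∀ x ∈ Set.Icc (x₀ - σ) (x₀ + σ), c ≤ p.derivative.eval x) :
    ∃ ψ : ℝ → ℝ, Continuous ψ ∧ ∀ u ∈ Set.Ioo (p.eval x₀ - c * σ) (p.eval x₀ + c * σ),
      ψ u ∈ Set.Icc (x₀ - σ) (x₀ + σ) ∧ p.eval (ψ u) = u ∧
      HasDerivAt ψ (p.derivative.eval (ψ u))⁻¹ u := by
  have hgrow : ∀ x ∈ Set.Icc (x₀ - σ) (x₀ + σ), ∀ y ∈ Set.Icc (x₀ - σ) (x₀ + σ), x ≤ y →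
      c * (y - x) ≤ p.eval y - p.eval x := by
    intro x hx y hy hxy
    refine (convex_Icc (x₀ - σ) (x₀ + σ)).mul_sub_le_image_sub_of_le_deriv
      p.continuous.continuousOn p.differentiable.differentiableOn (fun z hz => ?_) x hx y hy hxy
    rw [p.deriv]
    exact hp z (interior_subset hz)
  obtain ⟨e, he, heq⟩ := exists_homeomorph_eqOn_Icc (l := x₀ - σ) (r := x₀ + σ) (by linarith)
    p.continuous.continuousOn (fun x hx y hy hxy => by
      have := hgrow x hx y hy hxy.le
      have : 0 < c * (y - x) := mul_pos hc (by linarith)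
      linarith)
  refine ⟨e.symm, e.symm.continuous, fun u hu => ?_⟩
  have hl : (x₀ - σ) ∈ Set.Icc (x₀ - σ) (x₀ + σ) := ⟨le_rfl, by linarith⟩
  have hr : (x₀ + σ) ∈ Set.Icc (x₀ - σ) (x₀ + σ) := ⟨by linarith, le_rfl⟩
  have h0 : x₀ ∈ Set.Icc (x₀ - σ) (x₀ + σ) := ⟨by linarith, by linarith⟩
  have hmem : e.symm u ∈ Set.Ioo (x₀ - σ) (x₀ + σ) := by
    constructor
    · rw [← he.lt_iff_lt, e.apply_symm_apply, heq hl]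
      linarith [hu.1, hgrow _ hl _ h0 (by linarith)]
    · rw [← he.lt_iff_lt, e.apply_symm_apply, heq hr]
      linarith [hu.2, hgrow _ h0 _ hr (by linarith)]
  have hmem' := Set.Ioo_subset_Icc_self hmem
  refine ⟨hmem', (heq hmem').symm.trans (e.apply_symm_apply u), ?_⟩
  refine HasDerivAt.of_local_left_inverse e.symm.continuous.continuousAt (f := e) ?_
    (hc.trans_le (hp _ hmem')).ne'
    (Filter.Eventually.of_forall e.apply_symm_apply)
  refine (p.hasDerivAt _).congr_of_eventuallyEq ?_
  filter_upwards [Icc_mem_nhds hmem.1 hmem.2] with y hy using heq hy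

namespace Polynomial

/-- The Wronskian of the derivatives of `p` and `q`. -/
noncomputable def bend (p q : ℝ[X]) : ℝ[X] :=
  derivative (derivative q) * derivative p - derivative q * derivative (derivative p)

/-- The numerator of the derivative of `bend p q / (p' * q' ^ 2)`. -/
noncomputable def bendDeriv (p q : ℝ[X]) : ℝ[X] :=
  derivative (bend p q) * derivative p * derivative q
    - bend p q * (derivative (derivative p) * derivative q
      + 2 * derivative p * derivative (derivative q))

/-- The numerator of the mixed derivative which governs the nondegeneracy of `(ω p, q)`. -/
noncomputable def mixedNum (p q : ℝ[X]) (ω x y : ℝ) : ℝ :=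
  (derivative q).eval x * (derivative p).eval x
      * ((derivative q).eval x - ω * (derivative p).eval x) * (bendDeriv p q).eval y
    - ω * (bend p q).eval x * (bend p q).eval y * (derivative p).eval y ^ 2
      * (derivative q).eval y

end Polynomial

/-- Quantitative nondegeneracy of the curve `x ↦ (ω p(x), q(x))` near `x₀`. -/
structure IsCurvedWindow (p q : ℝ[X]) (ω L x₀ σ : ℝ) : Prop where
  one_le_const : 1 ≤ L
  inv_le_radius : L⁻¹ ≤ σ
  radius_le_one : σ ≤ 1
  abs_omega_le : |ω| ≤ L
  inv_le_deriv : ∀ x ∈ Set.Icc (x₀ - σ) (x₀ + σ), L⁻¹ ≤ (derivative p).eval x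
  deriv_le : ∀ x ∈ Set.Icc (x₀ - σ) (x₀ + σ), (derivative p).eval x ≤ L
  abs_deriv_deriv_le : ∀ x ∈ Set.Icc (x₀ - σ) (x₀ + σ),
    |(derivative (derivative p)).eval x| ≤ L
  inv_le_abs_deriv : ∀ x ∈ Set.Icc (x₀ - σ) (x₀ + σ), L⁻¹ ≤ |(derivative q).eval x|
  abs_deriv_le : ∀ x ∈ Set.Icc (x₀ - σ) (x₀ + σ), |(derivative q).eval x| ≤ L
  abs_deriv_deriv_le' : ∀ x ∈ Set.Icc (x₀ - σ) (x₀ + σ),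
    |(derivative (derivative q)).eval x| ≤ L
  inv_le_abs_sub : ∀ x ∈ Set.Icc (x₀ - σ) (x₀ + σ),
    L⁻¹ ≤ |(derivative q).eval x - ω * (derivative p).eval x|
  inv_le_abs_mixedNum : ∀ x ∈ Set.Icc (x₀ - σ) (x₀ + σ), ∀ y ∈ Set.Icc (x₀ - σ) (x₀ + σ),
    L⁻¹ ≤ |mixedNum p q ω x y|

theorem le_div_of_inv_le {L x y : ℝ} {m n : ℕ} (hL : 0 < L) (hx : (L ^ m)⁻¹ ≤ x) (hy0 : 0 < y)
    (hy : y ≤ 4 * L ^ n) : (4 * L ^ (m + n))⁻¹ ≤ x / y := by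
  rw [le_div_iff₀ hy0]
  calc (4 * L ^ (m + n))⁻¹ * y ≤ (4 * L ^ (m + n))⁻¹ * (4 * L ^ n) := by gcongr
    _ = (L ^ m)⁻¹ := by field_simp; ring
    _ ≤ x := hx

theorem IsCurvedWindow.exists_isPhase {p q : ℝ[X]} {ω L x₀ σ : ℝ}
    (h : IsCurvedWindow p q ω L x₀ σ) :
    ∃ γ γ1 : ℝ → ℝ, IsPhase γ γ1 ω (4 * L ^ 12) (p.eval x₀) (σ / (4 * L)) ∧
      ∀ u ∈ Set.Icc (p.eval x₀ - σ / (4 * L)) (p.eval x₀ + σ / (4 * L)),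
        ∃ x ∈ Set.Icc (x₀ - σ) (x₀ + σ), p.eval x = u ∧ q.eval x = γ u := by
  have hL1 := h.one_le_const
  have hL : 0 < L := by linarith
  have hσ : 0 < σ := (inv_pos.2 hL).trans_le h.inv_le_radius
  obtain ⟨ψ, hψc, hψ⟩ := Polynomial.exists_local_inverse hσ (inv_pos.2 hL) h.inv_le_deriv
  set ρ := σ / (4 * L) with hρ
  have hρ0 : 0 < ρ := by positivity
  have hρe : L⁻¹ * σ = 4 * ρ := by rw [hρ]; field_simp
  have hmem : ∀ u ∈ Set.Icc (p.eval x₀ - 2 * ρ) (p.eval x₀ + 2 * ρ), u ∈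
      Set.Ioo (p.eval x₀ - L⁻¹ * σ) (p.eval x₀ + L⁻¹ * σ) := fun u hu =>
    ⟨by linarith [hu.1], by linarith [hu.2]⟩
  replace hψ := fun u hu => hψ u (hmem u hu)
  have pL : ∀ n : ℕ, 1 ≤ L ^ n := fun n => one_le_pow₀ hL1
  have mL : ∀ {m n : ℕ}, m ≤ n → L ^ m ≤ L ^ n := fun hmn => pow_le_pow_right₀ hL1 hmn
  let P1 := fun u => (derivative p).eval (ψ u)
  let P2 := fun u => (derivative (derivative p)).eval (ψ u)
  let Q1 := fun u => (derivative q).eval (ψ u)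
  let Q2 := fun u => (derivative (derivative q)).eval (ψ u)
  let W := fun u => (bend p q).eval (ψ u)
  let W1 := fun u => (derivative (bend p q)).eval (ψ u)
  let V := fun u => (bendDeriv p q).eval (ψ u)
  have hW : ∀ u, W u = Q2 u * P1 u - Q1 u * P2 u := fun u => by simp [W, bend, P1, P2, Q1, Q2]
  have hV : ∀ u, V u = W1 u * P1 u * Q1 u - W u * (P2 u * Q1 u + 2 * P1 u * Q2 u) :=
    fun u => by simp [V, bendDeriv, W, W1, P1, P2, Q1, Q2]
  set D := Set.Icc (p.eval x₀ - 2 * ρ) (p.eval x₀ + 2 * ρ) with hD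
  have hP1l : ∀ u ∈ D, L⁻¹ ≤ P1 u := fun u hu => h.inv_le_deriv _ (hψ u hu).1
  have hP1p : ∀ u ∈ D, 0 < P1 u := fun u hu => (inv_pos.2 hL).trans_le (hP1l u hu)
  have hP1u : ∀ u ∈ D, P1 u ≤ L := fun u hu => h.deriv_le _ (hψ u hu).1
  have hP2u : ∀ u ∈ D, |P2 u| ≤ L := fun u hu => h.abs_deriv_deriv_le _ (hψ u hu).1
  have hQ1l : ∀ u ∈ D, L⁻¹ ≤ |Q1 u| := fun u hu => h.inv_le_abs_deriv _ (hψ u hu).1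
  have hQ1n : ∀ u ∈ D, Q1 u ≠ 0 := fun u hu =>
    abs_pos.1 ((inv_pos.2 hL).trans_le (hQ1l u hu))
  have hQ1u : ∀ u ∈ D, |Q1 u| ≤ L := fun u hu => h.abs_deriv_le _ (hψ u hu).1
  have hQ2u : ∀ u ∈ D, |Q2 u| ≤ L := fun u hu => h.abs_deriv_deriv_le' _ (hψ u hu).1
  have hvl : ∀ u ∈ D, L⁻¹ ≤ |Q1 u - ω * P1 u| := fun u hu => h.inv_le_abs_sub _ (hψ u hu).1
  have hvn : ∀ u ∈ D, Q1 u - ω * P1 u ≠ 0 := fun u hu =>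
    abs_pos.1 ((inv_pos.2 hL).trans_le (hvl u hu))
  have hvu : ∀ u ∈ D, |Q1 u - ω * P1 u| ≤ 2 * L ^ 2 := fun u hu => by
    calc |Q1 u - ω * P1 u| ≤ |Q1 u| + |ω * P1 u| := abs_sub _ _
      _ ≤ L + L * L := by
        rw [abs_mul, abs_of_pos (hP1p u hu)]
        exact add_le_add (hQ1u u hu) (mul_le_mul h.abs_omega_le (hP1u u hu) (hP1p u hu).le hL.le)
      _ ≤ 2 * L ^ 2 := by nlinarith
  have hWu : ∀ u ∈ D, |W u| ≤ 2 * L ^ 2 := fun u hu => by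
    rw [hW]
    calc |Q2 u * P1 u - Q1 u * P2 u| ≤ |Q2 u * P1 u| + |Q1 u * P2 u| := abs_sub _ _
      _ ≤ L * L + L * L := by
        rw [abs_mul, abs_mul, abs_of_pos (hP1p u hu)]
        exact add_le_add (mul_le_mul (hQ2u u hu) (hP1u u hu) (hP1p u hu).le hL.le)
          (mul_le_mul (hQ1u u hu) (hP2u u hu) (abs_nonneg _) hL.le)
      _ = 2 * L ^ 2 := by ring
  have dd : ∀ (r : ℝ[X]), ∀ u ∈ D, HasDerivAt (fun u => r.eval (ψ u))
      ((derivative r).eval (ψ u) * (P1 u)⁻¹) u := fun r u hu =>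
    (r.hasDerivAt (ψ u)).comp u (hψ u hu).2.2
  have dP1 : ∀ u ∈ D, HasDerivAt P1 (P2 u * (P1 u)⁻¹) u := dd _
  have dQ1 : ∀ u ∈ D, HasDerivAt Q1 (Q2 u * (P1 u)⁻¹) u := dd _
  have dW : ∀ u ∈ D, HasDerivAt W (W1 u * (P1 u)⁻¹) u := dd _
  let γ1 := fun u => Q1 u / P1 u
  let γ2 := fun u => W u / P1 u ^ 3
  have dγ1 : ∀ u ∈ D, HasDerivAt γ1 (γ2 u) u := fun u hu => by
    refine ((dQ1 u hu).div (dP1 u hu) (hP1p u hu).ne').congr_deriv ?_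
    have := (hP1p u hu).ne'
    simp only [γ2, hW]
    field_simp
  have hγ2 : ∀ u ∈ D, |γ2 u| ≤ 4 * L ^ 12 := fun u hu => by
    simp only [γ2]
    rw [abs_div, abs_pow, abs_of_pos (hP1p u hu), div_le_iff₀ (pow_pos (hP1p u hu) 3)]
    calc |W u| ≤ 2 * L ^ 2 := hWu u hu
      _ ≤ 4 * L ^ 9 := by nlinarith [mL (show 2 ≤ 9 by norm_num), pL 9]
      _ = 4 * L ^ 12 * L⁻¹ ^ 3 := by field_simp
      _ ≤ _ := by gcongr; exact hP1l u hu
  have hK1 : (1 : ℝ) ≤ 4 * L ^ 12 := by linarith [pL 12]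
  refine ⟨fun u => q.eval (ψ u), γ1, ⟨?_, hK1, ?_, ?_, ?_, ?_, ?_, ?_, ?_, ?_, ?_⟩, ?_⟩
  · exact (q.continuous.comp hψc).measurable
  · rw [inv_le_comm₀ (by positivity) hρ0, hρ, inv_div, div_le_iff₀ hσ]
    calc 4 * L = 4 * L ^ 2 * L⁻¹ := by field_simp
      _ ≤ 4 * L ^ 12 * σ := by
        gcongr
        · norm_num
        · exact h.inv_le_radius
  · rw [hρ, div_le_one (by positivity)]
    linarith [h.radius_le_one]
  · exact fun u hu => (dd q u hu).congr_deriv (by simp only [γ1, Q1, div_eq_mul_inv])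
  · intro u hu s hs
    have := (convex_Icc (p.eval x₀ - 2 * ρ) (p.eval x₀ + 2 * ρ)).norm_image_sub_le_of_norm_hasDerivWithin_le
      (f := γ1) (f' := γ2) (C := 4 * L ^ 12) (fun u hu => (dγ1 u hu).hasDerivWithinAt)
      (fun u hu => hγ2 u hu) hs hu
    simpa only [Real.norm_eq_abs] using this
  · intro u hu
    simp only [γ1]
    rw [abs_div, abs_of_pos (hP1p u hu), div_le_iff₀ (hP1p u hu)]
    calc |Q1 u| ≤ L := hQ1u u hu
      _ ≤ 4 * L ^ 11 := by linarith [mL (show 1 ≤ 11 by norm_num), pL 11, pow_one L]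
      _ = 4 * L ^ 12 * L⁻¹ := by field_simp
      _ ≤ _ := by gcongr; exact hP1l u hu
  · intro u hu
    simp only [γ1]
    rw [abs_div, abs_of_pos (hP1p u hu)]
    refine le_trans ?_ (le_div_of_inv_le hL (m := 1) (n := 11) (by simpa using hQ1l u hu) (hP1p u hu) ?_)
    · norm_num
    · linarith [hP1u u hu, mL (show 1 ≤ 11 by norm_num), pL 11, pow_one L]
  · intro u hu
    have e : γ1 u - ω = (Q1 u - ω * P1 u) / P1 u := by
      have := (hP1p u hu).ne'
      simp only [γ1]; field_simp
    rw [e, abs_div, abs_of_pos (hP1p u hu)]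
    refine le_trans ?_ (le_div_of_inv_le hL (m := 1) (n := 11) (by simpa using hvl u hu) (hP1p u hu) ?_)
    · norm_num
    · linarith [hP1u u hu, mL (show 1 ≤ 11 by norm_num), pL 11, pow_one L]
  · linarith [h.abs_omega_le, mL (show 1 ≤ 12 by norm_num), pL 12, pow_one L]
  · intro t s k ht hs htk hsk
    have key := curved_of_le_abs_deriv (γ1 := γ1) (γ2 := γ2) (ω := ω) (c := (4 * L ^ 12)⁻¹)
      (A := fun u => Q1 u / (Q1 u - ω * P1 u)) (A1 := fun u => -ω * W u / (P1 u * (Q1 u - ω * P1 u) ^ 2))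
      (B := fun u => W u / (P1 u * Q1 u ^ 2)) (B1 := fun u => V u / (P1 u ^ 3 * Q1 u ^ 3))
      dγ1 ?_ ?_ ?_ ?_ ?_ ?_ ht hs htk hsk
    · rwa [inv_mul_le_iff₀ (by positivity)] at key
    · intro u hu
      refine ((dQ1 u hu).div ((dQ1 u hu).sub ((dP1 u hu).const_mul ω)) (hvn u hu)).congr_deriv ?_
      have := (hP1p u hu).ne'
      have := hvn u hu
      simp only [hW, Pi.sub_apply]
      field_simp
      ring
    · intro u hu
      have h1 := (hP1p u hu).ne'
      have h2 := hQ1n u hu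
      refine ((dW u hu).div ((dP1 u hu).mul ((dQ1 u hu).pow 2)) (by
        simpa using ⟨h1, h2⟩)).congr_deriv ?_
      simp only [hV, Pi.mul_apply, Pi.pow_apply]
      field_simp
      ring
    · exact fun u hu => div_ne_zero (hQ1n u hu) (hP1p u hu).ne'
    · intro u hu
      have h1 := (hP1p u hu).ne'
      have h2 := hvn u hu
      have h3 : Q1 u / P1 u - ω ≠ 0 := by
        rw [show Q1 u / P1 u - ω = (Q1 u - ω * P1 u) / P1 u by field_simp]
        exact div_ne_zero h2 h1
      simp only [γ1]
      rw [div_eq_div_iff h2 h3]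
      field_simp
    · intro u hu
      have h1 := (hP1p u hu).ne'
      have h2 := hQ1n u hu
      simp only [γ1, γ2]
      field_simp
    · intro u hu w hw
      have h1 := (hP1p u hu).ne'
      have h2 := hvn u hu
      have h3 := (hP1p w hw).ne'
      have h4 := hQ1n w hw
      have e : -ω * W u / (P1 u * (Q1 u - ω * P1 u) ^ 2) * (W w / (P1 w * Q1 w ^ 2))
          + Q1 u / (Q1 u - ω * P1 u) * (V w / (P1 w ^ 3 * Q1 w ^ 3))
          = mixedNum p q ω (ψ u) (ψ w)
            / (P1 u * (Q1 u - ω * P1 u) ^ 2 * P1 w ^ 3 * Q1 w ^ 3) := by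
        have : mixedNum p q ω (ψ u) (ψ w) = Q1 u * P1 u * (Q1 u - ω * P1 u) * V w
          - ω * W u * W w * P1 w ^ 2 * Q1 w := rfl
        rw [this]
        field_simp
        ring
      rw [e, abs_div]
      refine le_div_of_inv_le hL (m := 1) (n := 11) ?_ (by positivity) ?_
      · simpa using h.inv_le_abs_mixedNum _ (hψ u hu).1 _ (hψ w hw).1
      · rw [abs_mul, abs_mul, abs_mul, abs_pow, abs_pow, abs_pow, abs_of_pos (hP1p u hu),
          abs_of_pos (hP1p w hw)]
        calc _ ≤ L * (2 * L ^ 2) ^ 2 * L ^ 3 * L ^ 3 := by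
              have := (hP1p u hu).le
              have := (hP1p w hw).le
              gcongr
              exacts [hP1u u hu, hvu u hu, hP1u w hw, hQ1u w hw]
          _ = 4 * L ^ 11 := by ring
  · intro u hu
    have hu' : u ∈ D := ⟨by linarith [hu.1], by linarith [hu.2]⟩
    exact ⟨ψ u, (hψ u hu').1, (hψ u hu').2.1, rfl⟩

/-- The `L²` norm of the dyadic averages at level `n`. -/
noncomputable def energy (f : ℝ → ℝ) (n : ℕ) : ℝ := ∫ x, dyadicAvg f n x ^ 2

theorem IsCurvedWindow.exists_pattern {p q : ℝ[X]} {ω L x₀ σ β : ℝ}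
    (h : IsCurvedWindow p q ω L x₀ σ) (hω : ω ≠ 0) (hβ : 0 < β) {C ν b : ℕ} (hb : 1 ≤ b)
    (hL : L ≤ 2 ^ (C * b)) (hβC : (2 ^ (C * b))⁻¹ ≤ β) (hβω : (2 ^ (ν + C * b))⁻¹ ≤ β * |ω|)
    (hq : ∀ x ∈ Set.Icc (x₀ - σ) (x₀ + σ), |β * q.eval x| ≤ 2 ^ C * (2 ^ (2 * b))⁻¹)
    (hp : ∀ x ∈ Set.Icc (x₀ - σ) (x₀ + σ), |β * (ω * p.eval x)| ≤ 2 ^ C * (2 ^ (ν + 2 * b))⁻¹)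
    {f : ℝ → ℝ} (hf : IsDensity f) {e : ℝ} (he : 0 < e) (he1 : e ≤ 1)
    (heb : 2 ^ (C + 1) ≤ e * 2 ^ b) (hfe : 16 * e ≤ (∫ x, f x) ^ 3)
    (hE : energy f ((1024 + 897 * C) * b) - energy f b ≤ e ^ 2)
    (hE' : energy f (ν + (1024 + 897 * C) * b) - energy f (ν + b) ≤ e ^ 2) :
    ∃ x, ∃ y ∈ Set.Icc (x₀ - σ) (x₀ + σ),
      f x ≠ 0 ∧ f (x + β * (ω * p.eval y)) ≠ 0 ∧ f (x + β * q.eval y) ≠ 0 := by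
  have hL1 := h.one_le_const
  have hL0 : 0 < L := by linarith
  obtain ⟨γ, γ1, hγ, hx⟩ := h.exists_isPhase
  set ρ := σ / (4 * L) with hρ
  have two : (1 : ℝ) ≤ 2 := by norm_num
  have hbΘ : b ≤ (1024 + 897 * C) * b := Nat.le_mul_of_pos_left _ (by omega)
  have he2 : (2 ^ b)⁻¹ ≤ e := by
    rw [inv_le_iff_one_le_mul₀ (by positivity)]
    exact (one_le_pow₀ two).trans heb
  have hρl : (2 ^ (2 * b + 2 * (C * b)))⁻¹ ≤ ρ := by
    have : (4 * L ^ 2)⁻¹ ≤ ρ := by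
      rw [hρ, le_div_iff₀ (by positivity)]
      calc (4 * L ^ 2)⁻¹ * (4 * L) = L⁻¹ := by field_simp
        _ ≤ σ := h.inv_le_radius
    refine le_trans (inv_anti₀ (by positivity) ?_) this
    calc 4 * L ^ 2 ≤ 2 ^ (2 * b) * (2 ^ (C * b)) ^ 2 := by
          gcongr
          calc (4 : ℝ) = 2 ^ 2 := by norm_num
            _ ≤ 2 ^ (2 * b) := pow_le_pow_right₀ two (by omega)
      _ = _ := by ring
  have hρ0 : 0 < ρ := lt_of_lt_of_le (by positivity) hρl
  have hK : (2 ^ (16 * b + 14 * (C * b)))⁻¹ ≤ ρ * e / (1700 * (4 * L ^ 12)) := by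
    rw [le_div_iff₀ (by positivity)]
    calc (2 ^ (16 * b + 14 * (C * b)))⁻¹ * (1700 * (4 * L ^ 12))
        ≤ (2 ^ (16 * b + 14 * (C * b)))⁻¹ * (2 ^ (13 * b) * (2 ^ (C * b)) ^ 12) := by
          rw [← mul_assoc 1700]
          gcongr
          calc (1700 * 4 : ℝ) ≤ 2 ^ 13 := by norm_num
            _ ≤ 2 ^ (13 * b) := pow_le_pow_right₀ two (by omega)
      _ = (2 ^ (2 * b + 2 * (C * b)))⁻¹ * (2 ^ b)⁻¹ := by
        rw [← pow_mul, ← pow_add, ← mul_inv, ← pow_add, inv_mul_eq_iff_eq_mul₀ (by positivity),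
          eq_mul_inv_iff_mul_eq₀ (by positivity), ← pow_add]
        congr 1
        ring
      _ ≤ ρ * e := by gcongr
  have hsmall : 2 ^ (b + 1) * (2 ^ C * (2 ^ (2 * b))⁻¹) ≤ e := by
    calc (2 : ℝ) ^ (b + 1) * (2 ^ C * (2 ^ (2 * b))⁻¹) = 2 ^ (C + 1) * (2 ^ b)⁻¹ := by
          field_simp
          ring
      _ ≤ e * 2 ^ b * (2 ^ b)⁻¹ := by gcongr
      _ = e := by field_simp
  have hpat := hγ.exists_pattern hβ hω hf he he1 hfe (n := b)
    (m := (1024 + 897 * C) * b) (n' := ν + b) (m' := ν + (1024 + 897 * C) * b)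
    hbΘ (by omega) (by omega) ?_ hE ?_ ?_ hE' ?_
  · obtain ⟨x, u, hu, h1, h2, h3⟩ := hpat
    obtain ⟨y, hy, hpy, hqy⟩ := hx u hu
    exact ⟨x, y, hy, h1, by rwa [hpy], by rwa [hqy]⟩
  · calc ((2 : ℝ) ^ ((1024 + 897 * C) * b))⁻¹
        = (2 ^ (C * b))⁻¹ * ((2 ^ (16 * b + 14 * (C * b)))⁻¹) ^ 64 := by
          rw [inv_pow, ← pow_mul, ← mul_inv, ← pow_add]
          congr 2
          ring
      _ ≤ _ := by gcongr
  · intro u hu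
    obtain ⟨y, hy, hpy, hqy⟩ := hx u hu
    rw [← hqy]
    exact (mul_le_mul_of_nonneg_left (hq y hy) (by positivity)).trans hsmall
  · calc 2 * ((2 : ℝ) ^ (ν + (1024 + 897 * C) * b))⁻¹
        ≤ 2 * (2 ^ (ν + (3 * b + 3 * (C * b) + 1)))⁻¹ := by
          gcongr
          rw [add_mul, mul_assoc]
          omega
      _ = (2 ^ (2 * b + 2 * (C * b)))⁻¹ * (2 ^ b)⁻¹ * (2 ^ (ν + C * b))⁻¹ := by
        field_simp
        ring
      _ ≤ ρ * e * (β * |ω|) := by gcongr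
  · intro u hu
    obtain ⟨y, hy, hpy, hqy⟩ := hx u hu
    rw [← hpy]
    refine (mul_le_mul_of_nonneg_left (hp y hy) (by positivity)).trans (le_trans (le_of_eq ?_) hsmall)
    field_simp
    ring

theorem energy_nonneg (f : ℝ → ℝ) (n : ℕ) : 0 ≤ energy f n := integral_nonneg fun _ => sq_nonneg _

theorem IsDensity.integral_le_one {f : ℝ → ℝ} (hf : IsDensity f) : ∫ x, f x ≤ 1 := by
  have h1 : f ≤ (Set.Ioc (0 : ℝ) 1).indicator fun _ => (1 : ℝ) := by
    intro x
    rw [Set.indicator_apply]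
    split_ifs with hx
    · exact hf.le_one x
    · exact (not_not.1 fun h => hx (hf.support x h)).le
  calc ∫ x, f x ≤ ∫ x, (Set.Ioc (0 : ℝ) 1).indicator (fun _ => (1 : ℝ)) x :=
        integral_mono hf.integrable ((integrable_indicator_iff measurableSet_Ioc).2
          (integrableOn_const (by simp))) h1
    _ = 1 := by simp [integral_indicator measurableSet_Ioc]

theorem IsDensity.energy_le_one {f : ℝ → ℝ} (hf : IsDensity f) (n : ℕ) : energy f n ≤ 1 := by
  have := ((hf.isDensity_dyadicAvg n).mul (hf.isDensity_dyadicAvg n)).integral_le_one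
  simpa only [energy, sq] using this

theorem IsDensity.energy_mono {f : ℝ → ℝ} (hf : IsDensity f) {n m : ℕ} (hnm : n ≤ m) :
    energy f n ≤ energy f m := by
  have h := hf.integral_sq_dyadicAvg_sub hnm
  have : 0 ≤ ∫ x, (dyadicAvg f m x - dyadicAvg f n x) ^ 2 := integral_nonneg fun _ => sq_nonneg _
  unfold energy
  linarith

/-- Among sufficiently many scales, the dyadic averages are almost constant on one of them. -/
theorem IsDensity.exists_energy_sub_le {f : ℝ → ℝ} (hf : IsDensity f) {Θ J : ℕ} (hΘ : 1 ≤ Θ)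
    {e : ℝ} (hJ : 2 < J * e) (b ν : ℕ) :
    ∃ j < J, energy f (Θ * (Θ ^ j * b)) - energy f (Θ ^ j * b) ≤ e ∧
      energy f (ν + Θ * (Θ ^ j * b)) - energy f (ν + Θ ^ j * b) ≤ e := by
  by_contra! H
  have key : ∀ j ∈ Finset.range J, e ≤ (energy f (Θ ^ (j + 1) * b) - energy f (Θ ^ j * b))
      + (energy f (ν + Θ ^ (j + 1) * b) - energy f (ν + Θ ^ j * b)) := by
    intro j hj
    have hle : Θ ^ j * b ≤ Θ ^ (j + 1) * b := by exact Nat.mul_le_mul_right _ (Nat.pow_le_pow_right hΘ j.le_succ)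
    have h1 := hf.energy_mono hle
    have h2 := hf.energy_mono (Nat.add_le_add_left hle ν)
    have h3 := H j (Finset.mem_range.1 hj)
    rw [← mul_assoc Θ, ← pow_succ'] at h3
    by_cases h4 : energy f (Θ ^ (j + 1) * b) - energy f (Θ ^ j * b) ≤ e
    · linarith [h3 h4]
    · linarith
  have hsum := Finset.sum_le_sum key
  rw [Finset.sum_const, Finset.card_range, nsmul_eq_mul, Finset.sum_add_distrib,
    Finset.sum_range_sub (fun j => energy f (Θ ^ j * b)),
    Finset.sum_range_sub (fun j => energy f (ν + Θ ^ j * b))] at hsum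
  linarith [hf.energy_le_one (Θ ^ J * b), hf.energy_le_one (ν + Θ ^ J * b),
    energy_nonneg f (Θ ^ 0 * b), energy_nonneg f (ν + Θ ^ 0 * b)]

/-- After rescaling, `(P₁, P₂)` is a nondegenerate curve near the parameter `τ`, with constants
polynomial in `2 ^ b`. -/
def HasWindow (P₁ P₂ : ℝ[X]) (N τ : ℝ) (C ν b : ℕ) : Prop :=
  ∃ (p q : ℝ[X]) (ω L σ β : ℝ), IsCurvedWindow p q ω L 1 σ ∧ σ ≤ 1 / 2 ∧ ω ≠ 0 ∧ 0 < β ∧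
    L ≤ 2 ^ (C * b) ∧ (2 ^ (C * b))⁻¹ ≤ β ∧ (2 ^ (ν + C * b))⁻¹ ≤ β * |ω| ∧
    (∀ x ∈ Set.Icc (1 - σ) (1 + σ), |β * q.eval x| ≤ 2 ^ C * (2 ^ (2 * b))⁻¹) ∧
    (∀ x ∈ Set.Icc (1 - σ) (1 + σ), |β * (ω * p.eval x)| ≤ 2 ^ C * (2 ^ (ν + 2 * b))⁻¹) ∧
    (∀ x, β * (ω * p.eval x) = P₁.eval (τ * x) / N) ∧ ∀ x, β * q.eval x = P₂.eval (τ * x) / N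

theorem exists_pattern_of_hasWindow {P₁ P₂ : ℝ[X]} {N τ₀ : ℝ} (hτ₀ : 0 ≤ τ₀) {C ν b J : ℕ}
    (hb : 1 ≤ b)
    (hw : ∀ b', b ≤ b' → b' ≤ (1024 + 897 * C) ^ J * b →
      HasWindow P₁ P₂ N (τ₀ * (2 ^ (2 * b'))⁻¹) C ν b')
    {f : ℝ → ℝ} (hf : IsDensity f) {e : ℝ} (he : 0 < e) (he1 : e ≤ 1)
    (heb : 2 ^ (C + 1) ≤ e * 2 ^ b) (hfe : 16 * e ≤ (∫ x, f x) ^ 3) (hJ : 2 < J * e ^ 2) :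
    ∃ x t, τ₀ * (2 ^ (2 * ((1024 + 897 * C) ^ J * b)))⁻¹ / 2 ≤ t ∧
      f x ≠ 0 ∧ f (x + P₁.eval t / N) ≠ 0 ∧ f (x + P₂.eval t / N) ≠ 0 := by
  obtain ⟨j, hj, hE, hE'⟩ := hf.exists_energy_sub_le (Θ := 1024 + 897 * C) (by omega) hJ b ν
  set b' := (1024 + 897 * C) ^ j * b with hb'
  have hbb' : b ≤ b' := Nat.le_mul_of_pos_left _ (by positivity)
  have hb'J : b' ≤ (1024 + 897 * C) ^ J * b := by
    rw [hb']
    exact Nat.mul_le_mul_right _ (Nat.pow_le_pow_right (by omega) hj.le)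
  obtain ⟨p, q, ω, L, σ, β, hW, hσ, hω, hβ, h1, h2, h3, h4, h5, h6, h7⟩ := hw b' hbb' hb'J
  obtain ⟨x, y, hy, hx1, hx2, hx3⟩ := hW.exists_pattern hω hβ (hb.trans hbb') h1 h2 h3 h4 h5 hf he
    he1 (heb.trans (by gcongr; norm_num)) hfe hE hE'
  rw [h6] at hx2
  rw [h7] at hx3
  refine ⟨x, τ₀ * (2 ^ (2 * b'))⁻¹ * y, ?_, hx1, hx2, hx3⟩
  rw [div_eq_mul_inv]
  have : (2 : ℝ)⁻¹ ≤ y := by linarith [hy.1]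
  gcongr
  norm_num

/-- The number of scales and the initial scale can be chosen so that the loss is only doubly
exponential. -/
theorem exists_loss_bound (C b₁ : ℕ) : ∃ c : ℝ, 0 < c ∧ ∀ ε : ℝ, 0 < ε → ε ≤ 1 →
    ∃ b J : ℕ, 1 ≤ b ∧ b₁ ≤ b ∧ 2 ^ (C + 1) ≤ ε ^ 3 / 16 * 2 ^ b ∧ 2 < J * (ε ^ 3 / 16) ^ 2 ∧
      Real.exp (-Real.exp (c * (ε ^ 6)⁻¹)) ≤ (2 ^ (2 * ((1024 + 897 * C) ^ J * b)))⁻¹ := by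
  have hΘ : (1 : ℝ) ≤ 1024 + 897 * C := by linarith [(Nat.cast_nonneg C : (0 : ℝ) ≤ C)]
  have hlog : 0 ≤ Real.log (1024 + 897 * C) := Real.log_nonneg hΘ
  refine ⟨513 * Real.log (1024 + 897 * C) + 2 * (b₁ + C + 7), by positivity, fun ε hε hε1 => ?_⟩
  set E := (ε ^ 6)⁻¹ with hE
  have hE1 : 1 ≤ E := (one_le_inv₀ (by positivity)).2 (pow_le_one₀ hε.le hε1)
  have h3E : (ε ^ 3)⁻¹ ≤ E :=
    inv_anti₀ (by positivity) (pow_le_pow_of_le_one hε.le hε1 (by norm_num))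
  have h31 : 1 ≤ (ε ^ 3)⁻¹ := (one_le_inv₀ (by positivity)).2 (pow_le_one₀ hε.le hε1)
  refine ⟨b₁ + C + 5 + ⌈(ε ^ 3)⁻¹⌉₊, ⌊512 * E⌋₊ + 1, by omega, by omega, ?_, ?_, ?_⟩
  · have h1 : (ε ^ 3)⁻¹ ≤ 2 ^ ⌈(ε ^ 3)⁻¹⌉₊ :=
      (Nat.le_ceil _).trans (by exact_mod_cast (Nat.lt_two_pow_self).le)
    have h2 : (2 : ℝ) ^ (C + 5) ≤ 2 ^ (b₁ + C + 5) :=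
      pow_le_pow_right₀ (by norm_num) (by omega)
    calc (2 : ℝ) ^ (C + 1) = ε ^ 3 / 16 * (2 ^ (C + 5) * (ε ^ 3)⁻¹) := by
          field_simp
          ring
      _ ≤ ε ^ 3 / 16 * (2 ^ (b₁ + C + 5) * 2 ^ ⌈(ε ^ 3)⁻¹⌉₊) := by gcongr
      _ = _ := by rw [← pow_add]
  · have h1 := Nat.lt_floor_add_one (512 * E)
    calc (2 : ℝ) = 512 * E * (ε ^ 3 / 16) ^ 2 := by
          rw [hE]
          field_simp
          norm_num
      _ < _ := by
        push_cast
        gcongr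
  · have hb : ((b₁ + C + 5 + ⌈(ε ^ 3)⁻¹⌉₊ : ℕ) : ℝ) ≤ (b₁ + C + 7) * E := by
      have := (Nat.ceil_lt_add_one (by positivity : 0 ≤ (ε ^ 3)⁻¹)).le
      push_cast
      nlinarith [(Nat.cast_nonneg b₁ : (0 : ℝ) ≤ b₁), (Nat.cast_nonneg C : (0 : ℝ) ≤ C)]
    have hJ : ((⌊512 * E⌋₊ + 1 : ℕ) : ℝ) ≤ 513 * E := by
      have := Nat.floor_le (by positivity : 0 ≤ 512 * E)
      push_cast
      linarith
    generalize b₁ + C + 5 + ⌈(ε ^ 3)⁻¹⌉₊ = b at hb ⊢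
    generalize ⌊512 * E⌋₊ + 1 = J at hJ ⊢
    have hΘJ : (1024 + 897 * C : ℝ) ^ J ≤ Real.exp (513 * Real.log (1024 + 897 * C) * E) := by
      calc (1024 + 897 * C : ℝ) ^ J = Real.exp (J * Real.log (1024 + 897 * C)) := by
            rw [Real.exp_nat_mul, Real.exp_log (by linarith)]
        _ ≤ _ := by
          apply Real.exp_le_exp.2
          nlinarith
    have hexp : 2 * ((1024 + 897 * C : ℝ) ^ J * b) ≤
        Real.exp ((513 * Real.log (1024 + 897 * C) + 2 * (b₁ + C + 7)) * E) := by
      calc 2 * ((1024 + 897 * C : ℝ) ^ J * b)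
          ≤ 2 * (Real.exp (513 * Real.log (1024 + 897 * C) * E) * ((b₁ + C + 7) * E)) := by gcongr
        _ = Real.exp (513 * Real.log (1024 + 897 * C) * E) * (2 * (b₁ + C + 7) * E) := by ring
        _ ≤ Real.exp (513 * Real.log (1024 + 897 * C) * E)
            * Real.exp (2 * (b₁ + C + 7) * E) := by
          gcongr
          linarith [Real.add_one_le_exp (2 * (b₁ + C + 7) * E)]
        _ = _ := by rw [← Real.exp_add]; ring_nf
    calc Real.exp (-Real.exp ((513 * Real.log (1024 + 897 * C) + 2 * (b₁ + C + 7)) * E))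
        ≤ Real.exp (-(2 * ((1024 + 897 * C : ℝ) ^ J * b))) := by gcongr
      _ = (Real.exp 1 ^ (2 * ((1024 + 897 * C) ^ J * b)))⁻¹ := by
        rw [← Real.exp_nat_mul, Real.exp_neg]
        push_cast
        ring_nf
      _ ≤ _ := by
        gcongr
        linarith [Real.add_one_le_exp 1]

/-- The indicator of a measurable set, seen through a window and rescaled to `(0, 1]`. -/
theorem exists_isDensity_of_measurableSet {S : Set ℝ} (hS : MeasurableSet S) (k : ℝ) {M : ℝ}
    (hM : 0 < M) : ∃ f : ℝ → ℝ, IsDensity f ∧ (∀ x, f x ≠ 0 → k + M * x ∈ S) ∧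
      ∫ x, f x = M⁻¹ * volume.real (S ∩ Set.Ioc k (k + M)) := by
  set T : Set ℝ := (fun x => k + M * x) ⁻¹' (S ∩ Set.Ioc k (k + M)) with hT
  have hTm : MeasurableSet T :=
    (by fun_prop : Measurable fun x : ℝ => k + M * x) (hS.inter measurableSet_Ioc)
  have hTI : ∀ x ∈ T, x ∈ Set.Ioc (0 : ℝ) 1 := by
    rintro x ⟨-, h1, h2⟩
    exact ⟨by nlinarith, by nlinarith⟩
  have hne : ∀ x, T.indicator (fun _ => (1 : ℝ)) x ≠ 0 → x ∈ T := fun x hx =>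
    Set.mem_of_indicator_ne_zero hx
  refine ⟨T.indicator fun _ => 1, ⟨measurable_const.indicator hTm, ?_, ?_, fun x hx => hTI x (hne x hx)⟩,
    fun x hx => (hne x hx).1, ?_⟩
  · exact fun x => Set.indicator_nonneg (fun _ _ => zero_le_one) x
  · exact fun x => Set.indicator_le_self' (fun _ _ => zero_le_one) x
  · rw [integral_indicator hTm, setIntegral_const, smul_eq_mul, mul_one]
    have : T = (fun x => M * x) ⁻¹' ((fun x => k + x) ⁻¹' (S ∩ Set.Ioc k (k + M))) := rfl
    rw [this, Measure.real, Real.volume_preimage_mul_left hM.ne', measure_preimage_add,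
      ENNReal.toReal_mul, ENNReal.toReal_ofReal (abs_nonneg _), abs_of_pos (inv_pos.2 hM), Measure.real]

theorem exists_unit_interval_measure_ge {S : Set ℝ} {N ε : ℝ} (hN : 1 < N)
    (hε : 0 < ε) (hSN : S ⊆ Set.Icc 0 N) (hv : ε * N ≤ volume.real S) :
    ∃ k : ℕ, ε / 2 ≤ volume.real (S ∩ Set.Ioc (k : ℝ) (k + 1)) := by
  by_contra! H
  have hfin : volume S ≠ ⊤ := measure_ne_top_of_subset hSN measure_Icc_lt_top.ne
  have hcov : S ⊆ {0} ∪ ⋃ k ∈ Finset.range ⌈N⌉₊, S ∩ Set.Ioc (k : ℝ) (k + 1) := by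
    intro x hx
    rcases (hSN hx).1.eq_or_lt with h0 | h0
    · exact Or.inl h0.symm
    · right
      have hc : 0 < ⌈x⌉₊ := Nat.ceil_pos.2 h0
      have e : ((⌈x⌉₊ - 1 : ℕ) : ℝ) = ⌈x⌉₊ - 1 := by rw [Nat.cast_sub hc]; simp
      simp only [Set.mem_iUnion, Finset.mem_range]
      refine ⟨⌈x⌉₊ - 1, ?_, hx, ?_, ?_⟩
      · have := Nat.ceil_le_ceil (hSN hx).2
        omega
      · rw [e]; linarith [Nat.ceil_lt_add_one h0.le]
      · rw [e]; linarith [Nat.le_ceil x]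
  have hfin2 : volume ({0} ∪ ⋃ k ∈ Finset.range ⌈N⌉₊, S ∩ Set.Ioc (k : ℝ) (k + 1)) ≠ ⊤ := by
    refine measure_union_ne_top (by simp) (measure_ne_top_of_subset ?_ hfin)
    exact Set.iUnion₂_subset fun k _ => Set.inter_subset_left
  have h1 := (measureReal_mono hcov hfin2).trans ((measureReal_union_le _ _).trans
    (add_le_add_right (measureReal_biUnion_finset_le _ _) _))
  have h0 : volume.real ({0} : Set ℝ) = 0 := by simp [Measure.real]
  have hpos : (Finset.range ⌈N⌉₊).Nonempty := by
    simp only [Finset.nonempty_range_iff]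
    exact (Nat.ceil_pos.2 (by linarith)).ne'
  have h2 := Finset.sum_lt_sum_of_nonempty hpos fun k _ => H k
  rw [Finset.sum_const, Finset.card_range, nsmul_eq_mul] at h2
  have h3 := Nat.ceil_lt_add_one (by linarith : 0 ≤ N)
  nlinarith

theorem exists_pattern_mem_of_hasWindow {P₁ P₂ : ℝ[X]} {S : Set ℝ} (hS : MeasurableSet S) {k M ε : ℝ}
    (hM : 0 < M) (hε : 0 < ε) (hε1 : ε ≤ 1) (hv : ε * M ≤ volume.real (S ∩ Set.Ioc k (k + M)))
    {τ₀ : ℝ} (hτ₀ : 0 ≤ τ₀) {C ν b J : ℕ} (hb : 1 ≤ b)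
    (hw : ∀ b', b ≤ b' → b' ≤ (1024 + 897 * C) ^ J * b →
      HasWindow P₁ P₂ M (τ₀ * (2 ^ (2 * b'))⁻¹) C ν b')
    (heb : 2 ^ (C + 1) ≤ ε ^ 3 / 16 * 2 ^ b) (hJ : 2 < J * (ε ^ 3 / 16) ^ 2) :
    ∃ x t, τ₀ * (2 ^ (2 * ((1024 + 897 * C) ^ J * b)))⁻¹ / 2 ≤ t ∧
      x ∈ S ∧ x + P₁.eval t ∈ S ∧ x + P₂.eval t ∈ S := by
  obtain ⟨f, hf, hfS, hfi⟩ := exists_isDensity_of_measurableSet hS k hM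
  have hle : ε ≤ ∫ x, f x := by
    rw [hfi, le_inv_mul_iff₀ hM]
    linarith
  have hε3 : ε ^ 3 ≤ 1 := pow_le_one₀ hε.le hε1
  obtain ⟨x, t, ht, h1, h2, h3⟩ := exists_pattern_of_hasWindow hτ₀ hb hw hf
    (e := ε ^ 3 / 16) (by positivity) (by linarith) heb
    (by linarith [pow_le_pow_left₀ hε.le hle 3]) hJ
  refine ⟨k + M * x, t, ht, hfS _ h1, ?_, ?_⟩
  · convert hfS _ h2 using 1
    field_simp
    ring
  · convert hfS _ h3 using 1
    field_simp
    ring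

theorem exp_add_exp_le {a b : ℝ} (ha : 0 ≤ a) (hb : 0 ≤ b) :
    Real.exp a + Real.exp b ≤ Real.exp (a + b + 1) := by
  have h1 : Real.exp a ≤ Real.exp (a + b) := Real.exp_le_exp.2 (by linarith)
  have h2 : Real.exp b ≤ Real.exp (a + b) := Real.exp_le_exp.2 (by linarith)
  rw [Real.exp_add (a + b)]
  nlinarith [Real.add_one_le_exp 1, Real.exp_pos (a + b)]

theorem exists_pattern_of_forall_hasWindow {P₁ P₂ : ℝ[X]} {r : ℝ} {C₁ b₁ C₂ : ℕ} {T : ℝ}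
    (hw₁ : ∀ b, b₁ ≤ b → HasWindow P₁ P₂ 1 (2 ^ (2 * b))⁻¹ C₁ 0 b) (hT : 0 < T)
    (hw₂ : ∀ N : ℝ, 1 < N → ∃ ν, ∀ b, 1 ≤ b → T ≤ N ^ r * (2 ^ (2 * b))⁻¹ →
      HasWindow P₁ P₂ N (N ^ r * (2 ^ (2 * b))⁻¹) C₂ ν b) :
    ∃ c : ℝ, 0 < c ∧ ∀ ε : ℝ, 0 < ε → ε ≤ 1 → ∃ δ : ℝ, 0 < δ ∧
      Real.exp (-Real.exp (c * (ε ^ 6)⁻¹)) ≤ δ ∧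
      ∀ N : ℝ, 1 < N → ∀ S : Set ℝ, MeasurableSet S → S ⊆ Set.Icc 0 N →
        ε * N ≤ volume.real S →
        ∃ x t : ℝ, δ * N ^ r < t ∧ x ∈ S ∧ x + P₁.eval t ∈ S ∧ x + P₂.eval t ∈ S := by
  obtain ⟨c₁, hc₁, hloss₁⟩ := exists_loss_bound C₁ b₁
  obtain ⟨c₂, hc₂, hloss₂⟩ := exists_loss_bound C₂ 1
  refine ⟨64 * c₁ + c₂ + 4 * (T + 1) + 2, by positivity, fun ε hε hε1 => ?_⟩
  obtain ⟨b, J, hb, hbb, heb, hJ, hδ₁⟩ := hloss₁ (ε / 2) (by positivity) (by linarith)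
  obtain ⟨b', J', hb', -, heb', hJ', hδ₂⟩ := hloss₂ ε hε hε1
  set δ₁ : ℝ := (2 ^ (2 * ((1024 + 897 * C₁) ^ J * b)))⁻¹ with hδ₁e
  set δ₂ : ℝ := (2 ^ (2 * ((1024 + 897 * C₂) ^ J' * b')))⁻¹ with hδ₂e
  have hδ₁0 : 0 < δ₁ := by positivity
  have hδ₂0 : 0 < δ₂ := by positivity
  have hδ₁1 : δ₁ ≤ 1 := inv_le_one_of_one_le₀ (one_le_pow₀ (by norm_num))
  have hδ₂1 : δ₂ ≤ 1 := inv_le_one_of_one_le₀ (one_le_pow₀ (by norm_num))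
  refine ⟨δ₁ * δ₂ / (4 * (T + 1)), by positivity, ?_, fun N hN S hS hSN hv => ?_⟩
  · set E := (ε ^ 6)⁻¹ with hE
    have hE1 : 1 ≤ E := (one_le_inv₀ (by positivity)).2 (pow_le_one₀ hε.le hε1)
    have hE2 : ((ε / 2) ^ 6)⁻¹ = 64 * E := by
      rw [hE, div_pow]
      field_simp
      norm_num
    rw [hE2] at hδ₁
    have hT1 : Real.exp (-Real.exp (4 * (T + 1) * E)) ≤ (4 * (T + 1))⁻¹ := by
      rw [Real.exp_neg]
      gcongr
      have h1 := Real.add_one_le_exp (4 * (T + 1) * E)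
      have h2 := Real.add_one_le_exp (Real.exp (4 * (T + 1) * E))
      nlinarith
    calc Real.exp (-Real.exp ((64 * c₁ + c₂ + 4 * (T + 1) + 2) * E))
        ≤ Real.exp (-(Real.exp (c₁ * (64 * E)) + Real.exp (c₂ * E)
          + Real.exp (4 * (T + 1) * E))) := by
          apply Real.exp_le_exp.2 (neg_le_neg _)
          calc _ ≤ Real.exp (c₁ * (64 * E) + c₂ * E + 1) + Real.exp (4 * (T + 1) * E) := by
                gcongr
                exact exp_add_exp_le (by positivity) (by positivity)
            _ ≤ Real.exp (c₁ * (64 * E) + c₂ * E + 1 + 4 * (T + 1) * E + 1) :=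
                exp_add_exp_le (by positivity) (by positivity)
            _ ≤ _ := by
              apply Real.exp_le_exp.2
              nlinarith
      _ = Real.exp (-Real.exp (c₁ * (64 * E))) * Real.exp (-Real.exp (c₂ * E))
          * Real.exp (-Real.exp (4 * (T + 1) * E)) := by
        rw [← Real.exp_add, ← Real.exp_add]
        ring_nf
      _ ≤ δ₁ * δ₂ * (4 * (T + 1))⁻¹ := by gcongr
      _ = _ := (div_eq_mul_inv _ _).symm
  · have hNr : 0 < N ^ r := Real.rpow_pos_of_pos (by linarith) r
    by_cases hcase : T ≤ N ^ r * δ₂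
    · obtain ⟨ν, hν⟩ := hw₂ N hN
      have hv' : ε * N ≤ volume.real (S ∩ Set.Ioc 0 (0 + N)) := by
        have hcov : S ⊆ {0} ∪ S ∩ Set.Ioc 0 (0 + N) := by
          intro x hx
          rcases (hSN hx).1.eq_or_lt with h0 | h0
          · exact Or.inl h0.symm
          · exact Or.inr ⟨hx, h0, by simpa using (hSN hx).2⟩
        have hfin : volume ({0} ∪ S ∩ Set.Ioc 0 (0 + N)) ≠ ⊤ :=
          measure_union_ne_top (by simp)
            (measure_ne_top_of_subset Set.inter_subset_right measure_Ioc_lt_top.ne)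
        have h1 := (measureReal_mono hcov hfin).trans (measureReal_union_le _ _)
        have h0 : volume.real ({0} : Set ℝ) = 0 := by simp [Measure.real]
        linarith
      obtain ⟨x, t, ht, hx⟩ := exists_pattern_mem_of_hasWindow hS (by linarith) hε hε1 hv'
        hNr.le hb' (fun b hb hbJ => hν b (hb'.trans hb) (hcase.trans (by
          rw [hδ₂e]
          gcongr
          norm_num))) heb' hJ'
      refine ⟨x, t, lt_of_lt_of_le ?_ ht, hx⟩
      rw [← hδ₂e]
      have : δ₁ * δ₂ / (4 * (T + 1)) < δ₂ / 2 := by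
        rw [div_lt_div_iff₀ (by positivity) (by norm_num)]
        nlinarith
      nlinarith
    · obtain ⟨k, hk⟩ := exists_unit_interval_measure_ge hN hε hSN hv
      obtain ⟨x, t, ht, hx⟩ := exists_pattern_mem_of_hasWindow hS one_pos (half_pos hε)
        (by linarith) (by rwa [mul_one]) zero_le_one hb
        (fun b'' hb'' _ => by rw [one_mul]; exact hw₁ b'' (hbb.trans hb'')) heb hJ
      refine ⟨x, t, lt_of_lt_of_le ?_ ht, hx⟩
      rw [← hδ₁e, one_mul]
      push Not at hcase
      rw [div_mul_eq_mul_div, div_lt_iff₀ (by positivity)]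
      nlinarith

namespace Polynomial

theorem coeff_X_mul_derivative (f : ℝ[X]) (n : ℕ) :
    (X * derivative f).coeff n = n * f.coeff n := by
  cases n with
  | zero => simp
  | succ n => rw [coeff_X_mul, coeff_derivative]; push_cast; ring

theorem natDegree_X_mul_derivative_le (f : ℝ[X]) : (X * derivative f).natDegree ≤ f.natDegree := by
  rw [natDegree_le_iff_coeff_eq_zero]
  intro n hn
  rw [coeff_X_mul_derivative, coeff_eq_zero_of_natDegree_lt hn, mul_zero]

theorem derivative_mul_sub_ne_zero {f g : ℝ[X]} (hf : f ≠ 0) (hg : g ≠ 0)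
    (hfg : f.natDegree ≠ g.natDegree) : derivative f * g - f * derivative g ≠ 0 := by
  intro h
  have h1 : (X * derivative f) * g - f * (X * derivative g) = 0 := by
    linear_combination X * h
  have h2 := congrArg (fun r => r.coeff (f.natDegree + g.natDegree)) h1
  simp only [coeff_sub, coeff_zero] at h2
  rw [coeff_mul_add_eq_of_natDegree_le (natDegree_X_mul_derivative_le f) le_rfl,
    coeff_mul_add_eq_of_natDegree_le le_rfl (natDegree_X_mul_derivative_le g), coeff_X_mul_derivative,
    coeff_X_mul_derivative] at h2
  have h3 : ((f.natDegree : ℝ) - g.natDegree) * (f.leadingCoeff * g.leadingCoeff) = 0 := by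
    rw [leadingCoeff, leadingCoeff]
    linear_combination h2
  rcases mul_eq_zero.1 h3 with h4 | h4
  · exact hfg (by exact_mod_cast sub_eq_zero.1 h4)
  · exact mul_ne_zero (leadingCoeff_ne_zero.2 hf) (leadingCoeff_ne_zero.2 hg) h4

/-- The restriction of `mixedNum P Q 1` to the diagonal. -/
noncomputable def mixedDiag (P Q : ℝ[X]) : ℝ[X] :=
  derivative Q * derivative P * (derivative Q - derivative P) * bendDeriv P Q
    - bend P Q * bend P Q * derivative P ^ 2 * derivative Q

theorem eval_mixedDiag (P Q : ℝ[X]) (z : ℝ) : (mixedDiag P Q).eval z = mixedNum P Q 1 z z := by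
  simp [mixedDiag, mixedNum]

theorem mixedDiag_ne_zero {P Q : ℝ[X]} (hP : 1 ≤ P.natDegree) (hPQ : P.natDegree < Q.natDegree) :
    mixedDiag P Q ≠ 0 := by
  have dP : (derivative P).natDegree = P.natDegree - 1 := natDegree_derivative P
  have dQ : (derivative Q).natDegree = Q.natDegree - 1 := natDegree_derivative Q
  have hP0 : derivative P ≠ 0 := fun h => by
    have := derivative_eq_zero.1 h
    omega
  have hQ0 : derivative Q ≠ 0 := fun h => by
    have := derivative_eq_zero.1 h
    omega
  have dv : (derivative Q - derivative P).natDegree = Q.natDegree - 1 := by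
    rw [natDegree_sub_eq_left_of_natDegree_lt (by omega), dQ]
  have hv0 : derivative Q - derivative P ≠ 0 := fun h => by
    rw [h, natDegree_zero] at dv
    omega
  have hW0 : bend P Q ≠ 0 := derivative_mul_sub_ne_zero hQ0 hP0 (by omega)
  have dW : (bend P Q).natDegree ≤ (P.natDegree - 1) + (Q.natDegree - 1) := by
    have h1 := natDegree_derivative_le (derivative P)
    have h2 := natDegree_derivative_le (derivative Q)
    have h3 : (derivative (derivative Q) * derivative P).natDegree
        ≤ (Q.natDegree - 1) + (P.natDegree - 1) := natDegree_mul_le_of_le (by omega) dP.le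
    have h4 : (derivative Q * derivative (derivative P)).natDegree
        ≤ (Q.natDegree - 1) + (P.natDegree - 1) := natDegree_mul_le_of_le dQ.le (by omega)
    rw [add_comm]
    exact (natDegree_sub_le_of_le h3 h4).trans (max_self _).le
  have dR : (derivative P * derivative Q * (derivative Q - derivative P)).natDegree
      = (P.natDegree - 1) + (Q.natDegree - 1) + (Q.natDegree - 1) := by
    rw [natDegree_mul (mul_ne_zero hP0 hQ0) hv0, natDegree_mul hP0 hQ0, dP, dQ, dv]
  have key := derivative_mul_sub_ne_zero hW0 (mul_ne_zero (mul_ne_zero hP0 hQ0) hv0)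
    (by rw [dR]; omega)
  have e : mixedDiag P Q = derivative P * derivative Q *
      (derivative (bend P Q) * (derivative P * derivative Q * (derivative Q - derivative P))
        - bend P Q * derivative (derivative P * derivative Q * (derivative Q - derivative P))) := by
    simp only [mixedDiag, bendDeriv, derivative_mul, derivative_sub]
    generalize derivative (bend P Q) = W1
    simp only [bend]
    ring
  rw [e]
  exact mul_ne_zero (mul_ne_zero hP0 hQ0) key

/-- A nonzero polynomial has a sign and a polynomial lower bound to the right of the origin. -/
theorem exists_pow_le_mul_eval {G : ℝ[X]} (hG : G ≠ 0) : ∃ (m : ℕ) (s : ℝ), (s = 1 ∨ s = -1) ∧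
    ∀ᶠ z in nhdsWithin (0 : ℝ) (Set.Ioi 0), z ^ m ≤ s * G.eval z := by
  obtain ⟨H, hH, hdvd⟩ := exists_eq_pow_rootMultiplicity_mul_and_not_dvd G hG 0
  have hH0 : H.eval 0 ≠ 0 := fun h => hdvd (dvd_iff_isRoot.2 h)
  obtain ⟨s, hs, hpos⟩ : ∃ s : ℝ, (s = 1 ∨ s = -1) ∧ 0 < s * H.eval 0 := by
    rcases lt_or_gt_of_ne hH0 with h | h
    · exact ⟨-1, Or.inr rfl, by linarith⟩
    · exact ⟨1, Or.inl rfl, by linarith⟩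
  refine ⟨rootMultiplicity 0 G + 1, s, hs, ?_⟩
  have hcont : ContinuousAt (fun z => s * H.eval z - z) 0 := by fun_prop
  have hev : ∀ᶠ z in nhds (0 : ℝ), 0 < s * H.eval z - z :=
    hcont.eventually_const_lt (by simpa using hpos)
  filter_upwards [nhdsWithin_le_nhds hev, self_mem_nhdsWithin] with z hz hz0
  have hz0' : 0 < z := hz0
  have hz1 : G.eval z = z ^ rootMultiplicity 0 G * H.eval z := by
    conv_lhs => rw [hH]
    simp
  rw [hz1]
  generalize rootMultiplicity 0 G = k
  calc z ^ (k + 1) = z ^ k * z := pow_succ _ _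
    _ ≤ z ^ k * (s * H.eval z) := by gcongr; linarith
    _ = _ := by ring

end Polynomial

namespace Polynomial

/-- The polynomial `x ↦ a P(τ x)`. -/
noncomputable def rescale (a τ : ℝ) (P : ℝ[X]) : ℝ[X] := C a * P.comp (C τ * X)

theorem eval_rescale (a τ : ℝ) (P : ℝ[X]) (x : ℝ) : (rescale a τ P).eval x = a * P.eval (τ * x) := by
  simp [rescale]

theorem derivative_rescale (a τ : ℝ) (P : ℝ[X]) :
    derivative (rescale a τ P) = rescale (a * τ) τ (derivative P) := by
  simp only [rescale, derivative_mul, derivative_C, zero_mul, zero_add, derivative_comp,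
    derivative_X, mul_one, map_mul]
  ring

theorem bend_rescale (a b τ : ℝ) (P Q : ℝ[X]) :
    bend (rescale a τ P) (rescale b τ Q) = rescale (a * b * τ ^ 3) τ (bend P Q) := by
  simp only [bend, derivative_rescale]
  simp only [rescale, sub_comp, mul_comp, map_mul, map_pow]
  ring

theorem bendDeriv_rescale (a b τ : ℝ) (P Q : ℝ[X]) :
    bendDeriv (rescale a τ P) (rescale b τ Q)
      = rescale (a ^ 2 * b ^ 2 * τ ^ 6) τ (bendDeriv P Q) := by
  simp only [bendDeriv, bend_rescale, derivative_rescale]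
  simp only [rescale, sub_comp, mul_comp, add_comp, map_mul, map_pow, ofNat_comp]
  ring

theorem mixedNum_rescale {s : ℝ} (hs : s ^ 2 = 1) (τ : ℝ) (P Q : ℝ[X]) (x y : ℝ) :
    mixedNum (rescale s τ P) (rescale 1 τ Q) s x y
      = s * τ ^ 9 * mixedNum P Q 1 (τ * x) (τ * y) := by
  simp only [mixedNum, bendDeriv_rescale, bend_rescale, derivative_rescale, eval_rescale]
  have h3 : s ^ 3 = s := by rw [pow_succ, hs, one_mul]
  have h5 : s ^ 5 = s := by rw [show s ^ 5 = s ^ 2 * s ^ 3 by ring, hs, h3, one_mul]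
  ring_nf
  simp only [h3, h5]

/-- Polynomials are bounded on bounded intervals. -/
theorem exists_abs_eval_le (P : ℝ[X]) : ∃ B : ℝ, 0 ≤ B ∧ ∀ z ∈ Set.Icc (0 : ℝ) 1, |P.eval z| ≤ B := by
  obtain ⟨B, hB⟩ := isCompact_Icc.exists_bound_of_continuousOn (f := fun z => P.eval z)
    (P.continuous.continuousOn (s := Set.Icc (0 : ℝ) 1))
  exact ⟨B, (norm_nonneg _).trans (hB 0 (by simp)), fun z hz => hB z hz⟩

/-- Polynomials are Lipschitz on bounded intervals. -/
theorem exists_abs_eval_sub_le (P : ℝ[X]) : ∃ B : ℝ, 0 ≤ B ∧ ∀ z ∈ Set.Icc (0 : ℝ) 1,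
    ∀ w ∈ Set.Icc (0 : ℝ) 1, |P.eval z - P.eval w| ≤ B * |z - w| := by
  obtain ⟨B, hB0, hB⟩ := exists_abs_eval_le (derivative P)
  refine ⟨B, hB0, fun z hz w hw => ?_⟩
  have := (convex_Icc (0 : ℝ) 1).norm_image_sub_le_of_norm_hasDerivWithin_le
    (f := fun z => P.eval z) (f' := fun z => (derivative P).eval z) (C := B)
    (fun u _ => (P.hasDerivAt u).hasDerivWithinAt) (fun u hu => hB u hu) hw hz
  simpa only [Real.norm_eq_abs] using this

theorem exists_abs_mixedNum_sub_le (P Q : ℝ[X]) : ∃ B : ℝ, 0 ≤ B ∧ ∀ z ∈ Set.Icc (0 : ℝ) 1,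
    ∀ w ∈ Set.Icc (0 : ℝ) 1, |mixedNum P Q 1 z w - mixedNum P Q 1 z z| ≤ B * |z - w| := by
  obtain ⟨B₁, h₁, hB₁⟩ := exists_abs_eval_le
    (derivative Q * derivative P * (derivative Q - derivative P))
  obtain ⟨B₂, h₂, hB₂⟩ := exists_abs_eval_le (bend P Q)
  obtain ⟨L₁, hl₁, hL₁⟩ := exists_abs_eval_sub_le (bendDeriv P Q)
  obtain ⟨L₂, hl₂, hL₂⟩ := exists_abs_eval_sub_le (bend P Q * derivative P ^ 2 * derivative Q)
  refine ⟨B₁ * L₁ + B₂ * L₂, by positivity, fun z hz w hw => ?_⟩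
  have e : mixedNum P Q 1 z w - mixedNum P Q 1 z z
      = (derivative Q * derivative P * (derivative Q - derivative P)).eval z
          * ((bendDeriv P Q).eval w - (bendDeriv P Q).eval z)
        - (bend P Q).eval z * ((bend P Q * derivative P ^ 2 * derivative Q).eval w
          - (bend P Q * derivative P ^ 2 * derivative Q).eval z) := by
    simp only [mixedNum, eval_mul, eval_sub, eval_pow]
    ring
  rw [e, abs_sub_comm z w]
  calc _ ≤ B₁ * (L₁ * |w - z|) + B₂ * (L₂ * |w - z|) := by
        refine (abs_sub _ _).trans (add_le_add ?_ ?_)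
        · rw [abs_mul]
          exact mul_le_mul (hB₁ z hz) (hL₁ w hw z hz) (abs_nonneg _) h₁
        · rw [abs_mul]
          exact mul_le_mul (hB₂ z hz) (hL₂ w hw z hz) (abs_nonneg _) h₂
    _ = _ := by ring

end Polynomial

theorem exists_forall_pow_le {P Q : ℝ[X]} (hP : 1 ≤ P.natDegree)
    (hPQ : P.natDegree < Q.natDegree) : ∃ (m : ℕ) (s t₀ : ℝ), s ^ 2 = 1 ∧ 0 < t₀ ∧
      ∀ z ∈ Set.Ioc 0 t₀, z ^ m ≤ s * (derivative P).eval z ∧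
        z ^ m ≤ |(derivative Q).eval z| ∧ z ^ m ≤ |(derivative Q - derivative P).eval z| ∧
        z ^ m ≤ |mixedNum P Q 1 z z| := by
  have dP : (derivative P).natDegree = P.natDegree - 1 := natDegree_derivative P
  have dQ : (derivative Q).natDegree = Q.natDegree - 1 := natDegree_derivative Q
  have hP0 : derivative P ≠ 0 := fun h => by
    have := derivative_eq_zero.1 h
    omega
  have hQ0 : derivative Q ≠ 0 := fun h => by
    have := derivative_eq_zero.1 h
    omega
  have hv0 : derivative Q - derivative P ≠ 0 := fun h => by
    have := congrArg natDegree h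
    rw [natDegree_sub_eq_left_of_natDegree_lt (by omega), natDegree_zero] at this
    omega
  obtain ⟨m₁, s, hs, e₁⟩ := exists_pow_le_mul_eval hP0
  obtain ⟨m₂, s₂, hs₂, e₂⟩ := exists_pow_le_mul_eval hQ0
  obtain ⟨m₃, s₃, hs₃, e₃⟩ := exists_pow_le_mul_eval hv0
  obtain ⟨m₄, s₄, hs₄, e₄⟩ := exists_pow_le_mul_eval (mixedDiag_ne_zero hP hPQ)
  have habs : ∀ {r y : ℝ}, (r = 1 ∨ r = -1) → r * y ≤ |y| := by
    rintro r y (rfl | rfl)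
    · rw [one_mul]
      exact le_abs_self y
    · rw [neg_one_mul]
      exact neg_le_abs y
  have ev := ((e₁.and e₂).and (e₃.and e₄)).and
    (nhdsWithin_le_nhds (Iio_mem_nhds (show (0 : ℝ) < 1 by norm_num)))
  obtain ⟨t₀, ht₀, hev⟩ := mem_nhdsGT_iff_exists_Ioc_subset.1 ev
  refine ⟨m₁ + m₂ + m₃ + m₄, s, t₀, by rcases hs with rfl | rfl <;> norm_num, ht₀,
    fun z hz => ?_⟩
  obtain ⟨⟨⟨i₁, i₂⟩, i₃, i₄⟩, i₅⟩ := hev hz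
  have hz1 : z ≤ 1 := le_of_lt i₅
  have mono : ∀ {k : ℕ}, k ≤ m₁ + m₂ + m₃ + m₄ → z ^ (m₁ + m₂ + m₃ + m₄) ≤ z ^ k :=
    fun hk => pow_le_pow_of_le_one hz.1.le hz1 hk
  refine ⟨(mono (by omega)).trans i₁, ((mono (by omega)).trans i₂).trans (habs hs₂),
    ((mono (by omega)).trans i₃).trans (habs hs₃), ?_⟩
  rw [← eval_mixedDiag]
  exact ((mono (by omega)).trans i₄).trans (habs hs₄)

theorem isCurvedWindow_rescale {P Q : ℝ[X]} {m : ℕ} {s t₀ B τ : ℝ} (hs : s ^ 2 = 1)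
    (hlow : ∀ z ∈ Set.Ioc 0 t₀, z ^ m ≤ s * (derivative P).eval z ∧
        z ^ m ≤ |(derivative Q).eval z| ∧ z ^ m ≤ |(derivative Q - derivative P).eval z| ∧
        z ^ m ≤ |mixedNum P Q 1 z z|)
    (hP1 : ∀ z ∈ Set.Icc (0 : ℝ) 1, |(derivative P).eval z| ≤ B)
    (hP2 : ∀ z ∈ Set.Icc (0 : ℝ) 1, |(derivative (derivative P)).eval z| ≤ B)
    (hQ1 : ∀ z ∈ Set.Icc (0 : ℝ) 1, |(derivative Q).eval z| ≤ B)
    (hQ2 : ∀ z ∈ Set.Icc (0 : ℝ) 1, |(derivative (derivative Q)).eval z| ≤ B)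
    (hM : ∀ z ∈ Set.Icc (0 : ℝ) 1, ∀ w ∈ Set.Icc (0 : ℝ) 1,
      |mixedNum P Q 1 z w - mixedNum P Q 1 z z| ≤ B * |z - w|)
    (hτ : 0 < τ) (h2 : 2 * τ ≤ 1) (ht : 2 * τ ≤ t₀) (hm : τ * 2 ^ (m + 1) ≤ 1)
    (hB0 : 0 ≤ B) (hB : 2 * B * τ ≤ 1) :
    IsCurvedWindow (rescale s τ P) (rescale 1 τ Q) s (τ ^ (m + 10))⁻¹ 1 (τ ^ (m + 1)) := by
  have hτ1 : τ ≤ 1 := by linarith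
  have mono : ∀ {k l : ℕ}, k ≤ l → τ ^ l ≤ τ ^ k := fun h => pow_le_pow_of_le_one hτ.le hτ1 h
  have hL1 : 1 ≤ (τ ^ (m + 10))⁻¹ := (one_le_inv₀ (by positivity)).2 (pow_le_one₀ hτ.le hτ1)
  have hσ : τ ^ (m + 1) ≤ τ := (mono (show 1 ≤ m + 1 by omega)).trans_eq (pow_one τ)
  have habs : |s| = 1 := by
    have : |s| ^ 2 = 1 := by rw [sq_abs, hs]
    exact (pow_eq_one_iff_of_nonneg (abs_nonneg s) two_ne_zero).1 this
  have hz : ∀ x ∈ Set.Icc (1 - τ ^ (m + 1)) (1 + τ ^ (m + 1)),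
      τ * x ∈ Set.Ioc 0 t₀ ∧ τ * x ∈ Set.Icc (0 : ℝ) 1 ∧ 2 * τ ^ (m + 1) ≤ (τ * x) ^ m := by
    intro x hx
    have hx1 : 1 / 2 ≤ x := by linarith [hx.1]
    have hx2 : x ≤ 2 := by linarith [hx.2]
    have i₁ : τ * x ≤ τ * 2 := by gcongr
    have i₂ : 0 < τ * x := by positivity
    refine ⟨⟨i₂, by linarith⟩, ⟨i₂.le, by linarith⟩, ?_⟩
    calc 2 * τ ^ (m + 1) = (τ * 2 ^ (m + 1)) * (τ * (1 / 2)) ^ m := by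
          rw [mul_pow, one_div, inv_pow]; field_simp; ring
      _ ≤ 1 * (τ * x) ^ m := by gcongr
      _ = _ := one_mul _
  have hBτ : τ * B ≤ 1 := by nlinarith
  have hBτ2 : τ ^ 2 * B ≤ 1 := by nlinarith
  have up1 : ∀ {r y : ℝ}, |r| = 1 → |y| ≤ B → |r * τ * y| ≤ (τ ^ (m + 10))⁻¹ := by
    intro r y hr hy
    rw [abs_mul, abs_mul, hr, one_mul, abs_of_pos hτ]
    exact ((mul_le_mul_of_nonneg_left hy hτ.le).trans hBτ).trans hL1
  have up2 : ∀ {r y : ℝ}, |r| = 1 → |y| ≤ B → |r * τ * τ * y| ≤ (τ ^ (m + 10))⁻¹ := by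
    intro r y hr hy
    rw [abs_mul, abs_mul, abs_mul, hr, one_mul, abs_of_pos hτ, ← pow_two]
    exact ((mul_le_mul_of_nonneg_left hy (by positivity)).trans hBτ2).trans hL1
  have lo : ∀ {y : ℝ}, 2 * τ ^ (m + 1) ≤ y → τ ^ (m + 10) ≤ τ * y := by
    intro y hy
    calc τ ^ (m + 10) ≤ τ ^ (m + 2) := mono (by omega)
      _ = τ * τ ^ (m + 1) := by ring
      _ ≤ τ * y := by gcongr; linarith [show 0 < τ ^ (m + 1) by positivity]
  refine ⟨hL1, ?_, hσ.trans hτ1, habs.trans_le hL1, ?_, ?_, ?_, ?_, ?_, ?_, ?_, ?_⟩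
  · rw [inv_inv]
    exact mono (by omega)
  · intro x hx
    obtain ⟨i₁, i₂, i₃⟩ := hz x hx
    rw [inv_inv, derivative_rescale, eval_rescale]
    exact (lo (i₃.trans (hlow _ i₁).1)).trans_eq (by ring)
  · intro x hx
    rw [derivative_rescale, eval_rescale]
    exact (le_abs_self _).trans (up1 habs (hP1 _ (hz x hx).2.1))
  · intro x hx
    rw [derivative_rescale, derivative_rescale, eval_rescale]
    exact up2 habs (hP2 _ (hz x hx).2.1)
  · intro x hx
    obtain ⟨i₁, i₂, i₃⟩ := hz x hx
    rw [inv_inv, derivative_rescale, eval_rescale, one_mul, abs_mul, abs_of_pos hτ]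
    exact lo (i₃.trans (hlow _ i₁).2.1)
  · intro x hx
    rw [derivative_rescale, eval_rescale]
    exact up1 abs_one (hQ1 _ (hz x hx).2.1)
  · intro x hx
    rw [derivative_rescale, derivative_rescale, eval_rescale]
    exact up2 abs_one (hQ2 _ (hz x hx).2.1)
  · intro x hx
    obtain ⟨i₁, i₂, i₃⟩ := hz x hx
    have e : (derivative (rescale 1 τ Q)).eval x - s * (derivative (rescale s τ P)).eval x
        = τ * (derivative Q - derivative P).eval (τ * x) := by
      rw [derivative_rescale, derivative_rescale, eval_rescale, eval_rescale, eval_sub]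
      linear_combination -τ * (derivative P).eval (τ * x) * hs
    rw [inv_inv, e, abs_mul, abs_of_pos hτ]
    exact lo (i₃.trans (hlow _ i₁).2.2.1)
  · intro x hx y hy
    obtain ⟨i₁, i₂, i₃⟩ := hz x hx
    have j₂ := (hz y hy).2.1
    have hxy : |τ * x - τ * y| ≤ τ * (2 * τ ^ (m + 1)) := by
      rw [← mul_sub, abs_mul, abs_of_pos hτ]
      gcongr
      rw [abs_le]
      constructor <;> linarith [hx.1, hx.2, hy.1, hy.2]
    have k₁ := hM _ i₂ _ j₂
    have k₂ : B * |τ * x - τ * y| ≤ τ ^ (m + 1) := by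
      calc B * |τ * x - τ * y| ≤ B * (τ * (2 * τ ^ (m + 1))) := by gcongr
        _ = (2 * B * τ) * τ ^ (m + 1) := by ring
        _ ≤ 1 * τ ^ (m + 1) := by gcongr
        _ = _ := one_mul _
    have k₃ : τ ^ (m + 1) ≤ |mixedNum P Q 1 (τ * x) (τ * y)| := by
      have := (hlow _ i₁).2.2.2
      have := abs_sub_abs_le_abs_sub (mixedNum P Q 1 (τ * x) (τ * x))
        (mixedNum P Q 1 (τ * x) (τ * y))
      rw [abs_sub_comm] at this
      linarith
    rw [inv_inv, mixedNum_rescale hs, abs_mul, abs_mul, habs, one_mul, abs_of_pos (by positivity)]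
    calc τ ^ (m + 10) = τ ^ 9 * τ ^ (m + 1) := by ring
      _ ≤ _ := by gcongr

theorem exists_hasWindow_of_small {P Q : ℝ[X]} (hP : 1 ≤ P.natDegree)
    (hPQ : P.natDegree < Q.natDegree) (hP0 : P.eval 0 = 0) (hQ0 : Q.eval 0 = 0) :
    ∃ C b₁ : ℕ, ∀ b, b₁ ≤ b → HasWindow P Q 1 (2 ^ (2 * b))⁻¹ C 0 b := by
  obtain ⟨m, s, t₀, hs, ht₀, hlow⟩ := exists_forall_pow_le hP hPQ
  obtain ⟨B₁, p₁, h₁⟩ := exists_abs_eval_le (derivative P)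
  obtain ⟨B₂, p₂, h₂⟩ := exists_abs_eval_le (derivative (derivative P))
  obtain ⟨B₃, p₃, h₃⟩ := exists_abs_eval_le (derivative Q)
  obtain ⟨B₄, p₄, h₄⟩ := exists_abs_eval_le (derivative (derivative Q))
  obtain ⟨B₅, p₅, h₅⟩ := exists_abs_mixedNum_sub_le P Q
  obtain ⟨B₆, p₆, h₆⟩ := exists_abs_eval_sub_le P
  obtain ⟨B₇, p₇, h₇⟩ := exists_abs_eval_sub_le Q
  set B := B₁ + B₂ + B₃ + B₄ + B₅ + B₆ + B₇ with hB
  obtain ⟨C₀, hC₀⟩ := pow_unbounded_of_one_lt (2 * B) (show (1 : ℝ) < 2 by norm_num)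
  have hlim : Filter.Tendsto (fun b : ℕ => ((2 : ℝ) ^ (2 * b))⁻¹) Filter.atTop (nhds 0) := by
    have := tendsto_pow_atTop_nhds_zero_of_lt_one (r := ((4 : ℝ)⁻¹)) (by norm_num) (by norm_num)
    refine this.congr fun b => ?_
    rw [pow_mul, inv_pow]
    norm_num
  have hsm : ∀ {K u : ℝ}, 0 < u → ∀ᶠ b : ℕ in Filter.atTop, K * ((2 : ℝ) ^ (2 * b))⁻¹ ≤ u := by
    intro K u hu
    have := (hlim.const_mul K).eventually_lt_const (by simpa using hu)
    exact this.mono fun b hb => hb.le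
  obtain ⟨b₁, hb₁⟩ := Filter.eventually_atTop.1
    (((hsm (K := 2) one_pos).and (hsm (K := 2) ht₀)).and
      ((hsm (K := 2 ^ (m + 1)) one_pos).and (hsm (K := 2 * B) one_pos)))
  refine ⟨2 * (m + 10) + C₀, b₁, fun b hb => ?_⟩
  obtain ⟨⟨k₁, k₂⟩, k₃, k₄⟩ := hb₁ b hb
  set τ : ℝ := (2 ^ (2 * b))⁻¹ with hτdef
  have hτ : 0 < τ := by positivity
  have hτ1 : τ ≤ 1 := by linarith
  have hσ : τ ^ (m + 1) ≤ τ :=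
    (pow_le_pow_of_le_one hτ.le hτ1 (show 1 ≤ m + 1 by omega)).trans_eq (pow_one τ)
  have hwin := isCurvedWindow_rescale hs hlow (B := B) (fun z hz => (h₁ z hz).trans (by linarith))
    (fun z hz => (h₂ z hz).trans (by linarith)) (fun z hz => (h₃ z hz).trans (by linarith))
    (fun z hz => (h₄ z hz).trans (by linarith))
    (fun z hz w hw => (h₅ z hz w hw).trans (by gcongr; linarith)) hτ k₁ k₂
    (by rwa [mul_comm]) (by positivity) k₄
  have habs : |s| = 1 := by
    have : |s| ^ 2 = 1 := by rw [sq_abs, hs]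
    exact (pow_eq_one_iff_of_nonneg (abs_nonneg s) two_ne_zero).1 this
  have hup : ∀ {R : ℝ[X]} {K : ℝ}, R.eval 0 = 0 → 0 ≤ K → K ≤ B → (∀ z ∈ Set.Icc (0 : ℝ) 1,
      ∀ w ∈ Set.Icc (0 : ℝ) 1, |R.eval z - R.eval w| ≤ K * |z - w|) →
      ∀ x ∈ Set.Icc (1 - τ ^ (m + 1)) (1 + τ ^ (m + 1)),
        |R.eval (τ * x)| ≤ 2 ^ (2 * (m + 10) + C₀) * τ := by
    intro R K hR hK0 hK hl x hx
    have hx1 : 0 ≤ x := by linarith [hx.1]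
    have hx2 : x ≤ 2 := by linarith [hx.2]
    have i₁ : τ * x ≤ τ * 2 := by gcongr
    have i₂ : 0 ≤ τ * x := by positivity
    have i₃ := hl (τ * x) ⟨i₂, by linarith⟩ 0 (by simp)
    rw [hR, sub_zero, sub_zero, abs_of_nonneg i₂] at i₃
    calc |R.eval (τ * x)| ≤ K * (τ * x) := i₃
      _ ≤ B * (τ * 2) := by gcongr
      _ = (2 * B) * τ := by ring
      _ ≤ 2 ^ C₀ * τ := by gcongr
      _ ≤ 2 ^ (2 * (m + 10) + C₀) * τ := by gcongr <;> norm_num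
  refine ⟨rescale s τ P, rescale 1 τ Q, s, (τ ^ (m + 10))⁻¹, τ ^ (m + 1), 1, hwin,
    by linarith, ?_, one_pos, ?_, ?_, ?_, ?_, ?_, ?_, ?_⟩
  · rintro rfl
    simp at habs
  · rw [hτdef, inv_pow, inv_inv, ← pow_mul]
    refine pow_le_pow_right₀ (by norm_num) ?_
    nlinarith
  · exact inv_le_one_of_one_le₀ (one_le_pow₀ (by norm_num))
  · rw [habs, mul_one]
    exact inv_le_one_of_one_le₀ (one_le_pow₀ (by norm_num))
  · intro x hx
    rw [eval_rescale, one_mul, one_mul]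
    exact hup hQ0 p₇ (by linarith) h₇ x hx
  · intro x hx
    rw [eval_rescale, one_mul, ← mul_assoc, ← pow_two, hs, one_mul, zero_add]
    exact hup hP0 p₆ (by linarith) h₆ x hx
  · intro x
    rw [eval_rescale]
    linear_combination (P.eval (τ * x)) * hs
  · intro x
    rw [eval_rescale]
    ring

theorem tendsto_pow_mul_inv_pow_atTop {i d : ℕ} (hid : i ≤ d) :
    Filter.Tendsto (fun τ : ℝ => τ ^ i * (τ ^ d)⁻¹) Filter.atTop (nhds (if i = d then 1 else 0)) := by
  split_ifs with h
  · subst h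
    refine tendsto_const_nhds.congr' ?_
    filter_upwards [Filter.eventually_gt_atTop 0] with τ hτ
    rw [mul_inv_cancel₀ (by positivity)]
  · have := tendsto_inv_atTop_zero.comp
      (Filter.tendsto_pow_atTop (α := ℝ) (show d - i ≠ 0 by omega))
    refine this.congr' ?_
    filter_upwards [Filter.eventually_gt_atTop 0] with τ hτ
    rw [Function.comp_apply, ← Nat.add_sub_cancel' hid, pow_add, Nat.add_sub_cancel_left]
    field_simp

/-- Rescaled derivatives of a polynomial converge at infinity to those of its leading term. -/
theorem tendsto_eval_iterate_derivative {P : ℝ[X]} {d : ℕ} (hd : P.natDegree ≤ d) (k : ℕ) :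
    Filter.Tendsto
      (fun z : ℝ × ℝ => z.1 ^ k * (z.1 ^ d)⁻¹ * (derivative^[k] P).eval (z.1 * z.2))
      (Filter.atTop ×ˢ nhds 1) (nhds (d.descFactorial k * P.coeff d)) := by
  have e : ∀ z : ℝ × ℝ, z.1 ^ k * (z.1 ^ d)⁻¹ * (derivative^[k] P).eval (z.1 * z.2)
      = ∑ i ∈ Finset.range (d + 1), (i.descFactorial k * P.coeff i)
          * (z.1 ^ i * (z.1 ^ d)⁻¹ * z.2 ^ (i - k)) := by
    intro z
    conv_lhs => rw [P.as_sum_range' (d + 1) (by omega)]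
    rw [iterate_derivative_sum, eval_finsetSum, Finset.mul_sum]
    refine Finset.sum_congr rfl fun i _ => ?_
    rw [← C_mul_X_pow_eq_monomial, iterate_derivative_C_mul, iterate_derivative_X_pow_eq_smul]
    by_cases hik : k ≤ i
    · obtain ⟨j, rfl⟩ := Nat.exists_eq_add_of_le hik
      simp only [eval_mul, eval_C, eval_smul, eval_pow, eval_X,
        Nat.add_sub_cancel_left, smul_eq_mul, mul_pow, pow_add]
      ring
    · rw [Nat.descFactorial_of_lt (by omega)]
      simp
  have hs : (d.descFactorial k * P.coeff d : ℝ) = ∑ i ∈ Finset.range (d + 1),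
      (i.descFactorial k * P.coeff i) * ((if i = d then 1 else 0) * 1 ^ (i - k)) := by
    simp
  rw [hs]
  refine Filter.Tendsto.congr (fun z => (e z).symm) (tendsto_finsetSum _ fun i hi => ?_)
  have hi : i ≤ d := by
    have := Finset.mem_range.1 hi
    omega
  exact (((tendsto_pow_mul_inv_pow_atTop hi).comp Filter.tendsto_fst).mul
    (Filter.tendsto_snd.pow _)).const_mul _

theorem cast_descFactorial_three (d : ℕ) :
    (d.descFactorial 3 : ℝ) = d * (d - 1) * (d - 2) := by
  rcases d with _ | _ | d
  · simp
  · simp [Nat.descFactorial]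
  · simp only [Nat.descFactorial_succ, Nat.descFactorial_zero]
    rw [show d + 1 + 1 - 2 = d by omega, show d + 1 + 1 - 1 = d + 1 by omega]
    push_cast
    ring

theorem eventually_abs_le_two_pow {α : Type*} {F : Filter α} {f : α → ℝ} {a : ℝ}
    (h : Filter.Tendsto f F (nhds a)) :
    ∀ᶠ C : ℕ in Filter.atTop, ∀ᶠ z in F, |f z| ≤ 2 ^ C := by
  filter_upwards [(tendsto_pow_atTop_atTop_of_one_lt (show (1 : ℝ) < 2 by norm_num)).eventually_gt_atTop
    |a|] with C hC
  exact (h.abs.eventually_lt_const hC).mono fun z hz => hz.le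

theorem eventually_inv_two_pow_le {α : Type*} {F : Filter α} {f : α → ℝ} {a : ℝ}
    (h : Filter.Tendsto f F (nhds a)) (ha : 0 < a) :
    ∀ᶠ C : ℕ in Filter.atTop, ∀ᶠ z in F, ((2 : ℝ) ^ C)⁻¹ ≤ f z := by
  filter_upwards [(tendsto_pow_atTop_atTop_of_one_lt (show (1 : ℝ) < 2 by norm_num)).eventually_gt_atTop
    a⁻¹] with C hC
  exact (h.eventually_const_lt (inv_lt_of_inv_lt₀ ha hC)).mono fun z hz => hz.le

theorem eventually_inv_two_pow_le_abs {α : Type*} {F : Filter α} {f : α → ℝ} {a : ℝ}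
    (h : Filter.Tendsto f F (nhds a)) (ha : a ≠ 0) :
    ∀ᶠ C : ℕ in Filter.atTop, ∀ᶠ z in F, ((2 : ℝ) ^ C)⁻¹ ≤ |f z| :=
  eventually_inv_two_pow_le h.abs (abs_pos.2 ha)

theorem mixedNum_eq (p q : ℝ[X]) (ω x y : ℝ) :
    mixedNum p q ω x y = (derivative q).eval x * (derivative p).eval x
      * ((derivative q).eval x - ω * (derivative p).eval x)
      * (((derivative^[3] q).eval y * (derivative p).eval y
          - (derivative q).eval y * (derivative^[3] p).eval y)
          * (derivative p).eval y * (derivative q).eval y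
        - ((derivative^[2] q).eval y * (derivative p).eval y
            - (derivative q).eval y * (derivative^[2] p).eval y)
          * ((derivative^[2] p).eval y * (derivative q).eval y
            + 2 * (derivative p).eval y * (derivative^[2] q).eval y))
      - ω * ((derivative^[2] q).eval x * (derivative p).eval x
            - (derivative q).eval x * (derivative^[2] p).eval x)
        * ((derivative^[2] q).eval y * (derivative p).eval y
            - (derivative q).eval y * (derivative^[2] p).eval y)
        * (derivative p).eval y ^ 2 * (derivative q).eval y := by
  simp only [mixedNum, bendDeriv, bend, derivative_sub, derivative_mul, eval_sub, eval_mul,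
    eval_add, eval_ofNat, Function.iterate_succ, Function.iterate_zero, Function.comp_apply, id]
  ring

theorem iterate_derivative_rescale (a τ : ℝ) (P : ℝ[X]) (k : ℕ) :
    derivative^[k] (rescale a τ P) = rescale (a * τ ^ k) τ (derivative^[k] P) := by
  induction k with
  | zero => simp
  | succ k ih =>
    rw [Function.iterate_succ_apply', ih, derivative_rescale, Function.iterate_succ_apply', pow_succ,
      mul_assoc]

theorem tendsto_eval_rescale (s : ℝ) {P : ℝ[X]} {d : ℕ} (hd : P.natDegree ≤ d) (k : ℕ) :
    Filter.Tendsto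
      (fun z : ℝ × ℝ => (derivative^[k] (rescale (s * (z.1 ^ d)⁻¹) z.1 P)).eval z.2)
      (Filter.atTop ×ˢ nhds 1) (nhds (s * (d.descFactorial k * P.coeff d))) := by
  refine ((tendsto_eval_iterate_derivative hd k).const_mul s).congr fun z => ?_
  rw [iterate_derivative_rescale, eval_rescale]
  ring

theorem exists_isCurvedWindow_of_large {P Q : ℝ[X]} (hP : 1 ≤ P.natDegree)
    (hPQ : P.natDegree < Q.natDegree) : ∃ (C : ℕ) (T σ s : ℝ), s ^ 2 = 1 ∧ 0 < T ∧ σ ≤ 1 / 2 ∧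
      ∀ τ, T ≤ τ → IsCurvedWindow (rescale (s * (τ ^ P.natDegree)⁻¹) τ P)
          (rescale (1 * (τ ^ Q.natDegree)⁻¹) τ Q) (s * (τ ^ P.natDegree * (τ ^ Q.natDegree)⁻¹))
          (2 ^ C) 1 σ ∧
        ∀ x ∈ Set.Icc (1 - σ) (1 + σ),
          |(rescale (s * (τ ^ P.natDegree)⁻¹) τ P).eval x| ≤ 2 ^ C ∧
          |(rescale (1 * (τ ^ Q.natDegree)⁻¹) τ Q).eval x| ≤ 2 ^ C := by
  set d := P.natDegree with hd
  set e := Q.natDegree with he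
  have hP0 : P.coeff d ≠ 0 := by
    rw [hd, coeff_natDegree, leadingCoeff_ne_zero]
    intro h
    simp [hd, h] at hP
  have hQ0 : Q.coeff e ≠ 0 := by
    rw [he, coeff_natDegree, leadingCoeff_ne_zero]
    intro h
    simp [he, h] at hPQ
  obtain ⟨s, hs, hA⟩ : ∃ s : ℝ, s ^ 2 = 1 ∧ 0 < s * P.coeff d := by
    rcases lt_or_gt_of_ne hP0 with h | h
    · exact ⟨-1, by norm_num, by linarith⟩
    · exact ⟨1, by norm_num, by linarith⟩
  set G : Filter (ℝ × ℝ × ℝ) := Filter.atTop ×ˢ (nhds 1 ×ˢ nhds 1) with hG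
  have gx : Filter.Tendsto (fun z : ℝ × ℝ × ℝ => (z.1, z.2.1)) G (Filter.atTop ×ˢ nhds 1) :=
    Filter.tendsto_fst.prodMk (Filter.tendsto_fst.comp Filter.tendsto_snd)
  have gy : Filter.Tendsto (fun z : ℝ × ℝ × ℝ => (z.1, z.2.2)) G (Filter.atTop ×ˢ nhds 1) :=
    Filter.tendsto_fst.prodMk (Filter.tendsto_snd.comp Filter.tendsto_snd)
  let p := fun τ : ℝ => rescale (s * (τ ^ d)⁻¹) τ P
  let q := fun τ : ℝ => rescale (1 * (τ ^ e)⁻¹) τ Q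
  let ω := fun τ : ℝ => s * (τ ^ d * (τ ^ e)⁻¹)
  have px := fun k => (tendsto_eval_rescale s hd.ge k).comp gx
  have py := fun k => (tendsto_eval_rescale s hd.ge k).comp gy
  have qx := fun k => (tendsto_eval_rescale 1 he.ge k).comp gx
  have qy := fun k => (tendsto_eval_rescale 1 he.ge k).comp gy
  have hω : Filter.Tendsto (fun z : ℝ × ℝ × ℝ => ω z.1) G (nhds 0) := by
    have := (tendsto_pow_mul_inv_pow_atTop hPQ.le).const_mul s
    rw [if_neg hPQ.ne, mul_zero] at this
    exact this.comp Filter.tendsto_fst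
  have hd0 : (0 : ℝ) < d := by exact_mod_cast hP
  have he0 : (0 : ℝ) < e := by exact_mod_cast hP.trans hPQ.le
  have hde : (0 : ℝ) < e - d := sub_pos.2 (by exact_mod_cast hPQ)
  have hv : Filter.Tendsto (fun z : ℝ × ℝ × ℝ => (derivative (q z.1)).eval z.2.1
      - ω z.1 * (derivative (p z.1)).eval z.2.1) G (nhds (e * Q.coeff e)) := by
    have := (qx 1).sub (hω.mul (px 1))
    refine (this.congr fun _ => rfl).trans_eq ?_
    rw [zero_mul, sub_zero, one_mul, Nat.descFactorial_one]
  have hN : Filter.Tendsto (fun z : ℝ × ℝ × ℝ => mixedNum (p z.1) (q z.1) (ω z.1) z.2.1 z.2.2) G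
      (nhds (-((e - d) * e * (e * Q.coeff e) ^ 4 * (d * (s * P.coeff d)) ^ 3))) := by
    have := ((((qx 1).mul (px 1)).mul ((qx 1).sub (hω.mul (px 1)))).mul
      ((((((qy 3).mul (py 1)).sub ((qy 1).mul (py 3))).mul (py 1)).mul (qy 1)).sub
        ((((qy 2).mul (py 1)).sub ((qy 1).mul (py 2))).mul
          (((py 2).mul (qy 1)).add (((py 1).const_mul 2).mul (qy 2)))))).sub
      ((((hω.mul (((qx 2).mul (px 1)).sub ((qx 1).mul (px 2)))).mul
        (((qy 2).mul (py 1)).sub ((qy 1).mul (py 2)))).mul ((py 1).pow 2)).mul (qy 1))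
    refine (this.congr fun z => (mixedNum_eq _ _ _ _ _).symm).trans_eq ?_
    rw [cast_descFactorial_three, cast_descFactorial_three, Nat.cast_descFactorial_two,
      Nat.cast_descFactorial_two, Nat.descFactorial_one, Nat.descFactorial_one]
    congr 1
    ring
  have hev := (((eventually_abs_le_two_pow hω).and (eventually_inv_two_pow_le (px 1) (by
      rw [Nat.descFactorial_one]; nlinarith))).and
    ((eventually_abs_le_two_pow (px 1)).and (eventually_abs_le_two_pow (px 2)))).and
    (((eventually_inv_two_pow_le_abs (qx 1) (by
      rw [Nat.descFactorial_one]; positivity)).and (eventually_abs_le_two_pow (qx 1))).and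
    ((eventually_abs_le_two_pow (qx 2)).and (eventually_inv_two_pow_le_abs hv (by positivity))))
  have hev' := (eventually_inv_two_pow_le_abs hN (by
      have : 0 < Q.coeff e ^ 4 := by positivity
      have : 0 < (e - d) * e * (e * Q.coeff e) ^ 4 * (d * (s * P.coeff d)) ^ 3 := by
        have : (e * Q.coeff e) ^ 4 = (e : ℝ) ^ 4 * Q.coeff e ^ 4 := mul_pow _ _ _
        rw [this]
        positivity
      exact neg_ne_zero.2 this.ne')).and
    ((eventually_abs_le_two_pow (px 0)).and (eventually_abs_le_two_pow (qx 0)))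
  obtain ⟨C, ⟨⟨⟨c₁, c₂⟩, c₃, c₄⟩, ⟨c₅, c₆⟩, c₇, c₈⟩, c₉, c₁₀, c₁₁⟩ := (hev.and hev').exists
  obtain ⟨pa, ha, pb, hb, hab⟩ := Filter.eventually_prod_iff.1
    ((((c₁.and c₂).and (c₃.and c₄)).and ((c₅.and c₆).and (c₇.and c₈))).and (c₉.and (c₁₀.and c₁₁)))
  obtain ⟨pc, hc, pd, hd', hcd⟩ := Filter.eventually_prod_iff.1 hb
  obtain ⟨T, hT⟩ := Filter.eventually_atTop.1 ha
  obtain ⟨σ, hσ, hball⟩ := Metric.nhds_basis_closedBall.eventually_iff.1 (hc.and hd')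
  rw [Real.closedBall_eq_Icc] at hball
  obtain ⟨C', hC'⟩ := pow_unbounded_of_one_lt (min σ (1 / 2))⁻¹ (show (1 : ℝ) < 2 by norm_num)
  have hσ0 : 0 < min σ (1 / 2) := lt_min hσ (by norm_num)
  have mem : ∀ x ∈ Set.Icc (1 - min σ (1 / 2)) (1 + min σ (1 / 2)), pc x ∧ pd x := fun x hx =>
    hball ⟨by linarith [hx.1, min_le_left σ (1 / 2)], by linarith [hx.2, min_le_left σ (1 / 2)]⟩
  have m1 : (2 : ℝ) ^ C ≤ 2 ^ (C + C') := pow_le_pow_right₀ (by norm_num) (by omega)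
  have m2 : (2 : ℝ) ^ C' ≤ 2 ^ (C + C') := pow_le_pow_right₀ (by norm_num) (by omega)
  have m3 : ((2 : ℝ) ^ (C + C'))⁻¹ ≤ (2 ^ C)⁻¹ := by gcongr
  refine ⟨C + C', max T 1, min σ (1 / 2), s, hs, by positivity, min_le_right _ _, fun τ hτ => ?_⟩
  have key := fun x (hx : x ∈ Set.Icc (1 - min σ (1 / 2)) (1 + min σ (1 / 2))) y
    (hy : y ∈ Set.Icc (1 - min σ (1 / 2)) (1 + min σ (1 / 2))) =>
      hab (hT τ ((le_max_left _ _).trans hτ)) (hcd (mem x hx).1 (mem y hy).2)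
  have h1 : (1 : ℝ) ∈ Set.Icc (1 - min σ (1 / 2)) (1 + min σ (1 / 2)) := by
    constructor <;> linarith
  refine ⟨⟨one_le_pow₀ (by norm_num), ?_, (min_le_right _ _).trans (by norm_num),
    (key 1 h1 1 h1).1.1.1.1.trans m1,
    fun x hx => m3.trans (key x hx x hx).1.1.1.2,
    fun x hx => ((le_abs_self _).trans (key x hx x hx).1.1.2.1).trans m1,
    fun x hx => (key x hx x hx).1.1.2.2.trans m1,
    fun x hx => m3.trans (key x hx x hx).1.2.1.1,
    fun x hx => (key x hx x hx).1.2.1.2.trans m1,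
    fun x hx => (key x hx x hx).1.2.2.1.trans m1,
    fun x hx => m3.trans (key x hx x hx).1.2.2.2,
    fun x hx y hy => m3.trans (key x hx y hy).2.1⟩,
    fun x hx => ⟨(key x hx x hx).2.2.1.trans m1, (key x hx x hx).2.2.2.trans m1⟩⟩
  exact inv_le_of_inv_le₀ hσ0 (hC'.le.trans m2)

theorem exists_hasWindow_of_large {P Q : ℝ[X]} (hP : 1 ≤ P.natDegree)
    (hPQ : P.natDegree < Q.natDegree) : ∃ (C : ℕ) (T : ℝ), 0 < T ∧ ∀ N : ℝ, 1 < N → ∃ ν, ∀ b : ℕ,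
      1 ≤ b → T ≤ N ^ ((Q.natDegree : ℝ)⁻¹) * (2 ^ (2 * b))⁻¹ →
        HasWindow P Q N (N ^ ((Q.natDegree : ℝ)⁻¹) * (2 ^ (2 * b))⁻¹) C ν b := by
  obtain ⟨C₀, T, σ, s, hs, hT, hσ, hwin⟩ := exists_isCurvedWindow_of_large hP hPQ
  set d := P.natDegree
  set e := Q.natDegree
  have habs : |s| = 1 := by
    have : |s| ^ 2 = 1 := by rw [sq_abs, hs]
    exact (pow_eq_one_iff_of_nonneg (abs_nonneg s) two_ne_zero).1 this
  have hs0 : s ≠ 0 := by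
    rintro rfl
    norm_num at hs
  refine ⟨C₀ + 2 * e + 1, T, hT, fun N hN => ?_⟩
  set C := C₀ + 2 * e + 1 with hC
  have hN0 : 0 < N := by linarith
  set R := N ^ ((e : ℝ)⁻¹) with hR
  have hR0 : 0 < R := by positivity
  have hR1 : 1 ≤ R := Real.one_le_rpow hN.le (by positivity)
  have hRe : R ^ e = N := Real.rpow_inv_natCast_pow hN0.le (by omega)
  have hM : R ^ d ≤ N := by
    rw [← hRe]
    exact pow_le_pow_right₀ hR1 hPQ.le
  have hRd : 0 < R ^ d := by positivity
  obtain ⟨ν, hν₁, hν₂⟩ := exists_nat_pow_near ((one_le_div hRd).2 hM) (show (1 : ℝ) < 2 by norm_num)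
  rw [le_div_iff₀ hRd] at hν₁
  rw [div_lt_iff₀ hRd] at hν₂
  refine ⟨ν, fun b hb hTb => ?_⟩
  set τ := R * (2 ^ (2 * b))⁻¹ with hτ
  have hτ0 : 0 < τ := by positivity
  obtain ⟨hw, hbd⟩ := hwin τ hTb
  have hτd : τ ^ d = R ^ d * (2 ^ (2 * b * d))⁻¹ := by rw [hτ, mul_pow, inv_pow, ← pow_mul]
  have hτe : τ ^ e / N = (2 ^ (2 * b * e))⁻¹ := by
    rw [hτ, mul_pow, inv_pow, ← pow_mul, hRe]
    field_simp
  have hβω : τ ^ e / N * (s * (τ ^ d * (τ ^ e)⁻¹)) = s * (τ ^ d / N) := by field_simp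
  have hCb : ∀ k, k ≤ C → k ≤ C * b := fun k hk => hk.trans (Nat.le_mul_of_pos_right C hb)
  have two : ∀ {k l : ℕ}, k ≤ l → (2 : ℝ) ^ k ≤ 2 ^ l :=
    fun h => pow_le_pow_right₀ (by norm_num) h
  refine ⟨_, _, _, _, σ, τ ^ e / N, hw, hσ, by positivity, by positivity, two (hCb _ (by omega)),
    ?_, ?_, ?_, ?_, ?_, ?_⟩
  · rw [hτe]
    refine inv_anti₀ (by positivity) (two ?_)
    calc 2 * b * e = 2 * e * b := by ring
      _ ≤ C * b := Nat.mul_le_mul_right b (by omega)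
  · have e₁ : |s * (τ ^ d * (τ ^ e)⁻¹)| = τ ^ d * (τ ^ e)⁻¹ := by
      rw [abs_mul, habs, one_mul, abs_of_pos (by positivity)]
    rw [e₁, show τ ^ e / N * (τ ^ d * (τ ^ e)⁻¹) = τ ^ d / N by field_simp, hτd]
    have i₁ : ν + 1 + 2 * b * d ≤ ν + C * b := by
      have : (2 * e + 1) * b ≤ C * b := Nat.mul_le_mul_right b (by omega)
      have : b * d ≤ b * e := Nat.mul_le_mul_left b hPQ.le
      nlinarith
    calc ((2 : ℝ) ^ (ν + C * b))⁻¹ ≤ (2 ^ (ν + 1 + 2 * b * d))⁻¹ := by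
          have := two i₁
          gcongr
      _ = (2 ^ (ν + 1))⁻¹ * (2 ^ (2 * b * d))⁻¹ := by rw [pow_add, mul_inv]
      _ ≤ (R ^ d / N) * (2 ^ (2 * b * d))⁻¹ := by
          gcongr
          rw [inv_le_iff_one_le_mul₀ (by positivity), div_mul_eq_mul_div, le_div_iff₀ hN0]
          linarith
      _ = _ := by ring
  · intro x hx
    rw [hτe, abs_mul, abs_of_pos (by positivity), mul_comm]
    exact mul_le_mul ((hbd x hx).2.trans (two (show C₀ ≤ C by omega))) (inv_anti₀ (by positivity)
      (two (Nat.le_mul_of_pos_right _ (by omega)))) (by positivity) (by positivity)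
  · intro x hx
    rw [← mul_assoc, hβω, mul_assoc, abs_mul, habs, one_mul, abs_mul, abs_of_pos (by positivity),
      mul_comm]
    have := (hbd x hx).1
    have i₁ : τ ^ d / N ≤ (2 ^ (ν + 2 * b))⁻¹ := by
      rw [hτd, div_le_iff₀ hN0, mul_inv_le_iff₀ (by positivity)]
      calc R ^ d ≤ (2 ^ ν)⁻¹ * N := by
            rw [le_inv_mul_iff₀ (by positivity)]
            exact hν₁
        _ = (2 ^ (ν + 2 * b))⁻¹ * N * 2 ^ (2 * b) := by rw [pow_add]; field_simp
        _ ≤ (2 ^ (ν + 2 * b))⁻¹ * N * 2 ^ (2 * b * d) := by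
            have := two (Nat.le_mul_of_pos_right (2 * b) hP)
            gcongr
    exact mul_le_mul (this.trans (two (show C₀ ≤ C by omega))) i₁ (by positivity) (by positivity)
  · intro x
    rw [← mul_assoc, hβω, eval_rescale]
    field_simp
    linear_combination (P.eval (τ * x)) * hs
  · intro x
    rw [eval_rescale]
    field_simp

/-- Theorem 1 of the paper.  For polynomials `P₁`, `P₂` with
`1 ≤ deg P₁ < deg P₂ = d₂` and `P₁(0) = P₂(0) = 0`, there is `c > 0` depending only on
`P₁, P₂` such that for every `ε > 0` there is `δ ≥ exp(−exp(c ε⁻⁶))` such that every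
measurable `S ⊆ [0, N]` (with `N > 1`) of measure `≥ εN` contains a triplet
`x, x + P₁(t), x + P₂(t)` with `t > δ N^{1/d₂}`. -/
theorem stmt0 (P₁ P₂ : Polynomial ℝ)
    (hdeg₁ : 1 ≤ P₁.natDegree) (hdeg₁₂ : P₁.natDegree < P₂.natDegree)
    (h01 : P₁.eval 0 = 0) (h02 : P₂.eval 0 = 0) :
    ∃ c : ℝ, 0 < c ∧ ∀ ε : ℝ, 0 < ε → ∃ δ : ℝ, 0 < δ ∧
      Real.exp (-Real.exp (c * ε ^ (-6 : ℝ))) ≤ δ ∧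
      ∀ N : ℝ, 1 < N → ∀ S : Set ℝ, MeasurableSet S → S ⊆ Set.Icc 0 N →
        ENNReal.ofReal (ε * N) ≤ volume S →
        ∃ x t : ℝ, δ * N ^ ((P₂.natDegree : ℝ)⁻¹) < t ∧
          x ∈ S ∧ x + P₁.eval t ∈ S ∧ x + P₂.eval t ∈ S := by
  obtain ⟨C₁, b₁, h₁⟩ := exists_hasWindow_of_small hdeg₁ hdeg₁₂ h01 h02
  obtain ⟨C₂, T, hT, h₂⟩ := exists_hasWindow_of_large hdeg₁ hdeg₁₂
  obtain ⟨c, hc, h⟩ := exists_pattern_of_forall_hasWindow h₁ hT h₂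
  refine ⟨c, hc, fun ε hε => ?_⟩
  have hvol : ∀ N : ℝ, 1 < N → ∀ S : Set ℝ, S ⊆ Set.Icc 0 N →
      ENNReal.ofReal (ε * N) ≤ volume S → ε * N ≤ volume.real S ∧ volume.real S ≤ N := by
    intro N hN S hS hv
    have i₁ : volume S ≤ ENNReal.ofReal N := by
      have := measure_mono (μ := volume) hS
      rwa [Real.volume_Icc, sub_zero] at this
    have i₂ : volume S ≠ ⊤ := ne_top_of_le_ne_top ENNReal.ofReal_ne_top i₁
    exact ⟨(ENNReal.ofReal_le_iff_le_toReal i₂).1 hv,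
      ENNReal.toReal_le_of_le_ofReal (by linarith) i₁⟩
  rcases le_or_gt ε 1 with hε1 | hε1
  · obtain ⟨δ, hδ, hδ', hpat⟩ := h ε hε hε1
    have e : ε ^ (-6 : ℝ) = (ε ^ 6)⁻¹ := by
      rw [Real.rpow_neg hε.le]
      norm_cast
    rw [e]
    exact ⟨δ, hδ, hδ', fun N hN S hSm hS hv => hpat N hN S hSm hS (hvol N hN S hS hv).1⟩
  · refine ⟨1, one_pos, Real.exp_le_one_iff.2 (by simp [Real.exp_nonneg]),
      fun N hN S _ hS hv => ?_⟩
    have := hvol N hN S hS hv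
    nlinarith
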